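/- There exist absolute constants c > 0 and C > 0 such that for all real R ≥ 3, both of the following hold: | Σ_{r > R} μ(r)²/(r·φ(r)) − 1/R | ≤ C / ( R^{3/2} · exp( c (log R)^{3/5} (log log R)^{−1/5} ) ), and | Σ_{r > R} μ(r)²·(log r)/(r·φ(r)) − (log R + 1)/R | ≤ C / ( R^{3/2} · exp( c (log R)^{3/5} (log log R)^{−1/5} ) ), where r runs over positive integers, μ is the Möbius function, and φ is Euler's totient function. -/

import Mathlib

open Finset Real

namespace VinogradovKorobov

section MeanValue

open UnitAddTorus MeasureTheory

/-- The normalised Haar measure on the torus `(ℝ / ℤ) ^ k`. -/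
noncomputable def torusMeasure (k : ℕ) : Measure (UnitAddTorus (Fin k)) :=
  Measure.pi fun _ => AddCircle.haarAddCircle

instance (k : ℕ) : IsProbabilityMeasure (torusMeasure k) := by
  unfold torusMeasure; infer_instance

lemma integral_mFourier {k : ℕ} (n : Fin k → ℤ) :
    ∫ α, mFourier n α ∂torusMeasure k = if n = 0 then 1 else 0 := by
  have h := (orthonormal_iff_ite.1 (orthonormal_mFourier (d := Fin k))) 0 n
  simp only [ContinuousMap.inner_toLp, mFourierLp] at h
  simp only [mFourier_zero, ContinuousMap.one_apply, map_one, mul_one, eq_comm (a := (0 : Fin k → ℤ))] at h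
  exact h

lemma integrable_torus {k : ℕ} {E : Type*} [NormedAddCommGroup E] {f : UnitAddTorus (Fin k) → E}
    (hf : Continuous f) : Integrable f (torusMeasure k) :=
  hf.integrable_of_hasCompactSupport (HasCompactSupport.of_compactSpace f)

/-- The trigonometric sum over a finite family of frequencies. -/
noncomputable def trigSum {ι : Type*} {k : ℕ} (A : Finset ι) (Φ : ι → Fin k → ℤ)
    (α : UnitAddTorus (Fin k)) : ℂ := ∑ i ∈ A, mFourier (Φ i) α

@[fun_prop]
lemma continuous_trigSum {ι : Type*} {k : ℕ} (A : Finset ι) (Φ : ι → Fin k → ℤ) :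
    Continuous (trigSum A Φ) := by
  unfold trigSum
  fun_prop

lemma trigSum_mul {ι κ : Type*} {k : ℕ} (A : Finset ι) (B : Finset κ) (Φ : ι → Fin k → ℤ)
    (Ψ : κ → Fin k → ℤ) (α : UnitAddTorus (Fin k)) :
    trigSum A Φ α * trigSum B Ψ α = trigSum (A ×ˢ B) (fun i => Φ i.1 + Ψ i.2) α := by
  simp only [trigSum, Finset.sum_mul_sum, Finset.sum_product, mFourier_add]

lemma integral_trigSum_mul_conj {ι κ : Type*} {k : ℕ} (A : Finset ι) (B : Finset κ)
    (Φ : ι → Fin k → ℤ) (Ψ : κ → Fin k → ℤ) :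
    ∫ α, trigSum A Φ α * (starRingEnd ℂ) (trigSum B Ψ α) ∂torusMeasure k
      = (#{z ∈ A ×ˢ B | Φ z.1 = Ψ z.2} : ℂ) := by
  have h : ∀ α, trigSum A Φ α * (starRingEnd ℂ) (trigSum B Ψ α)
      = ∑ z ∈ A ×ˢ B, mFourier (Φ z.1 - Ψ z.2) α := by
    intro α
    simp only [trigSum, map_sum, Finset.sum_mul_sum, Finset.sum_product, ← mFourier_neg,
      ← mFourier_add, sub_eq_add_neg]
  simp_rw [h]
  rw [integral_finsetSum _ fun z _ => integrable_torus (by fun_prop)]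
  simp [integral_mFourier, sub_eq_zero]

/-- The number of coincidences `Φ i = Φ j` in a finite family. -/
def energy {ι : Type*} {k : ℕ} (A : Finset ι) (Φ : ι → Fin k → ℤ) : ℕ :=
  #{z ∈ A ×ˢ A | Φ z.1 = Φ z.2}

lemma integral_norm_sq_trigSum {ι : Type*} {k : ℕ} (A : Finset ι) (Φ : ι → Fin k → ℤ) :
    ∫ α, ‖trigSum A Φ α‖ ^ 2 ∂torusMeasure k = energy A Φ := by
  have h := integral_trigSum_mul_conj A A Φ Φ
  simp_rw [Complex.mul_conj, Complex.normSq_eq_norm_sq] at h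
  rw [integral_complex_ofReal] at h
  unfold energy
  exact_mod_cast h

lemma card_corr_le {ι κ : Type*} {k : ℕ} (A : Finset ι) (B : Finset κ)
    (Φ : ι → Fin k → ℤ) (Ψ : κ → Fin k → ℤ) :
    (#{z ∈ A ×ˢ B | Φ z.1 = Ψ z.2} : ℝ)
      ≤ ∫ α, ‖trigSum A Φ α‖ * ‖trigSum B Ψ α‖ ∂torusMeasure k := by
  have h := congrArg norm (integral_trigSum_mul_conj A B Φ Ψ)
  rw [Complex.norm_natCast] at h
  rw [← h]
  refine (norm_integral_le_integral_norm _).trans_eq ?_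
  simp

lemma card_sub_eq_le {ι : Type*} {k : ℕ} (A : Finset ι) (Φ : ι → Fin k → ℤ) (v : Fin k → ℤ) :
    #{z ∈ A ×ˢ A | Φ z.1 - Φ z.2 = v} ≤ energy A Φ := by
  have h := card_corr_le A A Φ (fun i => Φ i + v)
  have h1 : ∀ α, ‖trigSum A Φ α‖ * ‖trigSum A (fun i => Φ i + v) α‖ ≤ ‖trigSum A Φ α‖ ^ 2 := by
    intro α
    have : trigSum A (fun i => Φ i + v) α = trigSum A Φ α * mFourier v α := by
      simp [trigSum, mFourier_add, Finset.sum_mul]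
    rw [this, norm_mul, sq]
    have h2 : ‖mFourier v α‖ ≤ 1 := (ContinuousMap.norm_coe_le_norm _ _).trans mFourier_norm.le
    have := norm_nonneg (trigSum A Φ α)
    nlinarith [mul_nonneg this this]
  have h2 : ∫ α, ‖trigSum A Φ α‖ * ‖trigSum A (fun i => Φ i + v) α‖ ∂torusMeasure k ≤ energy A Φ := by
    rw [← integral_norm_sq_trigSum]
    exact integral_mono (integrable_torus (by fun_prop)) (integrable_torus (by fun_prop)) h1
  have h3 := h.trans h2
  simp only [sub_eq_iff_eq_add']
  exact_mod_cast h3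

/-- The vector of moments `(x, x², …, xᵏ)`. -/
def moments (k : ℕ) (x : ℤ) : Fin k → ℤ := fun j => x ^ ((j : ℕ) + 1)

/-- Sums of moments of a tuple. -/
def momentSum (k : ℕ) {s : ℕ} (x : Fin s → ℤ) : Fin k → ℤ := ∑ i, moments k (x i)

lemma momentSum_apply {k s : ℕ} (x : Fin s → ℤ) (j : Fin k) :
    momentSum k x j = ∑ i, x i ^ ((j : ℕ) + 1) := by
  simp [momentSum, moments]

/-- The number of solutions of the Vinogradov system of degree `k` in `2 s` variables from `I`. -/
def vinogradovCount (k s : ℕ) (I : Finset ℤ) : ℕ :=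
  energy (Fintype.piFinset fun _ : Fin s => I) (momentSum k)

lemma mFourier_sum {ι : Type*} {k : ℕ} (s : Finset ι) (f : ι → Fin k → ℤ)
    (α : UnitAddTorus (Fin k)) : mFourier (∑ i ∈ s, f i) α = ∏ i ∈ s, mFourier (f i) α := by
  classical
  induction s using Finset.induction_on with
  | empty => simp [mFourier_zero]
  | insert a s ha ih => rw [Finset.sum_insert ha, Finset.prod_insert ha, mFourier_add, ih]

lemma trigSum_piFinset {k s : ℕ} (I : Fin s → Finset ℤ) (α : UnitAddTorus (Fin k)) :
    trigSum (Fintype.piFinset I) (momentSum k) α = ∏ i, trigSum (I i) (moments k) α := by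
  simp only [trigSum, Finset.prod_univ_sum, momentSum, mFourier_sum]

lemma trigSum_pow {k : ℕ} (s : ℕ) (I : Finset ℤ) (α : UnitAddTorus (Fin k)) :
    trigSum I (moments k) α ^ s
      = trigSum (Fintype.piFinset fun _ : Fin s => I) (momentSum k) α := by
  rw [trigSum_piFinset]; simp

lemma integral_trigSum_pow {k : ℕ} (s : ℕ) (I : Finset ℤ) :
    ∫ α, ‖trigSum I (moments k) α‖ ^ (2 * s) ∂torusMeasure k = vinogradovCount k s I := by
  rw [vinogradovCount, ← integral_norm_sq_trigSum]
  congr 1 with α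
  rw [← trigSum_pow, norm_pow, ← pow_mul, mul_comm]

lemma energy_mono {ι : Type*} {k : ℕ} {A B : Finset ι} (h : A ⊆ B) (Φ : ι → Fin k → ℤ) :
    energy A Φ ≤ energy B Φ :=
  Finset.card_le_card (Finset.filter_subset_filter _ (Finset.product_subset_product h h))

lemma vinogradovCount_mono {k s : ℕ} {I I' : Finset ℤ} (h : I ⊆ I') :
    vinogradovCount k s I ≤ vinogradovCount k s I' :=
  energy_mono (Fintype.piFinset_subset _ _ fun _ => h) _

lemma trigSum_norm_le {k : ℕ} (I : Finset ℤ) (α : UnitAddTorus (Fin k)) :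
    ‖trigSum I (moments k) α‖ ≤ #I := by
  refine (norm_sum_le _ _).trans ?_
  refine (Finset.sum_le_sum fun i _ => (ContinuousMap.norm_coe_le_norm _ _).trans
    mFourier_norm.le).trans ?_
  simp

lemma vinogradovCount_add_le (k s r : ℕ) (I : Finset ℤ) :
    (vinogradovCount k (s + r) I : ℝ) ≤ (#I : ℝ) ^ (2 * r) * vinogradovCount k s I := by
  rw [← integral_trigSum_pow, ← integral_trigSum_pow, ← integral_const_mul]
  refine integral_mono (integrable_torus (by fun_prop)) (integrable_torus (by fun_prop)) fun α => ?_
  simp only [mul_add, pow_add]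
  rw [mul_comm]
  gcongr
  exact trigSum_norm_le I α

lemma vinogradovCount_le_pow (k s : ℕ) (I : Finset ℤ) :
    (vinogradovCount k s I : ℝ) ≤ (#I : ℝ) ^ (2 * s) := by
  have h : vinogradovCount k s I ≤ #I ^ (2 * s) := by
    unfold vinogradovCount energy
    refine (Finset.card_filter_le _ _).trans_eq ?_
    simp [Finset.card_product]; ring
  exact_mod_cast h

/-- Equality of power sums is invariant under translation. -/
lemma sum_sub_pow_eq {ι κ : Type*} [Fintype ι] [Fintype κ] (hc : Fintype.card ι = Fintype.card κ)
    {k : ℕ} (x : ι → ℤ) (y : κ → ℤ)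
    (h : ∀ j, 1 ≤ j → j ≤ k → ∑ i, x i ^ j = ∑ i, y i ^ j) (a : ℤ) (j : ℕ) (hj : j ≤ k) :
    ∑ i, (x i + a) ^ j = ∑ i, (y i + a) ^ j := by
  have h' : ∀ j, j ≤ k → ∑ i, x i ^ j = ∑ i, y i ^ j := by
    intro j hj
    rcases Nat.eq_zero_or_pos j with rfl | hp
    · simp [hc]
    · exact h j hp hj
  simp only [add_pow]
  rw [Finset.sum_comm, Finset.sum_comm (s := (univ : Finset κ))]
  refine Finset.sum_congr rfl fun m hm => ?_
  rw [Finset.mem_range] at hm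
  simp only [← Finset.sum_mul, h' m (by omega)]

lemma momentSum_eq_iff {k s : ℕ} (x y : Fin s → ℤ) :
    momentSum k x = momentSum k y ↔ ∀ j, 1 ≤ j → j ≤ k → ∑ i, x i ^ j = ∑ i, y i ^ j := by
  constructor
  · intro h j h1 h2
    have := congrFun h ⟨j - 1, by omega⟩
    simpa [momentSum_apply, Nat.sub_add_cancel h1] using this
  · intro h
    funext j
    simpa [momentSum_apply] using h (j + 1) (by omega) (by omega)

lemma vinogradovCount_affine_le (k s : ℕ) (I : Finset ℤ) (a : ℤ) {p : ℤ} (hp : p ≠ 0) :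
    vinogradovCount k s (I.image fun m => a + p * m) ≤ vinogradovCount k s I := by
  unfold vinogradovCount energy
  have hinj : Function.Injective fun m : ℤ => a + p * m := fun u v h => by simpa [hp] using h
  refine Finset.card_le_card_of_surjOn
    (fun z => (fun i => a + p * z.1 i, fun i => a + p * z.2 i)) ?_
  rintro ⟨x, y⟩ hz
  simp only [coe_filter, Set.mem_ofPred_eq, mem_product, Fintype.mem_piFinset, mem_image] at hz
  obtain ⟨⟨hx, hy⟩, he⟩ := hz
  choose u hu hu' using hx
  choose v hv hv' using hy
  refine ⟨(u, v), ?_, by simp [hu', hv']⟩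
  simp only [coe_filter, Set.mem_ofPred_eq, mem_product, Fintype.mem_piFinset]
  refine ⟨⟨hu, hv⟩, ?_⟩
  rw [momentSum_eq_iff] at he ⊢
  intro j h1 h2
  have := sum_sub_pow_eq rfl x y he (-a) j h2
  simp only [← hu', ← hv', add_neg_cancel_comm, mul_pow, ← Finset.mul_sum] at this
  exact mul_left_cancel₀ (pow_ne_zero j hp) this

end MeanValue

section Linnik

lemma esymm_eq_of_psum_eq {R : Type*} [CommRing R] {k : ℕ} (z w : Fin k → R)
    (hu : ∀ j : ℕ, 1 ≤ j → j ≤ k → IsUnit (j : R))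
    (h : ∀ j, 1 ≤ j → j ≤ k → ∑ i, z i ^ j = ∑ i, w i ^ j) (j : ℕ) (hj : j ≤ k) :
    MvPolynomial.aeval z (MvPolynomial.esymm (Fin k) R j)
      = MvPolynomial.aeval w (MvPolynomial.esymm (Fin k) R j) := by
  induction j using Nat.strong_induction_on with
  | _ j ih =>
    rcases Nat.eq_zero_or_pos j with rfl | hpos
    · simp
    · have key := MvPolynomial.mul_esymm_eq_sum (Fin k) R j
      have hz := congrArg (MvPolynomial.aeval z) key
      have hw := congrArg (MvPolynomial.aeval w) key
      rw [map_mul, map_natCast] at hz hw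
      refine (hu j hpos hj).mul_left_cancel ?_
      rw [hz, hw]
      simp only [map_mul, map_pow, map_neg, map_one, map_sum]
      congr 1
      refine Finset.sum_congr rfl fun a ha => ?_
      rw [Finset.mem_filter, HasAntidiagonal.mem_antidiagonal] at ha
      rw [ih a.1 ha.2 (by omega)]
      have hp := h a.2 (by omega) (by omega)
      simp only [MvPolynomial.psum, map_sum, map_pow, MvPolynomial.aeval_X, hp]

lemma prod_sub_eq_of_psum_eq {R : Type*} [CommRing R] {k : ℕ} (z w : Fin k → R)
    (hu : ∀ j : ℕ, 1 ≤ j → j ≤ k → IsUnit (j : R))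
    (h : ∀ j, 1 ≤ j → j ≤ k → ∑ i, z i ^ j = ∑ i, w i ^ j) (T : R) :
    ∏ i, (T - z i) = ∏ i, (T - w i) := by
  have expand : ∀ u : Fin k → R, ∏ i, (T - u i) = ∑ j ∈ Finset.range (k + 1),
      (-1) ^ j * (MvPolynomial.aeval u (MvPolynomial.esymm (Fin k) R j) * T ^ (k - j)) := by
    intro u
    have := congrArg (Polynomial.eval T)
      (Multiset.prod_X_sub_X_eq_sum_esymm (Multiset.map u Finset.univ.val))
    simp only [Multiset.map_map, Multiset.card_map, Finset.card_val, Finset.card_univ,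
      Fintype.card_fin, Polynomial.eval_finsetSum, Polynomial.eval_mul, Polynomial.eval_pow,
      Polynomial.eval_C, Polynomial.eval_X, Polynomial.eval_neg, Polynomial.eval_one] at this
    rw [← Finset.prod_eq_multiset_prod] at this
    simp only [MvPolynomial.aeval_esymm_eq_multiset_esymm]
    rw [← this, Polynomial.eval_prod]
    simp
  rw [expand, expand]
  refine Finset.sum_congr rfl fun j hj => ?_
  rw [esymm_eq_of_psum_eq z w hu h j (by rw [Finset.mem_range] at hj; omega)]

lemma mem_range_of_psum_modEq {k p : ℕ} (hp : p.Prime) (hk : 1 ≤ k) (hkp : k < p)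
    (x y : Fin k → ℤ) (hx : ∀ i j, i ≠ j → ¬ (p : ℤ) ∣ x i - x j) (a : ℤ)
    (h : ∀ j, 1 ≤ j → j ≤ k → (p : ℤ) ^ k ∣ ∑ i, (x i + a) ^ j - ∑ i, (y i + a) ^ j) (l : Fin k) :
    ∃ i, (p : ℤ) ^ k ∣ y l - x i := by
  have hk0 : k ≠ 0 := by omega
  have hunit : ∀ n : ℤ, IsUnit (n : ZMod (p ^ k)) ↔ ¬ (p : ℤ) ∣ n := by
    intro n
    rw [ZMod.coe_int_isUnit_iff_isCoprime, Nat.cast_pow, IsCoprime.pow_left_iff (by omega)]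
    exact (Nat.prime_iff_prime_int.1 hp).coprime_iff_not_dvd
  have hzero : ∀ n : ℤ, (n : ZMod (p ^ k)) = 0 ↔ (p : ℤ) ^ k ∣ n := by
    intro n
    rw [ZMod.intCast_zmod_eq_zero_iff_dvd]; simp
  have hprod := prod_sub_eq_of_psum_eq (fun i => ((x i + a : ℤ) : ZMod (p ^ k))) (fun i => ((y i + a : ℤ) : ZMod (p ^ k)))
    (fun j h1 h2 => by
      have := (hunit j).2 (fun hd => by
        have := Int.le_of_dvd (by omega) hd
        omega)
      simpa using this)
    (fun j h1 h2 => by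
      rw [← sub_eq_zero]
      have := (hzero _).2 (h j h1 h2)
      push_cast at this ⊢
      exact this) ((y l + a : ℤ) : ZMod (p ^ k))
  have h0 : ∏ i, (((y l + a : ℤ) : ZMod (p ^ k)) - ((y i + a : ℤ) : ZMod (p ^ k))) = 0 :=
    Finset.prod_eq_zero (Finset.mem_univ l) (sub_self _)
  rw [h0] at hprod
  by_cases hex : ∃ i, (p : ℤ) ∣ y l - x i
  · obtain ⟨i, hi⟩ := hex
    refine ⟨i, ?_⟩
    rw [← Finset.mul_prod_erase _ _ (Finset.mem_univ i)] at hprod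
    have hu : IsUnit (∏ j ∈ Finset.univ.erase i, (((y l + a : ℤ) : ZMod (p ^ k)) - ((x j + a : ℤ) : ZMod (p ^ k)))) := by
      rw [IsUnit.prod_iff]
      intro j hj
      have hne := (Finset.mem_erase.1 hj).1
      rw [← Int.cast_sub, hunit]
      intro hd
      have : (p : ℤ) ∣ x i - x j := by
        rw [show x i - x j = (y l + a - (x j + a)) - (y l - x i) by ring]
        exact dvd_sub hd hi
      exact hx i j hne.symm this
    have := hu.mul_left_eq_zero.1 hprod
    rw [← Int.cast_sub, hzero] at this
    simpa using this
  · exfalso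
    push Not at hex
    have hu : IsUnit (∏ i, (((y l + a : ℤ) : ZMod (p ^ k)) - ((x i + a : ℤ) : ZMod (p ^ k)))) := by
      rw [IsUnit.prod_iff]
      intro i _
      rw [← Int.cast_sub, hunit]
      simpa using hex i
    rw [hprod] at hu
    have hnt : Nontrivial (ZMod (p ^ k)) := by
      have : Fact (1 < p ^ k) := ⟨Nat.one_lt_pow hk0 hp.one_lt⟩
      exact ZMod.nontrivial _
    exact not_isUnit_zero hu

/-- Tuples from `[0, X)` whose entries are pairwise incongruent modulo `p`. -/
noncomputable def distinctTuples (k X p : ℕ) : Finset (Fin k → ℤ) :=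
  {x ∈ Fintype.piFinset fun _ => Finset.Ico (0 : ℤ) X | ∀ i j, i ≠ j → ¬ (p : ℤ) ∣ x i - x j}

lemma sum_fin_sub (k : ℕ) : ∑ j : Fin k, (k - 1 - (j : ℕ)) = k * (k - 1) / 2 := by
  rw [Fin.sum_univ_eq_sum_range (fun j => k - 1 - j) k, Finset.sum_range_reflect (fun j => j) k,
    Finset.sum_range_id]

lemma card_distinctTuples_modEq_le {k p X : ℕ} (hp : p.Prime) (hk : 1 ≤ k) (hkp : k < p)
    (hX : X ≤ p ^ k) (a : ℤ) (n : ℕ → ℤ) :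
    #{x ∈ distinctTuples k X p | ∀ j, 1 ≤ j → j ≤ k → (p : ℤ) ^ j ∣ ∑ i, (x i + a) ^ j - n j}
      ≤ k ^ k * p ^ (k * (k - 1) / 2) := by
  classical
  have hp0 : (p : ℤ) ≠ 0 := by exact_mod_cast hp.ne_zero
  set S := {x ∈ distinctTuples k X p | ∀ j, 1 ≤ j → j ≤ k →
    (p : ℤ) ^ j ∣ ∑ i, (x i + a) ^ j - n j} with hS
  let f : (Fin k → ℤ) → Fin k → ℤ := fun x j =>
    ((∑ i, (x i + a) ^ ((j : ℕ) + 1) - n (j + 1)) / (p : ℤ) ^ ((j : ℕ) + 1)) % (p : ℤ) ^ (k - 1 - j)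
  have him : S.image f ⊆ Fintype.piFinset fun j : Fin k => Finset.Ico (0 : ℤ) ((p ^ (k - 1 - (j : ℕ)) : ℕ) : ℤ) := by
    intro g hg
    obtain ⟨x, -, rfl⟩ := Finset.mem_image.1 hg
    rw [Fintype.mem_piFinset]
    intro j
    have hpos : (0 : ℤ) < (p : ℤ) ^ (k - 1 - (j : ℕ)) := by
      have := hp.pos
      positivity
    rw [Finset.mem_Ico]
    push_cast
    exact ⟨Int.emod_nonneg _ hpos.ne', Int.emod_lt_of_pos _ hpos⟩
  have hcard : #(S.image f) ≤ p ^ (k * (k - 1) / 2) := by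
    refine (Finset.card_le_card him).trans_eq ?_
    rw [Fintype.card_piFinset]
    simp only [Int.card_Ico, sub_zero, Int.toNat_natCast]
    rw [Finset.prod_pow_eq_pow_sum, sum_fin_sub]
  refine (Finset.card_le_mul_card_image (f := f) S (k ^ k) ?_).trans (by gcongr)
  intro g hg
  obtain ⟨x, hx, rfl⟩ := Finset.mem_image.1 hg
  have hsub : {y ∈ S | f y = f x} ⊆ Fintype.piFinset fun _ : Fin k => Finset.univ.image x := by
    intro y hy
    obtain ⟨hyS, hyf⟩ := Finset.mem_filter.1 hy
    obtain ⟨hxD, hxc⟩ := Finset.mem_filter.1 hx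
    obtain ⟨hyD, hyc⟩ := Finset.mem_filter.1 hyS
    obtain ⟨hxI, hxd⟩ := Finset.mem_filter.1 hxD
    obtain ⟨hyI, hyd⟩ := Finset.mem_filter.1 hyD
    rw [Fintype.mem_piFinset] at hxI hyI ⊢
    intro l
    obtain ⟨i, hi⟩ := mem_range_of_psum_modEq hp hk hkp x y hxd a (fun j h1 h2 => by
      have hj := congrFun hyf ⟨j - 1, by omega⟩
      simp only [f, Nat.sub_add_cancel h1] at hj
      have hd : (p : ℤ) ^ (k - 1 - (j - 1)) ∣ (∑ i, (x i + a) ^ j - n j) / (p : ℤ) ^ j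
          - (∑ i, (y i + a) ^ j - n j) / (p : ℤ) ^ j := Int.ModEq.dvd hj
      have hd2 := mul_dvd_mul_left ((p : ℤ) ^ j) hd
      rw [mul_sub, Int.mul_ediv_cancel' (hxc j h1 h2), Int.mul_ediv_cancel' (hyc j h1 h2),
        ← pow_add, show j + (k - 1 - (j - 1)) = k by omega] at hd2
      simpa using hd2) l
    rw [Finset.mem_image]
    refine ⟨i, Finset.mem_univ _, ?_⟩
    have h1 := Finset.mem_Ico.1 (hxI i)
    have h2 := Finset.mem_Ico.1 (hyI l)
    have hX' : (X : ℤ) ≤ (p : ℤ) ^ k := by exact_mod_cast hX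
    have := Int.eq_zero_of_abs_lt_dvd hi (by rw [abs_lt]; constructor <;> linarith)
    linarith
  refine (Finset.card_le_card hsub).trans ?_
  rw [Fintype.card_piFinset]
  simp only [Finset.prod_const, Finset.card_univ, Fintype.card_fin]
  gcongr
  exact Finset.card_image_le.trans_eq (by simp)

/-- The members of `[0, X)` congruent to `a` modulo `p`. -/
noncomputable def residueClass (X p : ℕ) (a : ℤ) : Finset ℤ := {x ∈ Finset.Ico (0 : ℤ) X | (p : ℤ) ∣ x - a}

lemma vinogradovCount_residueClass_le {k s X p : ℕ} (hp : 0 < p) (hX : 0 < X) {a : ℤ}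
    (ha : 0 ≤ a) (ha' : a < p) :
    vinogradovCount k s (residueClass X p a)
      ≤ vinogradovCount k s (Finset.Ico (0 : ℤ) (((X - 1) / p + 1 : ℕ) : ℤ)) := by
  refine (vinogradovCount_mono ?_).trans
    (vinogradovCount_affine_le k s _ a (p := (p : ℤ)) (by exact_mod_cast hp.ne'))
  intro x hx
  obtain ⟨hxI, m, hm⟩ := Finset.mem_filter.1 hx
  rw [Finset.mem_Ico] at hxI
  rw [Finset.mem_image]
  have hp' : (0 : ℤ) < p := by exact_mod_cast hp
  refine ⟨m, Finset.mem_Ico.2 ⟨?_, ?_⟩, by linarith⟩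
  · by_contra hneg
    have : m ≤ -1 := by omega
    nlinarith
  · push_cast [Nat.cast_sub (show 1 ≤ X from hX)]
    rw [Int.lt_add_one_iff, Int.le_ediv_iff_mul_le hp']
    nlinarith

lemma energy_distinct_residueClass_le {k s p X : ℕ} (hp : p.Prime) (hk : 1 ≤ k) (hkp : k < p)
    (hX : X ≤ p ^ k) (a : ℤ) :
    energy (distinctTuples k X p ×ˢ Fintype.piFinset fun _ : Fin s => residueClass X p a)
        (fun z => momentSum k z.1 + momentSum k z.2)
      ≤ X ^ k * (k ^ k * p ^ (k * (k - 1) / 2)) * vinogradovCount k s (residueClass X p a) := by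
  classical
  set D := distinctTuples k X p with hD
  set U := Fintype.piFinset fun _ : Fin s => residueClass X p a with hU
  let P : Finset ((Fin k → ℤ) × (Fin k → ℤ)) := {z ∈ D ×ˢ D | ∀ j, 1 ≤ j → j ≤ k →
    (p : ℤ) ^ j ∣ ∑ i, (z.1 i + -a) ^ j - ∑ i, (z.2 i + -a) ^ j}
  have hP : #P ≤ X ^ k * (k ^ k * p ^ (k * (k - 1) / 2)) := by
    have hDc : #D ≤ X ^ k := by
      refine (Finset.card_filter_le _ _).trans_eq ?_
      simp
    refine (Finset.card_le_mul_card_image_of_maps_to (f := Prod.snd) (t := D) ?_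
      (k ^ k * p ^ (k * (k - 1) / 2)) ?_).trans ?_
    · intro z hz
      exact (Finset.mem_product.1 (Finset.mem_filter.1 hz).1).2
    · intro y hy
      refine le_trans ?_ (card_distinctTuples_modEq_le hp hk hkp hX (-a)
        (fun j => ∑ i, (y i + -a) ^ j))
      refine Finset.card_le_card_of_injOn Prod.fst ?_ ?_
      · rintro ⟨x, y'⟩ hz
        simp only [P, coe_filter, Set.mem_ofPred_eq, mem_filter, mem_product] at hz ⊢
        obtain ⟨⟨⟨h1, h2⟩, h3⟩, rfl⟩ := hz
        exact ⟨h1, h3⟩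
      · rintro ⟨x, y'⟩ hz ⟨x2, y2⟩ hz2 h
        simp only [coe_filter, Set.mem_ofPred_eq] at hz hz2 h
        rw [h, hz.2, hz2.2]
    · rw [mul_comm]; gcongr
  unfold energy
  refine (Finset.card_le_mul_card_image_of_maps_to (f := fun z => (z.1.1, z.2.1)) (t := P) ?_
    (vinogradovCount k s (residueClass X p a)) ?_).trans (by rw [mul_comm]; gcongr)
  · rintro ⟨⟨x, u⟩, ⟨y, w⟩⟩ hz
    simp only [mem_product, mem_filter] at hz
    obtain ⟨⟨⟨hx, hu⟩, ⟨hy, hw⟩⟩, he⟩ := hz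
    simp only [P, mem_filter, mem_product]
    refine ⟨⟨hx, hy⟩, fun j h1 h2 => ?_⟩
    have hshift := sum_sub_pow_eq rfl (Sum.elim x u) (Sum.elim y w) (fun j h1 h2 => by
      have := congrFun he ⟨j - 1, by omega⟩
      simpa [momentSum_apply, Nat.sub_add_cancel h1] using this) (-a) j h2
    simp only [Fintype.sum_sum_type, Sum.elim_inl, Sum.elim_inr] at hshift
    have hdv : ∀ v : Fin s → ℤ, v ∈ U → (p : ℤ) ^ j ∣ ∑ i, (v i + -a) ^ j := by
      intro v hv
      refine Finset.dvd_sum fun i _ => pow_dvd_pow_of_dvd ?_ j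
      have := (Finset.mem_filter.1 (Fintype.mem_piFinset.1 hv i)).2
      simpa [sub_eq_add_neg] using this
    show (p : ℤ) ^ j ∣ ∑ i, (x i + -a) ^ j - ∑ i, (y i + -a) ^ j
    rw [show ∑ i, (x i + -a) ^ j - ∑ i, (y i + -a) ^ j
      = ∑ i, (w i + -a) ^ j - ∑ i, (u i + -a) ^ j by linarith]
    exact dvd_sub (hdv w hw) (hdv u hu)
  · rintro ⟨x, y⟩ -
    refine le_trans ?_ (card_sub_eq_le U (momentSum k) (momentSum k y - momentSum k x))
    refine Finset.card_le_card_of_injOn (fun z => (z.1.2, z.2.2)) ?_ ?_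
    · rintro ⟨⟨x', u⟩, ⟨y', w⟩⟩ hz
      simp only [coe_filter, Set.mem_ofPred_eq, mem_filter, mem_product, Prod.mk.injEq] at hz ⊢
      obtain ⟨⟨⟨⟨hx, hu⟩, ⟨hy, hw⟩⟩, he⟩, rfl, rfl⟩ := hz
      refine ⟨⟨hu, hw⟩, ?_⟩
      rw [sub_eq_sub_iff_add_eq_add, add_comm, he, add_comm]
    · rintro ⟨⟨x1, u1⟩, ⟨y1, w1⟩⟩ hz ⟨⟨x2, u2⟩, ⟨y2, w2⟩⟩ hz2 h
      simp only [coe_filter, Set.mem_ofPred_eq, Prod.mk.injEq] at hz hz2 h ⊢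
      exact ⟨⟨hz.2.1.trans hz2.2.1.symm, h.1⟩, hz.2.2.trans hz2.2.2.symm, h.2⟩

end Linnik

section Recursion

open UnitAddTorus MeasureTheory

lemma mem_residueClass {X p : ℕ} {a x : ℤ} :
    x ∈ residueClass X p a ↔ (0 ≤ x ∧ x < X) ∧ (p : ℤ) ∣ x - a := by
  simp [residueClass]

lemma residue_eq_of_dvd {p : ℕ} {a b : ℕ} (ha : a < p) (hb : b < p) {x : ℤ}
    (h1 : (p : ℤ) ∣ x - a) (h2 : (p : ℤ) ∣ x - b) : a = b := by
  have h := dvd_sub h1 h2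
  have := Int.eq_zero_of_abs_lt_dvd h (by rw [abs_lt]; constructor <;> linarith)
  omega

lemma exists_residue {p : ℕ} (hp : 0 < p) (x : ℤ) : ∃ a < p, (p : ℤ) ∣ x - (a : ℕ) := by
  refine ⟨(x % p).toNat, ?_, ?_⟩
  · have h1 := Int.emod_lt_of_pos x (show (0 : ℤ) < p by exact_mod_cast hp)
    have h2 := Int.emod_nonneg x (show (p : ℤ) ≠ 0 by exact_mod_cast hp.ne')
    omega
  · have h2 := Int.emod_nonneg x (show (p : ℤ) ≠ 0 by exact_mod_cast hp.ne')
    rw [Int.toNat_of_nonneg h2]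
    exact Int.dvd_self_sub_emod

lemma trigSum_eq_sum_residueClass {k X p : ℕ} (hp : 0 < p) (α : UnitAddTorus (Fin k)) :
    trigSum (Finset.Ico (0 : ℤ) X) (moments k) α
      = ∑ a ∈ Finset.range p, trigSum (residueClass X p a) (moments k) α := by
  classical
  unfold trigSum
  rw [← Finset.sum_biUnion]
  · refine Finset.sum_congr ?_ fun _ _ => rfl
    ext x
    simp only [Finset.mem_Ico, Finset.mem_biUnion, Finset.mem_range, mem_residueClass]
    constructor
    · intro h
      obtain ⟨a, ha, hd⟩ := exists_residue hp x
      exact ⟨a, ha, h, hd⟩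
    · rintro ⟨a, _, h, _⟩
      exact h
  · intro a ha b hb hab
    rw [Function.onFun, Finset.disjoint_left]
    intro x h1 h2
    exact hab (residue_eq_of_dvd (by simpa using ha) (by simpa using hb)
      (mem_residueClass.1 h1).2 (mem_residueClass.1 h2).2)

lemma sum_pow_le_card_pow_mul {p n : ℕ} (hp : 0 < p) (hn : 1 ≤ n) (f : ℕ → ℝ) (hf : ∀ a, 0 ≤ f a) :
    (∑ a ∈ Finset.range p, f a) ^ n ≤ (p : ℝ) ^ (n - 1) * ∑ a ∈ Finset.range p, f a ^ n := by
  have h := pow_sum_div_card_le_sum_pow (s := Finset.range p) (f := f) (fun i _ => hf i) (n - 1)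
  rw [Nat.sub_add_cancel hn, Finset.card_range, div_le_iff₀ (by positivity)] at h
  linarith

/-- Tuples from `[0, X)` with two congruent entries at prescribed places. -/
noncomputable def collidingTuples (k X p : ℕ) (i j : Fin k) : Finset (Fin k → ℤ) :=
  {x ∈ Fintype.piFinset fun _ => Finset.Ico (0 : ℤ) X | (p : ℤ) ∣ x i - x j}

lemma norm_trigSum_collidingTuples_le {k X p : ℕ} (hp : 0 < p) {i j : Fin k} (hij : i ≠ j)
    (α : UnitAddTorus (Fin k)) :
    ‖trigSum (collidingTuples k X p i j) (momentSum k) α‖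
      ≤ (∑ a ∈ Finset.range p, ‖trigSum (residueClass X p a) (moments k) α‖ ^ 2)
        * ‖trigSum (Finset.Ico (0 : ℤ) X) (moments k) α‖ ^ (k - 2) := by
  classical
  let I : ℕ → Fin k → Finset ℤ := fun a l =>
    if l = i ∨ l = j then residueClass X p a else Finset.Ico (0 : ℤ) X
  have hsub : ∀ a, residueClass X p a ⊆ Finset.Ico (0 : ℤ) X := fun a => Finset.filter_subset _ _
  have hU : collidingTuples k X p i j
      = (Finset.range p).biUnion fun a => Fintype.piFinset (I a) := by
    ext x
    simp only [collidingTuples, mem_filter, Fintype.mem_piFinset, Finset.mem_biUnion,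
      Finset.mem_range, I]
    constructor
    · rintro ⟨h1, h2⟩
      obtain ⟨a, ha, hd⟩ := exists_residue hp (x i)
      refine ⟨a, ha, fun l => ?_⟩
      split_ifs with hl
      · rw [mem_residueClass]
        refine ⟨Finset.mem_Ico.1 (h1 l), ?_⟩
        rcases hl with rfl | rfl
        · exact hd
        · rw [show x l - (a : ℤ) = (x i - a) - (x i - x l) by ring]
          exact dvd_sub hd h2
      · exact h1 l
    · rintro ⟨a, _, h⟩
      refine ⟨fun l => ?_, ?_⟩
      · have := h l
        split_ifs at this
        · exact hsub _ this
        · exact this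
      · have h1 := h i
        have h2 := h j
        rw [if_pos (Or.inl rfl), mem_residueClass] at h1
        rw [if_pos (Or.inr rfl), mem_residueClass] at h2
        rw [show x i - x j = (x i - (a : ℤ)) - (x j - a) by ring]
        exact dvd_sub h1.2 h2.2
  have hdisj : (↑(Finset.range p) : Set ℕ).PairwiseDisjoint fun a => Fintype.piFinset (I a) := by
    intro a ha b hb hab
    rw [Function.onFun, Finset.disjoint_left]
    intro x h1 h2
    have h1 := Fintype.mem_piFinset.1 h1 i
    have h2 := Fintype.mem_piFinset.1 h2 i
    simp only [I, true_or, if_true] at h1 h2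
    exact hab (residue_eq_of_dvd (by simpa using ha) (by simpa using hb)
      (mem_residueClass.1 h1).2 (mem_residueClass.1 h2).2)
  have hsplit : trigSum (collidingTuples k X p i j) (momentSum k) α
      = ∑ a ∈ Finset.range p, trigSum (Fintype.piFinset (I a)) (momentSum k) α := by
    rw [hU]
    exact Finset.sum_biUnion hdisj
  rw [hsplit, Finset.sum_mul]
  refine (norm_sum_le _ _).trans_eq (Finset.sum_congr rfl fun a _ => ?_)
  rw [trigSum_piFinset, norm_prod]
  have : ∀ l, ‖trigSum (I a l) (moments k) α‖ = if l = i ∨ l = j then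
      ‖trigSum (residueClass X p a) (moments k) α‖
      else ‖trigSum (Finset.Ico (0 : ℤ) X) (moments k) α‖ := by
    intro l
    simp only [I]
    split_ifs <;> rfl
  simp_rw [this]
  rw [Finset.prod_ite, Finset.prod_const, Finset.prod_const]
  have hc : (Finset.univ.filter fun l => l = i ∨ l = j) = {i, j} := by
    ext l; simp
  have hc2 : #(Finset.univ.filter fun l => l = i ∨ l = j) = 2 := by
    rw [hc, Finset.card_pair hij]
  have hc3 : #(Finset.univ.filter fun l => ¬ (l = i ∨ l = j)) = k - 2 := by
    rw [Finset.filter_not, Finset.card_sdiff_of_subset (Finset.filter_subset _ _), hc2]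
    simp
  rw [hc2, hc3]

/-- Tuples from `[0, X)` with at least two congruent entries. -/
noncomputable def nonDistinctTuples (k X p : ℕ) : Finset (Fin k → ℤ) :=
  {x ∈ Fintype.piFinset fun _ => Finset.Ico (0 : ℤ) X | ¬ ∀ i j, i ≠ j → ¬ (p : ℤ) ∣ x i - x j}

lemma integral_nonDistinct_le {k s X p : ℕ} (hp : 0 < p) (hk : 2 ≤ k) :
    ∫ α, ‖trigSum (nonDistinctTuples k X p) (momentSum k) α‖ ^ 2
        * ‖trigSum (Finset.Ico (0 : ℤ) X) (moments k) α‖ ^ (2 * s) ∂torusMeasure k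
      ≤ (k : ℝ) ^ 2 * ∫ α, (∑ a ∈ Finset.range p,
          ‖trigSum (residueClass X p a) (moments k) α‖ ^ 2)
        * ‖trigSum (Finset.Ico (0 : ℤ) X) (moments k) α‖ ^ (2 * (k + s) - 2) ∂torusMeasure k := by
  classical
  set V := Fintype.piFinset fun _ : Fin s => Finset.Ico (0 : ℤ) X with hV
  set W := Fintype.piFinset fun _ : Fin k => Finset.Ico (0 : ℤ) X with hW
  let Φ : (Fin k → ℤ) × (Fin s → ℤ) → Fin k → ℤ := fun z => momentSum k z.1 + momentSum k z.2
  set Q : UnitAddTorus (Fin k) → ℝ := fun α =>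
    ∑ a ∈ Finset.range p, ‖trigSum (residueClass X p a) (moments k) α‖ ^ 2 with hQ
  have h1 : ∫ α, ‖trigSum (nonDistinctTuples k X p) (momentSum k) α‖ ^ 2
        * ‖trigSum (Finset.Ico (0 : ℤ) X) (moments k) α‖ ^ (2 * s) ∂torusMeasure k
      = energy (nonDistinctTuples k X p ×ˢ V) Φ := by
    rw [← integral_norm_sq_trigSum]
    congr 1 with α
    rw [← trigSum_mul, norm_mul, mul_pow, ← trigSum_pow, norm_pow, ← pow_mul, mul_comm s 2]
  rw [h1]
  let P : Finset (Fin k × Fin k) := Finset.univ.offDiag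
  have h2 : energy (nonDistinctTuples k X p ×ˢ V) Φ ≤ ∑ q ∈ P,
      #{z ∈ (collidingTuples k X p q.1 q.2 ×ˢ V) ×ˢ (W ×ˢ V) | Φ z.1 = Φ z.2} := by
    refine (Finset.card_le_card ?_).trans Finset.card_biUnion_le
    rintro ⟨⟨x, u⟩, ⟨y, w⟩⟩ hz
    simp only [mem_filter, mem_product, nonDistinctTuples, collidingTuples, mem_biUnion] at hz ⊢
    obtain ⟨⟨⟨⟨hx, hx'⟩, hu⟩, ⟨hy, -⟩, hw⟩, he⟩ := hz
    push Not at hx'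
    obtain ⟨i, j, hij, hd⟩ := hx'
    exact ⟨(i, j), by simpa [P] using hij, ⟨⟨⟨hx, hd⟩, hu⟩, hy, hw⟩, he⟩
  have h3 : ∀ q ∈ P,
      (#{z ∈ (collidingTuples k X p q.1 q.2 ×ˢ V) ×ˢ (W ×ˢ V) | Φ z.1 = Φ z.2} : ℝ)
      ≤ ∫ α, Q α * ‖trigSum (Finset.Ico (0 : ℤ) X) (moments k) α‖ ^ (2 * (k + s) - 2)
        ∂torusMeasure k := by
    intro q hq
    have hne : q.1 ≠ q.2 := by simpa [P] using hq
    refine (card_corr_le _ _ _ _).trans ?_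
    refine integral_mono (integrable_torus (by fun_prop)) (integrable_torus (by fun_prop)) fun α => ?_
    simp only [Φ]
    rw [← trigSum_mul, ← trigSum_mul, norm_mul, norm_mul, ← trigSum_pow, ← trigSum_pow]
    simp only [norm_pow]
    calc _ ≤ (Q α * ‖trigSum (Finset.Ico (0 : ℤ) X) (moments k) α‖ ^ (k - 2)
          * ‖trigSum (Finset.Ico (0 : ℤ) X) (moments k) α‖ ^ s)
          * (‖trigSum (Finset.Ico (0 : ℤ) X) (moments k) α‖ ^ k
          * ‖trigSum (Finset.Ico (0 : ℤ) X) (moments k) α‖ ^ s) := by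
          gcongr
          exact norm_trigSum_collidingTuples_le hp hne α
      _ = _ := by
          rw [show 2 * (k + s) - 2 = (k - 2) + s + (k + s) by omega]
          ring
  have h4 : (energy (nonDistinctTuples k X p ×ˢ V) Φ : ℝ) ≤ ∑ q ∈ P,
      ∫ α, Q α * ‖trigSum (Finset.Ico (0 : ℤ) X) (moments k) α‖ ^ (2 * (k + s) - 2)
        ∂torusMeasure k := by
    refine le_trans ?_ (Finset.sum_le_sum h3)
    exact_mod_cast h2
  refine h4.trans ?_
  rw [Finset.sum_const, nsmul_eq_mul]
  gcongr
  have : #P ≤ k ^ 2 := by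
    simp only [P, Finset.offDiag_card]
    simp [sq]
  exact_mod_cast this

lemma young_pow {q f : ℝ} (hq : 0 ≤ q) (hf : 0 ≤ f) {b : ℕ} (hb : 1 ≤ b) :
    q * f ^ (2 * b - 2) ≤ 4⁻¹ * f ^ (2 * b) + 4⁻¹ * (4 * q) ^ b := by
  have e : f ^ (2 * b) = f ^ 2 * f ^ (2 * b - 2) := by rw [← pow_add]; congr 1; omega
  rcases le_total (4 * q) (f ^ 2) with h | h
  · have : 4 * q * f ^ (2 * b - 2) ≤ f ^ 2 * f ^ (2 * b - 2) := by gcongr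
    have : 0 ≤ (4 * q) ^ b := by positivity
    linarith
  · have h2 : f ^ (2 * b - 2) ≤ (4 * q) ^ (b - 1) := by
      rw [show 2 * b - 2 = 2 * (b - 1) by omega, pow_mul]
      gcongr
    have h3 : 4 * q * f ^ (2 * b - 2) ≤ 4 * q * (4 * q) ^ (b - 1) := by gcongr
    have e2 : 4 * q * (4 * q) ^ (b - 1) = (4 * q) ^ b := by
      rw [← pow_succ', Nat.sub_add_cancel hb]
    have : 0 ≤ f ^ (2 * b) := by positivity
    linarith

lemma integral_distinct_le {k s X p : ℕ} (hp : p.Prime) (hk : 1 ≤ k) (hkp : k < p)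
    (hX : X ≤ p ^ k) (hX0 : 0 < X) (hs : 1 ≤ s) :
    ∫ α, ‖trigSum (distinctTuples k X p) (momentSum k) α‖ ^ 2
        * ‖trigSum (Finset.Ico (0 : ℤ) X) (moments k) α‖ ^ (2 * s) ∂torusMeasure k
      ≤ (p : ℝ) ^ (2 * s) * ((X : ℝ) ^ k * (k ^ k * p ^ (k * (k - 1) / 2))
        * vinogradovCount k s (Finset.Ico (0 : ℤ) (((X - 1) / p + 1 : ℕ) : ℤ))) := by
  set M := (X : ℝ) ^ k * (k ^ k * p ^ (k * (k - 1) / 2))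
        * vinogradovCount k s (Finset.Ico (0 : ℤ) (((X - 1) / p + 1 : ℕ) : ℤ)) with hM
  have hpt : ∀ α, ‖trigSum (distinctTuples k X p) (momentSum k) α‖ ^ 2
        * ‖trigSum (Finset.Ico (0 : ℤ) X) (moments k) α‖ ^ (2 * s)
      ≤ (p : ℝ) ^ (2 * s - 1) * ∑ a ∈ Finset.range p,
        ‖trigSum (distinctTuples k X p) (momentSum k) α‖ ^ 2
        * ‖trigSum (residueClass X p a) (moments k) α‖ ^ (2 * s) := by
    intro α
    rw [← Finset.mul_sum, mul_left_comm]
    gcongr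
    rw [trigSum_eq_sum_residueClass hp.pos]
    refine (pow_le_pow_left₀ (norm_nonneg _) (norm_sum_le _ _) _).trans ?_
    exact sum_pow_le_card_pow_mul hp.pos (by omega)
      (fun a => ‖trigSum (residueClass X p a) (moments k) α‖) fun a => norm_nonneg _
  refine (integral_mono (integrable_torus (by fun_prop)) (integrable_torus (by fun_prop)) hpt).trans ?_
  rw [integral_const_mul, integral_finsetSum _ fun a _ => integrable_torus (by fun_prop)]
  have hterm : ∀ a ∈ Finset.range p, ∫ α, ‖trigSum (distinctTuples k X p) (momentSum k) α‖ ^ 2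
        * ‖trigSum (residueClass X p a) (moments k) α‖ ^ (2 * s) ∂torusMeasure k ≤ M := by
    intro a ha
    have h1 := energy_distinct_residueClass_le (s := s) hp hk hkp hX (a : ℤ)
    have h2 := vinogradovCount_residueClass_le (k := k) (s := s) (a := a) hp.pos hX0 (by omega)
      (by simpa using ha)
    have h3 := h1.trans (Nat.mul_le_mul_left _ h2)
    have h4 : (energy (distinctTuples k X p ×ˢ Fintype.piFinset fun _ : Fin s => residueClass X p a)
        (fun z => momentSum k z.1 + momentSum k z.2) : ℝ) ≤ M := by
      rw [hM]
      exact_mod_cast h3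
    refine le_trans (le_of_eq ?_) h4
    rw [← integral_norm_sq_trigSum]
    congr 1 with α
    rw [← trigSum_mul, norm_mul, mul_pow, ← trigSum_pow, norm_pow, ← pow_mul, mul_comm s 2]
  refine (mul_le_mul_of_nonneg_left (Finset.sum_le_sum hterm) (by positivity)).trans_eq ?_
  rw [Finset.sum_const, Finset.card_range, nsmul_eq_mul, ← mul_assoc, ← pow_succ]
  congr 2
  omega

lemma integral_square_pow_le {k b X p : ℕ} (hp : 0 < p) (hX0 : 0 < X) (hb : 1 ≤ b) :
    ∫ α, (∑ a ∈ Finset.range p, ‖trigSum (residueClass X p a) (moments k) α‖ ^ 2) ^ b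
        ∂torusMeasure k
      ≤ (p : ℝ) ^ b * vinogradovCount k b (Finset.Ico (0 : ℤ) (((X - 1) / p + 1 : ℕ) : ℤ)) := by
  have hpt : ∀ α : UnitAddTorus (Fin k),
      (∑ a ∈ Finset.range p, ‖trigSum (residueClass X p a) (moments k) α‖ ^ 2) ^ b
      ≤ (p : ℝ) ^ (b - 1) * ∑ a ∈ Finset.range p,
        ‖trigSum (residueClass X p a) (moments k) α‖ ^ (2 * b) := by
    intro α
    simp only [pow_mul]
    exact sum_pow_le_card_pow_mul hp hb
      (fun a => ‖trigSum (residueClass X p a) (moments k) α‖ ^ 2) fun a => by positivity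
  refine (integral_mono (integrable_torus (by fun_prop)) (integrable_torus (by fun_prop)) hpt).trans ?_
  rw [integral_const_mul, integral_finsetSum _ fun a _ => integrable_torus (by fun_prop)]
  have hterm : ∀ a ∈ Finset.range p, ∫ α, ‖trigSum (residueClass X p a) (moments k) α‖ ^ (2 * b)
      ∂torusMeasure k
      ≤ vinogradovCount k b (Finset.Ico (0 : ℤ) (((X - 1) / p + 1 : ℕ) : ℤ)) := by
    intro a ha
    rw [integral_trigSum_pow]
    exact_mod_cast vinogradovCount_residueClass_le (k := k) (s := b) (a := a) hp hX0 (by omega)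
      (by simpa using ha)
  refine (mul_le_mul_of_nonneg_left (Finset.sum_le_sum hterm) (by positivity)).trans_eq ?_
  rw [Finset.sum_const, Finset.card_range, nsmul_eq_mul, ← mul_assoc, ← pow_succ,
    Nat.sub_add_cancel hb]

lemma le_of_moment_bounds {J I₁ I₂ I₃ I₄ K B D : ℝ} (hJ : 0 ≤ J) (h2 : J ≤ 2 * I₂ + 2 * I₁)
    (h3 : I₁ ≤ K * I₃) (h5 : 2 * K * I₃ ≤ 4⁻¹ * J + 4⁻¹ * I₄) (h6 : I₂ ≤ B) (h8 : I₄ ≤ D)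
    (hD : 0 ≤ D) : J ≤ 4 * B + D := by
  linarith

/-- The recursive inequality of Linnik and Karatsuba. -/
lemma vinogradovCount_recursion {k s X p : ℕ} (hp : p.Prime) (hk : 2 ≤ k) (hkp : k < p)
    (hX : X ≤ p ^ k) (hX0 : 0 < X) (hs : 1 ≤ s) :
    (vinogradovCount k (k + s) (Finset.Ico (0 : ℤ) X) : ℝ)
      ≤ 4 * ((p : ℝ) ^ (2 * s) * ((X : ℝ) ^ k * (k ^ k * p ^ (k * (k - 1) / 2))
        * vinogradovCount k s (Finset.Ico (0 : ℤ) (((X - 1) / p + 1 : ℕ) : ℤ))))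
      + (8 * (k : ℝ) ^ 2) ^ (k + s) * ((p : ℝ) ^ (k + s)
        * vinogradovCount k (k + s) (Finset.Ico (0 : ℤ) (((X - 1) / p + 1 : ℕ) : ℤ))) := by
  set F : UnitAddTorus (Fin k) → ℂ := trigSum (Finset.Ico (0 : ℤ) X) (moments k) with hF
  set G : UnitAddTorus (Fin k) → ℂ := trigSum (distinctTuples k X p) (momentSum k) with hG
  set E : UnitAddTorus (Fin k) → ℂ := trigSum (nonDistinctTuples k X p) (momentSum k) with hE
  set Q : UnitAddTorus (Fin k) → ℝ := fun α =>
    ∑ a ∈ Finset.range p, ‖trigSum (residueClass X p a) (moments k) α‖ ^ 2 with hQ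
  have cF : Continuous F := continuous_trigSum _ _
  have cG : Continuous G := continuous_trigSum _ _
  have cE : Continuous E := continuous_trigSum _ _
  have cQ : Continuous Q := by fun_prop
  have hJ := integral_trigSum_pow (k := k) (k + s) (Finset.Ico (0 : ℤ) X)
  have hFGE : ∀ α, F α ^ k = G α + E α := by
    intro α
    rw [hF, trigSum_pow]
    simp only [hG, hE, trigSum, distinctTuples, nonDistinctTuples]
    rw [Finset.sum_filter_add_sum_filter_not]
  have h1 : ∀ α, ‖F α‖ ^ (2 * (k + s)) ≤ 2 * (‖G α‖ ^ 2 * ‖F α‖ ^ (2 * s))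
      + 2 * (‖E α‖ ^ 2 * ‖F α‖ ^ (2 * s)) := by
    intro α
    rw [show 2 * (k + s) = k * 2 + 2 * s by ring, pow_add, pow_mul, ← norm_pow, hFGE]
    have h : ‖G α + E α‖ ^ 2 ≤ 2 * ‖G α‖ ^ 2 + 2 * ‖E α‖ ^ 2 := by
      have h0 := norm_add_le (G α) (E α)
      have := pow_le_pow_left₀ (norm_nonneg _) h0 2
      nlinarith [sq_nonneg (‖G α‖ - ‖E α‖)]
    have h' : 0 ≤ ‖F α‖ ^ (2 * s) := by positivity
    nlinarith
  have h2 := integral_mono (μ := torusMeasure k) (integrable_torus (by fun_prop))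
    (integrable_torus (by fun_prop)) h1
  rw [integral_add (integrable_torus (by fun_prop)) (integrable_torus (by fun_prop)),
    integral_const_mul, integral_const_mul, hJ] at h2
  have h3 := integral_nonDistinct_le (s := s) (X := X) hp.pos hk
  have h4 : ∀ α, (2 * (k : ℝ) ^ 2 * Q α) * ‖F α‖ ^ (2 * (k + s) - 2)
      ≤ 4⁻¹ * ‖F α‖ ^ (2 * (k + s)) + 4⁻¹ * ((8 * (k : ℝ) ^ 2) ^ (k + s) * Q α ^ (k + s)) := by
    intro α
    have hQ0 : 0 ≤ Q α := by positivity
    have := young_pow (q := 2 * (k : ℝ) ^ 2 * Q α) (f := ‖F α‖) (by positivity) (norm_nonneg _)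
      (b := k + s) (by omega)
    rw [show 4 * (2 * (k : ℝ) ^ 2 * Q α) = 8 * (k : ℝ) ^ 2 * Q α by ring, mul_pow _ (Q α)] at this
    exact this
  have h5 := integral_mono (μ := torusMeasure k) (integrable_torus (by fun_prop))
    (integrable_torus (by fun_prop)) h4
  rw [integral_add (integrable_torus (by fun_prop)) (integrable_torus (by fun_prop)),
    integral_const_mul, integral_const_mul, integral_const_mul, hJ] at h5
  simp only [mul_assoc (2 * (k : ℝ) ^ 2)] at h5
  rw [integral_const_mul] at h5
  have h6 : ∫ α, ‖G α‖ ^ 2 * ‖F α‖ ^ (2 * s) ∂torusMeasure k ≤ _ :=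
    integral_distinct_le (s := s) hp (by omega) hkp hX hX0 hs
  have h7 : ∫ α, Q α ^ (k + s) ∂torusMeasure k ≤ _ :=
    integral_square_pow_le (k := k) (b := k + s) hp.pos hX0 (by omega)
  have h8 := mul_le_mul_of_nonneg_left h7 (show 0 ≤ (8 * (k : ℝ) ^ 2) ^ (k + s) by positivity)
  have h3' : ∫ α, ‖E α‖ ^ 2 * ‖F α‖ ^ (2 * s) ∂torusMeasure k ≤ _ := h3
  exact le_of_moment_bounds (Nat.cast_nonneg _) h2 h3' h5 h6 h8
    (mul_nonneg (by positivity) (mul_nonneg (by positivity) (Nat.cast_nonneg _)))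

end Recursion

section MeanValue

/-- Choice of the prime for one step of the recursion. -/
lemma exists_prime_near_root {k X : ℕ} (hk : 3 ≤ k) (hX : (k : ℝ) ^ k < X) :
    ∃ p : ℕ, p.Prime ∧ k < p ∧ X ≤ p ^ k ∧ (X : ℝ) ^ ((k : ℝ)⁻¹) ≤ p
      ∧ (p : ℝ) ≤ 4 * (X : ℝ) ^ ((k : ℝ)⁻¹) ∧ p ≤ X := by
  set x := (X : ℝ) ^ ((k : ℝ)⁻¹) with hx
  have hk0 : (3 : ℝ) ≤ k := by exact_mod_cast hk
  have hxk : x ^ k = X := by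
    rw [hx, Real.rpow_inv_natCast_pow (by positivity) (by omega)]
  have hkx : (k : ℝ) < x := by
    rw [← hxk] at hX
    exact lt_of_pow_lt_pow_left₀ k (by positivity) hX
  obtain ⟨p, hp, hrp, hpr⟩ := Nat.exists_prime_lt_and_le_two_mul ⌈x⌉₊
    (by have := Nat.ceil_pos.2 (show 0 < x by linarith); omega)
  have h1 : x ≤ ⌈x⌉₊ := Nat.le_ceil x
  have h2 : (⌈x⌉₊ : ℝ) < x + 1 := Nat.ceil_lt_add_one (by linarith)
  have h3 : (⌈x⌉₊ : ℝ) < p := by exact_mod_cast hrp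
  have h4 : (p : ℝ) ≤ 2 * ⌈x⌉₊ := by exact_mod_cast hpr
  refine ⟨p, hp, ?_, ?_, by linarith, by linarith, ?_⟩
  · have : (k : ℝ) < p := by linarith
    exact_mod_cast this
  · have : (X : ℝ) ≤ (p : ℝ) ^ k := by
      rw [← hxk]; gcongr; linarith
    exact_mod_cast this
  · have : (p : ℝ) ≤ X := by
      rw [← hxk]
      calc (p : ℝ) ≤ 4 * x := by linarith
        _ ≤ x ^ 3 := by nlinarith [mul_pos (show 0 < x by linarith) (show 0 < x by linarith)]
        _ ≤ x ^ k := pow_le_pow_right₀ (by linarith) hk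
    exact_mod_cast this

lemma vinogradovCount_step {k s X : ℕ} {η D : ℝ} (hk : 3 ≤ k) (hs : k ^ 2 ≤ s)
    (hη : 0 ≤ η) (hη' : η ≤ k * (k + 1) / 2) (hD : 0 ≤ D)
    (ih : ∀ Y : ℕ, 0 < Y → (vinogradovCount k s (Finset.Ico (0 : ℤ) Y) : ℝ)
      ≤ D * (Y : ℝ) ^ (2 * s - k * (k + 1) / 2 + η : ℝ))
    (hX : (k : ℝ) ^ k < X) :
    (vinogradovCount k (k + s) (Finset.Ico (0 : ℤ) X) : ℝ)
      ≤ (4 * k ^ k * 2 ^ (2 * s) * 4 ^ (k ^ 2) + (8 * k ^ 2) ^ (k + s) * 2 ^ (2 * k + 2 * s)) * D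
        * (X : ℝ) ^ (2 * ((k + s : ℕ) : ℝ) - k * (k + 1) / 2 + η * (1 - (k : ℝ)⁻¹)) := by
  obtain ⟨p, hp, hkp, hpk, hxp, hpx, hpX⟩ := exists_prime_near_root hk hX
  have hX0 : 0 < X := by have := hp.pos; omega
  have hrec := vinogradovCount_recursion (s := s) hp (by omega) hkp hpk hX0
    (by nlinarith)
  set Y : ℕ := (X - 1) / p + 1 with hY
  set E : ℝ := 2 * s - k * (k + 1) / 2 + η with hE
  have hk0 : (3 : ℝ) ≤ k := by exact_mod_cast hk
  have hs0 : (k : ℝ) ^ 2 ≤ s := by exact_mod_cast hs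
  have hκ : (k : ℝ) * (k + 1) / 2 ≤ (k : ℝ) ^ 2 := by
    have := mul_nonneg (show (0 : ℝ) ≤ k by linarith) (show (0 : ℝ) ≤ k - 1 by linarith)
    linarith
  have hE0 : 0 ≤ E := by rw [hE]; linarith [sq_nonneg (k : ℝ)]
  have hE1 : E ≤ 2 * s := by linarith
  have hp0 : (0 : ℝ) < p := by exact_mod_cast hp.pos
  have hp1 : (1 : ℝ) ≤ p := by exact_mod_cast hp.one_le
  have hXr : (0 : ℝ) < X := by exact_mod_cast hX0
  have hYle : (Y : ℝ) ≤ 2 * (X / p) := by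
    have h1 : (((X - 1) / p : ℕ) : ℝ) ≤ X / p :=
      (Nat.cast_le.2 (Nat.div_le_div_right (Nat.sub_le X 1))).trans Nat.cast_div_le
    have h2 : (1 : ℝ) ≤ X / p := by
      rw [le_div_iff₀ hp0]; simpa using hpX
    rw [hY]; push_cast; linarith
  have hY0 : 0 < Y := Nat.succ_pos _
  have hYr : (0 : ℝ) < Y := by exact_mod_cast hY0
  have hJ := ih Y hY0
  have hJ2 : (vinogradovCount k (k + s) (Finset.Ico (0 : ℤ) Y) : ℝ)
      ≤ (Y : ℝ) ^ (2 * k) * (D * (Y : ℝ) ^ E) := by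
    rw [add_comm k s]
    refine (vinogradovCount_add_le k s k _).trans ?_
    simp only [Int.card_Ico, sub_zero, Int.toNat_natCast]
    gcongr
  have hYE : (Y : ℝ) ^ E ≤ 2 ^ (2 * s) * ((X : ℝ) ^ E * (p : ℝ) ^ (-E)) := by
    calc (Y : ℝ) ^ E ≤ (2 * (X / p)) ^ E := by gcongr
      _ = 2 ^ E * ((X : ℝ) ^ E * (p : ℝ) ^ (-E)) := by
        rw [Real.mul_rpow (by norm_num) (by positivity), Real.div_rpow (by positivity) (by positivity),
          Real.rpow_neg hp0.le]
        rfl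
      _ ≤ _ := by
        gcongr
        rw [← Real.rpow_natCast]
        push_cast
        gcongr
        norm_num
  have hYk : (Y : ℝ) ^ (2 * k) ≤ 2 ^ (2 * k) * (X : ℝ) ^ (2 * k) * (p : ℝ) ^ (-(2 * k : ℝ)) := by
    calc (Y : ℝ) ^ (2 * k) ≤ (2 * (X / p)) ^ (2 * k) := by gcongr
      _ = _ := by
        rw [Real.rpow_neg hp0.le, show (2 * k : ℝ) = ((2 * k : ℕ) : ℝ) by push_cast; ring,
          Real.rpow_natCast, mul_pow, div_pow]
        ring
  set x := (X : ℝ) ^ ((k : ℝ)⁻¹) with hx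
  have hx0 : 0 < x := by positivity
  have hx1 : ∀ e : ℝ, x ^ e = (X : ℝ) ^ (e / k) := by
    intro e
    rw [hx, ← Real.rpow_mul hXr.le]; congr 1; ring
  have hη2 : η ≤ k ^ 2 := by linarith
  -- the exponents of `p`
  have hpow1 : (p : ℝ) ^ (2 * s) * (p : ℝ) ^ (k * (k - 1) / 2) * (p : ℝ) ^ (-E)
      ≤ 4 ^ (k ^ 2) * (X : ℝ) ^ (k - η / k) := by
    have hh : ((k * (k - 1) / 2 : ℕ) : ℝ) = k * (k - 1) / 2 := by
      rw [Nat.cast_div ((Nat.even_mul_pred_self k).two_dvd) (by norm_num)]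
      push_cast [Nat.cast_sub (show 1 ≤ k by omega)]
      ring
    calc (p : ℝ) ^ (2 * s) * (p : ℝ) ^ (k * (k - 1) / 2) * (p : ℝ) ^ (-E)
        = (p : ℝ) ^ ((k : ℝ) ^ 2 - η) := by
          rw [← Real.rpow_natCast, ← Real.rpow_natCast, ← Real.rpow_add hp0, ← Real.rpow_add hp0, hh]
          congr 1
          rw [hE]; push_cast; ring
      _ ≤ (4 * x) ^ ((k : ℝ) ^ 2 - η) := Real.rpow_le_rpow hp0.le hpx (by linarith)
      _ = 4 ^ ((k : ℝ) ^ 2 - η) * x ^ ((k : ℝ) ^ 2 - η) := by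
          rw [Real.mul_rpow (by norm_num) hx0.le]
      _ ≤ _ := by
          rw [hx1, show ((k : ℝ) ^ 2 - η) / k = k - η / k by field_simp]
          gcongr
          rw [← Real.rpow_natCast 4 (k ^ 2)]
          refine Real.rpow_le_rpow_of_exponent_le (by norm_num) ?_
          push_cast
          linarith
  have hpow2 : (p : ℝ) ^ (k + s) * (p : ℝ) ^ (-E) * (p : ℝ) ^ (-(2 * k : ℝ))
      ≤ (X : ℝ) ^ (-(η / k)) := by
    calc (p : ℝ) ^ (k + s) * (p : ℝ) ^ (-E) * (p : ℝ) ^ (-(2 * k : ℝ))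
        = (p : ℝ) ^ (-(s : ℝ) - k + k * (k + 1) / 2 - η) := by
          rw [← Real.rpow_natCast, ← Real.rpow_add hp0, ← Real.rpow_add hp0]
          congr 1
          rw [hE]; push_cast; ring
      _ ≤ (p : ℝ) ^ (-η) := by
          apply Real.rpow_le_rpow_of_exponent_le hp1
          linarith
      _ ≤ x ^ (-η) := Real.rpow_le_rpow_of_nonpos hx0 hxp (by linarith)
      _ = _ := by rw [hx1, neg_div]
  refine hrec.trans ?_
  have hexp1 : (X : ℝ) ^ k * (X : ℝ) ^ E * (X : ℝ) ^ (k - η / k)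
      = (X : ℝ) ^ (2 * ((k + s : ℕ) : ℝ) - k * (k + 1) / 2 + η * (1 - (k : ℝ)⁻¹)) := by
    rw [← Real.rpow_natCast, ← Real.rpow_add hXr, ← Real.rpow_add hXr]
    congr 1
    rw [hE]; push_cast; ring
  have hexp2 : (X : ℝ) ^ (2 * k) * (X : ℝ) ^ E * (X : ℝ) ^ (-(η / k))
      = (X : ℝ) ^ (2 * ((k + s : ℕ) : ℝ) - k * (k + 1) / 2 + η * (1 - (k : ℝ)⁻¹)) := by
    rw [← Real.rpow_natCast, ← Real.rpow_add hXr, ← Real.rpow_add hXr]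
    congr 1
    rw [hE]; push_cast; ring
  have t1 : 4 * ((p : ℝ) ^ (2 * s) * ((X : ℝ) ^ k * (k ^ k * p ^ (k * (k - 1) / 2))
        * vinogradovCount k s (Finset.Ico (0 : ℤ) Y)))
      ≤ 4 * k ^ k * 2 ^ (2 * s) * 4 ^ (k ^ 2) * D
        * (X : ℝ) ^ (2 * ((k + s : ℕ) : ℝ) - k * (k + 1) / 2 + η * (1 - (k : ℝ)⁻¹)) := by
    calc _ ≤ 4 * ((p : ℝ) ^ (2 * s) * ((X : ℝ) ^ k * (k ^ k * p ^ (k * (k - 1) / 2))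
        * (D * (2 ^ (2 * s) * ((X : ℝ) ^ E * (p : ℝ) ^ (-E)))))) := by
          gcongr
          exact hJ.trans (by gcongr)
      _ = 4 * k ^ k * 2 ^ (2 * s) * D * (X : ℝ) ^ k * (X : ℝ) ^ E
          * ((p : ℝ) ^ (2 * s) * (p : ℝ) ^ (k * (k - 1) / 2) * (p : ℝ) ^ (-E)) := by ring
      _ ≤ 4 * k ^ k * 2 ^ (2 * s) * D * (X : ℝ) ^ k * (X : ℝ) ^ E
          * (4 ^ (k ^ 2) * (X : ℝ) ^ (k - η / k)) := by gcongr
      _ = _ := by rw [← hexp1]; ring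
  have t2 : (8 * (k : ℝ) ^ 2) ^ (k + s) * ((p : ℝ) ^ (k + s)
        * vinogradovCount k (k + s) (Finset.Ico (0 : ℤ) Y))
      ≤ (8 * k ^ 2) ^ (k + s) * 2 ^ (2 * k + 2 * s) * D
        * (X : ℝ) ^ (2 * ((k + s : ℕ) : ℝ) - k * (k + 1) / 2 + η * (1 - (k : ℝ)⁻¹)) := by
    calc _ ≤ (8 * (k : ℝ) ^ 2) ^ (k + s) * ((p : ℝ) ^ (k + s)
          * ((2 ^ (2 * k) * (X : ℝ) ^ (2 * k) * (p : ℝ) ^ (-(2 * k : ℝ)))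
          * (D * (2 ^ (2 * s) * ((X : ℝ) ^ E * (p : ℝ) ^ (-E)))))) := by
          gcongr
          exact hJ2.trans (by gcongr)
      _ = (8 * (k : ℝ) ^ 2) ^ (k + s) * 2 ^ (2 * k + 2 * s) * D * (X : ℝ) ^ (2 * k) * (X : ℝ) ^ E
          * ((p : ℝ) ^ (k + s) * (p : ℝ) ^ (-E) * (p : ℝ) ^ (-(2 * k : ℝ))) := by ring
      _ ≤ (8 * (k : ℝ) ^ 2) ^ (k + s) * 2 ^ (2 * k + 2 * s) * D * (X : ℝ) ^ (2 * k) * (X : ℝ) ^ E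
          * (X : ℝ) ^ (-(η / k)) := by gcongr
      _ = _ := by rw [← hexp2]; ring
  linarith

lemma vinogradovCount_induction {k L : ℕ} (hk : 3 ≤ k) : ∀ l ≤ L, ∀ X : ℕ, 0 < X →
    (vinogradovCount k (k ^ 2 + l * k) (Finset.Ico (0 : ℤ) X) : ℝ)
      ≤ (k : ℝ) ^ (k * k ^ 2) * (4 * k ^ k * 2 ^ (2 * (k ^ 2 + L * k)) * 4 ^ (k ^ 2)
          + (8 * k ^ 2) ^ (k + (k ^ 2 + L * k)) * 2 ^ (2 * k + 2 * (k ^ 2 + L * k))) ^ l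
        * (X : ℝ) ^ (2 * ((k ^ 2 + l * k : ℕ) : ℝ) - k * (k + 1) / 2
          + k * (k + 1) / 2 * (1 - (k : ℝ)⁻¹) ^ l) := by
  have hk0 : (3 : ℝ) ≤ k := by exact_mod_cast hk
  set M : ℝ := 4 * k ^ k * 2 ^ (2 * (k ^ 2 + L * k)) * 4 ^ (k ^ 2)
          + (8 * k ^ 2) ^ (k + (k ^ 2 + L * k)) * 2 ^ (2 * k + 2 * (k ^ 2 + L * k)) with hM
  have hM1 : 1 ≤ M := by
    have : (1 : ℝ) ≤ (8 * k ^ 2) ^ (k + (k ^ 2 + L * k)) * 2 ^ (2 * k + 2 * (k ^ 2 + L * k)) := by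
      apply one_le_mul_of_one_le_of_one_le <;> apply one_le_pow₀ <;> nlinarith
    have : (0 : ℝ) ≤ 4 * k ^ k * 2 ^ (2 * (k ^ 2 + L * k)) * 4 ^ (k ^ 2) := by positivity
    linarith
  have hki : (k : ℝ)⁻¹ ≤ 1 := inv_le_one_of_one_le₀ (by linarith)
  have hki0 : 0 ≤ 1 - (k : ℝ)⁻¹ := by linarith
  have hki1 : 1 - (k : ℝ)⁻¹ ≤ 1 := by have : 0 ≤ (k : ℝ)⁻¹ := by positivity
                                      linarith
  intro l
  induction l with
  | zero =>
    intro _ X hX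
    have h := vinogradovCount_le_pow k (k ^ 2 + 0 * k) (Finset.Ico (0 : ℤ) X)
    simp only [Int.card_Ico, sub_zero, Int.toNat_natCast] at h
    refine h.trans ?_
    simp only [pow_zero, mul_one]
    rw [sub_add_cancel, show (2 * ((k ^ 2 + 0 * k : ℕ) : ℝ)) = ((2 * (k ^ 2 + 0 * k) : ℕ) : ℝ) by
      push_cast; ring, Real.rpow_natCast]
    refine le_mul_of_one_le_left (by positivity) (one_le_pow₀ (by linarith))
  | succ l ih =>
    intro hl X hX
    have hXr : (1 : ℝ) ≤ X := by exact_mod_cast hX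
    rcases le_or_gt ((X : ℝ)) ((k : ℝ) ^ k) with hXk | hXk
    · have h := vinogradovCount_le_pow k (k ^ 2 + (l + 1) * k) (Finset.Ico (0 : ℤ) X)
      simp only [Int.card_Ico, sub_zero, Int.toNat_natCast] at h
      refine h.trans ?_
      have e : (X : ℝ) ^ (2 * (k ^ 2 + (l + 1) * k)) = (X : ℝ) ^ ((k : ℝ) * (k + 1) / 2
            - k * (k + 1) / 2 * (1 - (k : ℝ)⁻¹) ^ (l + 1))
          * (X : ℝ) ^ (2 * ((k ^ 2 + (l + 1) * k : ℕ) : ℝ) - k * (k + 1) / 2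
          + k * (k + 1) / 2 * (1 - (k : ℝ)⁻¹) ^ (l + 1)) := by
        rw [← Real.rpow_add (by linarith), ← Real.rpow_natCast]
        congr 1
        push_cast; ring
      rw [e]
      gcongr
      refine le_trans ?_ (le_mul_of_one_le_right (by positivity) (one_le_pow₀ hM1))
      calc (X : ℝ) ^ ((k : ℝ) * (k + 1) / 2 - k * (k + 1) / 2 * (1 - (k : ℝ)⁻¹) ^ (l + 1))
          ≤ (X : ℝ) ^ ((k ^ 2 : ℕ) : ℝ) := by
            apply Real.rpow_le_rpow_of_exponent_le hXr
            have : 0 ≤ (k : ℝ) * (k + 1) / 2 * (1 - (k : ℝ)⁻¹) ^ (l + 1) := by positivity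
            have := mul_nonneg (show (0 : ℝ) ≤ k by linarith) (show (0 : ℝ) ≤ k - 1 by linarith)
            push_cast
            linarith
        _ = (X : ℝ) ^ (k ^ 2) := Real.rpow_natCast _ _
        _ ≤ ((k : ℝ) ^ k) ^ (k ^ 2) := by gcongr
        _ = _ := by rw [← pow_mul]
    · have hl' : (l : ℝ) ≤ L := by exact_mod_cast (by omega : l ≤ L)
      have h := vinogradovCount_step (s := k ^ 2 + l * k)
        (η := k * (k + 1) / 2 * (1 - (k : ℝ)⁻¹) ^ l) (D := (k : ℝ) ^ (k * k ^ 2) * M ^ l) hk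
        (by omega) (by positivity) (mul_le_of_le_one_right (by positivity) (pow_le_one₀ hki0 hki1))
        (by positivity) (fun Y hY => ih (by omega) Y hY) hXk
      rw [show k ^ 2 + (l + 1) * k = k + (k ^ 2 + l * k) by ring]
      refine h.trans ?_
      have e1 : (k : ℝ) * (k + 1) / 2 * (1 - (k : ℝ)⁻¹) ^ l * (1 - (k : ℝ)⁻¹)
          = k * (k + 1) / 2 * (1 - (k : ℝ)⁻¹) ^ (l + 1) := by ring
      have e2 : (k : ℝ) ^ (k * k ^ 2) * M ^ (l + 1) = M * ((k : ℝ) ^ (k * k ^ 2) * M ^ l) := by ring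
      rw [e1, e2]
      have hlL : k ^ 2 + l * k ≤ k ^ 2 + L * k := by
        have := Nat.mul_le_mul_right k (show l ≤ L by omega)
        omega
      gcongr
      rw [hM]
      gcongr <;> nlinarith

/-- Vinogradov's mean value theorem. -/
theorem vinogradovCount_le (m : ℕ) : ∃ C : ℝ, 0 < C ∧ ∀ k : ℕ, 3 ≤ k → ∀ X : ℕ, 0 < X →
    (vinogradovCount k (k ^ 2 * (1 + m)) (Finset.Ico (0 : ℤ) X) : ℝ)
      ≤ Real.exp (C * k ^ 4) * (X : ℝ) ^ (2 * ((k ^ 2 * (1 + m) : ℕ) : ℝ) - k * (k + 1) / 2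
          + k * (k + 1) / 2 * Real.exp (-m)) := by
  refine ⟨1 + 40 * (1 + m) * m, by positivity, fun k hk X hX => ?_⟩
  have h := vinogradovCount_induction (L := k * m) hk (k * m) le_rfl X hX
  rw [show k ^ 2 + k * m * k = k ^ 2 * (1 + m) by ring] at h
  refine h.trans ?_
  have hk0 : (3 : ℝ) ≤ k := by exact_mod_cast hk
  have hXr : (1 : ℝ) ≤ X := by exact_mod_cast hX
  set S := k ^ 2 * (1 + m) with hS
  have hkS : k ≤ S := by nlinarith
  have hk2S : k ^ 2 ≤ S := by nlinarith
  have hkexp : (k : ℝ) ≤ Real.exp k := by linarith [Real.add_one_le_exp (k : ℝ)]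
  have h2exp : (2 : ℝ) ≤ Real.exp 1 := by linarith [Real.add_one_le_exp (1 : ℝ)]
  have hm0 : (0 : ℝ) ≤ m := Nat.cast_nonneg _
  have hM : 4 * (k : ℝ) ^ k * 2 ^ (2 * S) * 4 ^ (k ^ 2) + (8 * k ^ 2) ^ (k + S) * 2 ^ (2 * k + 2 * S)
      ≤ Real.exp (40 * k ^ 3 * (1 + m)) := by
    have hkS' : (k : ℝ) ^ 3 * (1 + m) = k * S := by rw [hS]; push_cast; ring
    have hkSr : (k : ℝ) ≤ S := by exact_mod_cast hkS
    have hk2Sr : (k : ℝ) ^ 2 ≤ S := by exact_mod_cast hk2S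
    have h3S : 3 * (S : ℝ) ≤ k * S := by gcongr
    have hb : 8 * (k : ℝ) ^ 2 ≤ Real.exp k ^ 4 :=
      calc 8 * (k : ℝ) ^ 2 ≤ (k : ℝ) ^ 2 * (k : ℝ) ^ 2 := by
            have : 8 ≤ (k : ℝ) ^ 2 := by nlinarith
            gcongr
        _ = (k : ℝ) ^ 4 := by ring
        _ ≤ _ := by gcongr
    have i1 : 4 * (k : ℝ) ^ k * 2 ^ (2 * S) * 4 ^ (k ^ 2)
        ≤ Real.exp 1 ^ 2 * Real.exp k ^ k * Real.exp 1 ^ (2 * S) * (Real.exp 1 ^ 2) ^ (k ^ 2) := by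
      gcongr <;> nlinarith
    have i2 : (8 * (k : ℝ) ^ 2) ^ (k + S) * 2 ^ (2 * k + 2 * S)
        ≤ (Real.exp k ^ 4) ^ (k + S) * Real.exp 1 ^ (2 * k + 2 * S) := by gcongr
    simp only [← Real.exp_nat_mul, ← Real.exp_add] at i1 i2
    have i3 : ∀ u : ℝ, u ≤ 30 * (k * S) → Real.exp u ≤ Real.exp (30 * (k * S)) :=
      fun u hu => Real.exp_le_exp.2 hu
    have i4 := i1.trans (i3 _ (by push_cast; nlinarith))
    have i5 := i2.trans (i3 _ (by push_cast; nlinarith))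
    have i6 : 2 * Real.exp (30 * (k * S)) ≤ Real.exp (40 * (k * S)) := by
      rw [show 40 * ((k : ℝ) * S) = 10 * (k * S) + 30 * (k * S) by ring, Real.exp_add]
      gcongr
      refine h2exp.trans (Real.exp_le_exp.2 ?_)
      nlinarith
    rw [mul_assoc 40, hkS']
    linarith
  have hfin : (1 - (k : ℝ)⁻¹) ^ (k * m) ≤ Real.exp (-m) := by
    have h1 : 1 - (k : ℝ)⁻¹ ≤ Real.exp (-(k : ℝ)⁻¹) := Real.one_sub_le_exp_neg _
    have h2 : (k : ℝ)⁻¹ ≤ 1 := inv_le_one_of_one_le₀ (by linarith)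
    refine (pow_le_pow_left₀ (by linarith) h1 _).trans_eq ?_
    rw [← Real.exp_nat_mul]
    congr 1
    push_cast
    field_simp
  gcongr
  · calc _ ≤ Real.exp (k ^ 4) * Real.exp (40 * k ^ 3 * (1 + m)) ^ (k * m) := by
          gcongr
          calc (k : ℝ) ^ (k * k ^ 2) ≤ Real.exp k ^ (k * k ^ 2) := by gcongr
            _ = _ := by rw [← Real.exp_nat_mul]; congr 1; push_cast; ring
      _ = _ := by
          rw [← Real.exp_nat_mul, ← Real.exp_add]; congr 1; push_cast; ring

end MeanValue

section Bilinear

open UnitAddTorus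

/-- The additive character `x ↦ exp(2πix)` on the reals. -/
noncomputable def expi (x : ℝ) : ℂ := Complex.exp (2 * π * x * Complex.I)

lemma norm_expi (x : ℝ) : ‖expi x‖ = 1 := by
  have := Complex.norm_exp_ofReal_mul_I (2 * π * x)
  simpa [expi] using this

lemma expi_add (x y : ℝ) : expi (x + y) = expi x * expi y := by
  rw [expi, expi, expi, ← Complex.exp_add]
  congr 1
  push_cast
  ring

lemma expi_zero : expi 0 = 1 := by simp [expi]

lemma expi_sum {ι : Type*} (s : Finset ι) (f : ι → ℝ) : expi (∑ i ∈ s, f i) = ∏ i ∈ s, expi (f i) := by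
  classical
  induction s using Finset.induction_on with
  | empty => simp [expi_zero]
  | insert a s ha ih => rw [Finset.sum_insert ha, Finset.prod_insert ha, expi_add, ih]

lemma mFourier_coe {k : ℕ} (v : Fin k → ℤ) (β : Fin k → ℝ) :
    mFourier v (fun j => (β j : UnitAddCircle)) = expi (∑ j, β j * v j) := by
  rw [expi_sum]
  simp only [mFourier, ContinuousMap.coe_mk]
  refine Finset.prod_congr rfl fun j _ => ?_
  rw [fourier_coe_apply]
  simp only [expi]
  congr 1
  push_cast
  ring

/-- Exponential sum of the polynomial with coefficients `β`. -/
noncomputable def weylSum {k : ℕ} (I : Finset ℤ) (β : Fin k → ℝ) : ℂ :=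
  ∑ y ∈ I, expi (∑ j, β j * (y : ℝ) ^ ((j : ℕ) + 1))

lemma weylSum_eq {k : ℕ} (I : Finset ℤ) (β : Fin k → ℝ) :
    weylSum I β = trigSum I (moments k) (fun j => (β j : UnitAddCircle)) := by
  simp [weylSum, trigSum, mFourier_coe, moments]

lemma norm_weylSum_pow {k : ℕ} (s : ℕ) (I : Finset ℤ) (β : Fin k → ℝ) :
    ((‖weylSum I β‖ ^ (2 * s) : ℝ) : ℂ)
      = ∑ z ∈ (Fintype.piFinset fun _ : Fin s => I) ×ˢ (Fintype.piFinset fun _ : Fin s => I),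
        expi (∑ j, β j * ((momentSum k z.1 - momentSum k z.2) j : ℤ)) := by
  have h : ((‖weylSum I β‖ ^ (2 * s) : ℝ) : ℂ)
      = weylSum I β ^ s * (starRingEnd ℂ) (weylSum I β ^ s) := by
    rw [Complex.mul_conj, Complex.normSq_eq_norm_sq, norm_pow, ← pow_mul, mul_comm s 2]
  rw [h, weylSum_eq, trigSum_pow]
  simp only [trigSum, map_sum, Finset.sum_mul_sum, Finset.sum_product, ← mFourier_neg,
      ← mFourier_add]
  simp only [mFourier_coe, sub_eq_add_neg]

lemma momentSum_sub_abs_le {k s X : ℕ} {z : (Fin s → ℤ) × (Fin s → ℤ)}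
    (hz : z ∈ (Fintype.piFinset fun _ : Fin s => Finset.Ico (0 : ℤ) X)
      ×ˢ (Fintype.piFinset fun _ : Fin s => Finset.Ico (0 : ℤ) X)) (j : Fin k) :
    (momentSum k z.1 - momentSum k z.2) j
      ∈ Finset.Icc (-((s * X ^ ((j : ℕ) + 1) : ℕ) : ℤ)) ((s * X ^ ((j : ℕ) + 1) : ℕ) : ℤ) := by
  have key : ∀ x ∈ Fintype.piFinset fun _ : Fin s => Finset.Ico (0 : ℤ) X,
      0 ≤ momentSum k x j ∧ momentSum k x j ≤ ((s * X ^ ((j : ℕ) + 1) : ℕ) : ℤ) := by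
    intro x hx
    simp only [Fintype.mem_piFinset, Finset.mem_Ico] at hx
    rw [momentSum_apply]
    refine ⟨Finset.sum_nonneg fun i _ => pow_nonneg (hx i).1 _, ?_⟩
    refine (Finset.sum_le_card_nsmul _ _ ((X : ℤ) ^ ((j : ℕ) + 1)) fun i _ =>
      pow_le_pow_left₀ (hx i).1 (hx i).2.le _).trans ?_
    simp
  rw [Finset.mem_product] at hz
  have h1 := key _ hz.1
  have h2 := key _ hz.2
  rw [Finset.mem_Icc, Pi.sub_apply]
  constructor <;> linarith

/-- The double sum controlling one coordinate in the bilinear estimate. -/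
noncomputable def bilinearCoord (a : ℝ) (U : ℕ) : ℝ :=
  ∑ v ∈ Finset.Icc (-(U : ℤ)) U, ‖∑ u ∈ Finset.Icc (-(U : ℤ)) U, expi (a * u * v)‖

lemma sum_norm_pow_le {ι : Type*} (A : Finset ι) (f : ι → ℂ) {n : ℕ} (hn : 1 ≤ n) :
    (∑ a ∈ A, ‖f a‖) ^ n ≤ (#A : ℝ) ^ (n - 1) * ∑ a ∈ A, ‖f a‖ ^ n := by
  rcases A.eq_empty_or_nonempty with rfl | hA
  · simp [show n ≠ 0 by omega]
  have h := pow_sum_div_card_le_sum_pow (s := A) (f := fun a => ‖f a‖) (fun i _ => norm_nonneg _)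
    (n - 1)
  have h0 : 0 < (#A : ℝ) := by exact_mod_cast hA.card_pos
  rw [Nat.sub_add_cancel hn, div_le_iff₀ (by positivity)] at h
  linarith

lemma sum_comp_sub_le {k s : ℕ} {X : ℕ} {g : (Fin k → ℤ) → ℝ} (hg : ∀ v, 0 ≤ g v) :
    ∑ z ∈ (Fintype.piFinset fun _ : Fin s => Finset.Ico (0 : ℤ) X)
        ×ˢ (Fintype.piFinset fun _ : Fin s => Finset.Ico (0 : ℤ) X),
        g (momentSum k z.1 - momentSum k z.2)
      ≤ vinogradovCount k s (Finset.Ico (0 : ℤ) X)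
        * ∑ v ∈ Fintype.piFinset fun j : Fin k =>
          Finset.Icc (-((s * X ^ ((j : ℕ) + 1) : ℕ) : ℤ)) ((s * X ^ ((j : ℕ) + 1) : ℕ) : ℤ), g v := by
  rw [← Finset.sum_fiberwise_of_maps_to (t := Fintype.piFinset fun j : Fin k =>
          Finset.Icc (-((s * X ^ ((j : ℕ) + 1) : ℕ) : ℤ)) ((s * X ^ ((j : ℕ) + 1) : ℕ) : ℤ))
    (g := fun z => momentSum k z.1 - momentSum k z.2)
    (fun z hz => Fintype.mem_piFinset.2 fun j => momentSum_sub_abs_le hz j), Finset.mul_sum]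
  refine Finset.sum_le_sum fun v _ => ?_
  rw [Finset.sum_congr rfl (g := fun _ => g v) (fun z hz => by rw [(Finset.mem_filter.1 hz).2]),
    Finset.sum_const, nsmul_eq_mul]
  gcongr
  · exact hg v
  · exact card_sub_eq_le _ _ v

/-- Vinogradov's bilinear estimate. -/
lemma bilinear_bound {k s : ℕ} (X : ℕ) (hs : 1 ≤ s) (α : Fin k → ℝ) :
    ‖∑ x ∈ Finset.Ico (0 : ℤ) X, ∑ y ∈ Finset.Ico (0 : ℤ) X,
        expi (∑ j, α j * ((x : ℝ) * y) ^ ((j : ℕ) + 1))‖ ^ (2 * s * (2 * s))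
      ≤ (X : ℝ) ^ (8 * s ^ 2 - 4 * s) * (vinogradovCount k s (Finset.Ico (0 : ℤ) X) : ℝ) ^ 2
        * ∏ j, bilinearCoord (α j) (s * X ^ ((j : ℕ) + 1)) := by
  classical
  set I := Finset.Ico (0 : ℤ) X with hI
  set P := (Fintype.piFinset fun _ : Fin s => I) ×ˢ (Fintype.piFinset fun _ : Fin s => I) with hP
  set Box := Fintype.piFinset fun j : Fin k =>
    Finset.Icc (-((s * X ^ ((j : ℕ) + 1) : ℕ) : ℤ)) ((s * X ^ ((j : ℕ) + 1) : ℕ) : ℤ) with hBox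
  set J : ℝ := ((vinogradovCount k s I : ℕ) : ℝ) with hJ
  have hcI : #I = X := by simp [hI]
  have hcP : (#P : ℝ) = (X : ℝ) ^ (2 * s) := by
    have : #P = X ^ (2 * s) := by simp [hP, hcI]; ring
    exact_mod_cast this
  let T : (Fin k → ℤ) → ℂ := fun u => weylSum I fun j => α j * u j
  have hpower : ‖∑ x ∈ I, ∑ y ∈ I, expi (∑ j, α j * ((x : ℝ) * y) ^ ((j : ℕ) + 1))‖ ^ (2 * s)
      ≤ (X : ℝ) ^ (2 * s - 1) * ∑ z ∈ P, ‖T (momentSum k z.1 - momentSum k z.2)‖ := by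
    have e : ∀ x y : ℤ, ∑ j : Fin k, α j * ((x : ℝ) * y) ^ ((j : ℕ) + 1)
        = ∑ j : Fin k, (α j * (x : ℝ) ^ ((j : ℕ) + 1)) * (y : ℝ) ^ ((j : ℕ) + 1) := fun x y =>
      Finset.sum_congr rfl fun j _ => by rw [mul_pow]; ring
    simp only [e]
    have h1 := pow_le_pow_left₀ (norm_nonneg _) (norm_sum_le I fun x =>
      weylSum I fun j : Fin k => α j * (x : ℝ) ^ ((j : ℕ) + 1)) (2 * s)
    refine h1.trans ((sum_norm_pow_le I _ (by omega)).trans ?_)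
    rw [hcI]
    gcongr
    have h2 : ((∑ x ∈ I, ‖weylSum I fun j : Fin k => α j * (x : ℝ) ^ ((j : ℕ) + 1)‖ ^ (2 * s) : ℝ) : ℂ)
        = ∑ z ∈ P, T (momentSum k z.1 - momentSum k z.2) := by
      rw [Complex.ofReal_sum]
      simp_rw [norm_weylSum_pow]
      rw [Finset.sum_comm]
      refine Finset.sum_congr rfl fun z _ => ?_
      refine Finset.sum_congr rfl fun x _ => ?_
      congr 1
      refine Finset.sum_congr rfl fun j _ => by ring
    have h3 := congrArg norm h2
    rw [Complex.norm_real, Real.norm_of_nonneg (by positivity)] at h3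
    rw [h3]
    exact norm_sum_le _ _
  have hdiff : (∑ z ∈ P, ‖T (momentSum k z.1 - momentSum k z.2)‖) ^ (2 * s)
      ≤ ((X : ℝ) ^ (2 * s)) ^ (2 * s - 1) * (J * ∑ u ∈ Box, ‖T u‖ ^ (2 * s)) := by
    refine (sum_norm_pow_le P _ (by omega)).trans ?_
    rw [hcP]
    gcongr
    exact sum_comp_sub_le (g := fun u => ‖T u‖ ^ (2 * s)) fun v => by positivity
  have hbox : ∑ u ∈ Box, ‖T u‖ ^ (2 * s)
      ≤ J * ∏ j, bilinearCoord (α j) (s * X ^ ((j : ℕ) + 1)) := by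
    have h2 : ((∑ u ∈ Box, ‖T u‖ ^ (2 * s) : ℝ) : ℂ)
        = ∑ z ∈ P, ∏ j : Fin k, ∑ u ∈ Finset.Icc (-((s * X ^ ((j : ℕ) + 1) : ℕ) : ℤ))
          ((s * X ^ ((j : ℕ) + 1) : ℕ) : ℤ),
          expi (α j * u * ((momentSum k z.1 - momentSum k z.2) j : ℤ)) := by
      rw [Complex.ofReal_sum]
      simp_rw [T, norm_weylSum_pow]
      rw [Finset.sum_comm]
      refine Finset.sum_congr rfl fun z _ => ?_
      rw [Finset.prod_univ_sum]
      refine Finset.sum_congr rfl fun u _ => ?_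
      rw [expi_sum]
    have h3 := congrArg norm h2
    rw [Complex.norm_real, Real.norm_of_nonneg (by positivity)] at h3
    rw [h3]
    refine (norm_sum_le _ _).trans ?_
    simp only [norm_prod]
    refine (sum_comp_sub_le (g := fun v : Fin k → ℤ => ∏ j : Fin k,
      ‖∑ u ∈ Finset.Icc (-((s * X ^ ((j : ℕ) + 1) : ℕ) : ℤ)) ((s * X ^ ((j : ℕ) + 1) : ℕ) : ℤ),
          expi (α j * u * (v j : ℤ))‖) fun v => by positivity).trans_eq ?_
    simp only [bilinearCoord, Finset.prod_univ_sum]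
    rfl
  calc _ ≤ ((X : ℝ) ^ (2 * s - 1) * ∑ z ∈ P, ‖T (momentSum k z.1 - momentSum k z.2)‖) ^ (2 * s) := by
        rw [pow_mul]; gcongr
    _ ≤ ((X : ℝ) ^ (2 * s - 1)) ^ (2 * s) * (((X : ℝ) ^ (2 * s)) ^ (2 * s - 1)
        * (J * (J * ∏ j, bilinearCoord (α j) (s * X ^ ((j : ℕ) + 1))))) := by
        rw [mul_pow]; gcongr; exact hdiff.trans (by gcongr)
    _ = _ := by
        have : 8 * s ^ 2 - 4 * s = (2 * s - 1) * (2 * s) + 2 * s * (2 * s - 1) := by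
          obtain ⟨r, rfl⟩ := Nat.exists_eq_add_of_le hs
          have : 2 * (1 + r) - 1 = 1 + 2 * r := by omega
          rw [this]
          ring_nf
          omega
        rw [this, pow_add, ← pow_mul, ← pow_mul]
        ring

end Bilinear

section CoordinateSum

lemma expi_intCast (m : ℤ) : expi m = 1 := by
  rw [expi, Complex.exp_eq_one_iff]
  exact ⟨m, by push_cast; ring⟩

lemma le_norm_expi_sub_one (β : ℝ) : 4 * |β - round β| ≤ ‖expi β - 1‖ := by
  set d := β - round β with hd
  have h1 : expi β = expi d := by
    have : β = d + (round β : ℤ) := by rw [hd]; ring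
    conv_lhs => rw [this]
    rw [expi_add, expi_intCast, mul_one]
  have h2 : |d| ≤ 1 / 2 := abs_sub_round β
  have h3 : ‖expi d - 1‖ = 2 * |sin (π * d)| := by
    have := Complex.norm_exp_I_mul_ofReal_sub_one (2 * π * d)
    rw [show 2 * π * d / 2 = π * d by ring, norm_mul, Real.norm_eq_abs, Real.norm_eq_abs,
      abs_two] at this
    rw [← this, expi]
    congr 3
    push_cast
    ring
  have h4 : |sin (π * d)| = sin (π * |d|) := by
    have h0 : 0 ≤ sin (π * |d|) :=
      sin_nonneg_of_nonneg_of_le_pi (by positivity) (by nlinarith [pi_pos])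
    rcases abs_cases d with ⟨h, -⟩ | ⟨h, -⟩
    · rw [h] at h0 ⊢; exact abs_of_nonneg h0
    · rw [h] at h0 ⊢
      rw [mul_neg, sin_neg] at h0 ⊢
      rw [abs_of_nonpos (by linarith)]
  have h5 := mul_le_sin (x := π * |d|) (by positivity) (by nlinarith [pi_pos])
  rw [show 2 / π * (π * |d|) = 2 * |d| by field_simp] at h5
  rw [h1, h3, h4]
  linarith

lemma expi_mul_natCast_add (β : ℝ) (c : ℤ) (n : ℕ) :
    (∑ i ∈ Finset.range n, expi (β * ((c + i : ℤ) : ℝ))) * (expi β - 1)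
      = expi (β * ((c + n : ℤ) : ℝ)) - expi (β * c) := by
  induction n with
  | zero => simp
  | succ n ih =>
    rw [Finset.sum_range_succ, add_mul, ih]
    have : expi (β * ((c + (n + 1 : ℕ) : ℤ) : ℝ)) = expi (β * ((c + n : ℤ) : ℝ)) * expi β := by
      rw [← expi_add]; congr 1; push_cast; ring
    rw [this]; ring

lemma norm_sum_expi_le (U : ℕ) {β τ : ℝ} (hτ : 0 < τ) (h : τ ≤ |β - round β|) :
    ‖∑ u ∈ Finset.Icc (-(U : ℤ)) U, expi (β * u)‖ ≤ 1 / (2 * τ) := by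
  have h1 : ∑ u ∈ Finset.Icc (-(U : ℤ)) U, expi (β * u)
      = ∑ i ∈ Finset.range (2 * U + 1), expi (β * ((-(U : ℤ) + i : ℤ) : ℝ)) := by
    symm
    refine Finset.sum_bij (fun i _ => -(U : ℤ) + i) ?_ ?_ ?_ ?_
    · intro i hi; simp only [Finset.mem_range, Finset.mem_Icc] at *; omega
    · intro i _ j _ hij; simpa using hij
    · intro u hu
      simp only [Finset.mem_Icc] at hu
      exact ⟨(u + U).toNat, by simp only [Finset.mem_range]; omega, by omega⟩
    · intro i _; rfl
  have h2 := congrArg norm (expi_mul_natCast_add β (-(U : ℤ)) (2 * U + 1))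
  rw [← h1, norm_mul] at h2
  have h3 := norm_sub_le (expi (β * ((-(U : ℤ) + (2 * U + 1 : ℕ) : ℤ) : ℝ)))
    (expi (β * ((-(U : ℤ) : ℤ) : ℝ)))
  rw [← h2, norm_expi, norm_expi] at h3
  have h4 := le_norm_expi_sub_one β
  rw [le_div_iff₀ (by positivity)]
  have h5 : ‖∑ u ∈ Finset.Icc (-(U : ℤ)) U, expi (β * u)‖ * (4 * τ) ≤ 1 + 1 :=
    le_trans (by gcongr; linarith) h3
  linarith

lemma norm_sum_expi_le_card (U : ℕ) (β : ℝ) :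
    ‖∑ u ∈ Finset.Icc (-(U : ℤ)) U, expi (β * u)‖ ≤ 2 * U + 1 := by
  refine (norm_sum_le _ _).trans ?_
  simp only [norm_expi, Finset.sum_const, Int.card_Icc, nsmul_eq_mul, mul_one]
  have : ((U : ℤ) + 1 - -(U : ℤ)).toNat = 2 * U + 1 := by omega
  rw [this]
  push_cast
  exact le_rfl

lemma bilinearCoord_neg (a : ℝ) (U : ℕ) : bilinearCoord (-a) U = bilinearCoord a U := by
  unfold bilinearCoord
  refine Finset.sum_nbij' (fun v => -v) (fun v => -v) ?_ ?_ ?_ ?_ ?_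
  · intro v hv; simp only [Finset.mem_Icc] at *; omega
  · intro v hv; simp only [Finset.mem_Icc] at *; omega
  · intro v _; simp
  · intro v _; simp
  · intro v _
    congr 1
    refine Finset.sum_congr rfl fun u _ => ?_
    congr 1; push_cast; ring

lemma bilinearCoord_le_sq (a : ℝ) (U : ℕ) : bilinearCoord a U ≤ (2 * U + 1) ^ 2 := by
  unfold bilinearCoord
  have : ∀ v ∈ Finset.Icc (-(U : ℤ)) U,
      ‖∑ u ∈ Finset.Icc (-(U : ℤ)) U, expi (a * u * v)‖ ≤ 2 * U + 1 := by
    intro v _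
    have := norm_sum_expi_le_card U (a * v)
    simpa only [mul_right_comm] using this
  refine (Finset.sum_le_card_nsmul _ _ _ this).trans_eq ?_
  rw [Int.card_Icc, show ((U : ℤ) + 1 - -(U : ℤ)).toNat = 2 * U + 1 by omega, nsmul_eq_mul]
  push_cast
  ring

lemma card_int_between_le {A : Finset ℤ} {a b : ℝ} (hab : a ≤ b)
    (h : ∀ v ∈ A, a ≤ v ∧ (v : ℝ) ≤ b) : (#A : ℝ) ≤ b - a + 1 := by
  have hsub : A ⊆ Finset.Icc ⌈a⌉ ⌊b⌋ := fun v hv =>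
    Finset.mem_Icc.2 ⟨Int.ceil_le.2 (h v hv).1, Int.le_floor.2 (h v hv).2⟩
  have h1 := Finset.card_le_card hsub
  rw [Int.card_Icc] at h1
  have h2 : (#A : ℝ) ≤ ((⌊b⌋ + 1 - ⌈a⌉).toNat : ℝ) := by exact_mod_cast h1
  refine h2.trans ?_
  rcases le_total 0 (⌊b⌋ + 1 - ⌈a⌉) with h3 | h3
  · have : (((⌊b⌋ + 1 - ⌈a⌉).toNat : ℤ) : ℝ) = ((⌊b⌋ + 1 - ⌈a⌉ : ℤ) : ℝ) := by
      rw [Int.toNat_of_nonneg h3]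
    rw [Int.cast_natCast] at this
    rw [this]
    push_cast
    linarith [Int.floor_le b, Int.le_ceil a]
  · rw [Int.toNat_of_nonpos h3]
    simp only [Nat.cast_zero]
    linarith

lemma card_near_int_le {a τ : ℝ} (ha : 0 < a) (hτ : 0 < τ) (hτ1 : τ ≤ 1) (U : ℕ) :
    (#{v ∈ Finset.Icc (-(U : ℤ)) (U : ℤ) | |a * (v : ℤ) - round (a * (v : ℤ))| < τ} : ℝ)
      ≤ (2 * (a * U) + 3) * (2 * τ / a + 1) := by
  classical
  set A : Finset ℤ := {v ∈ Finset.Icc (-(U : ℤ)) (U : ℤ) | |a * (v : ℤ) - round (a * (v : ℤ))| < τ} with hA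
  have hfib := Finset.card_eq_sum_card_image (fun v : ℤ => round (a * v)) A
  have h1 : (#(A.image fun v : ℤ => round (a * v)) : ℝ) ≤ 2 * (a * U) + 3 := by
    have := card_int_between_le (A := A.image fun v : ℤ => round (a * v)) (a := -(a * U + 1))
      (b := a * U + 1) (by have : 0 ≤ a * U := by positivity
                           linarith) ?_
    · linarith
    · intro m hm
      simp only [hA, Finset.mem_image, Finset.mem_filter, Finset.mem_Icc] at hm
      obtain ⟨v, ⟨⟨hv1, hv2⟩, hv3⟩, rfl⟩ := hm
      rw [abs_lt] at hv3
      have e1 : (v : ℝ) ≤ U := by exact_mod_cast hv2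
      have e2 : -(U : ℝ) ≤ v := by exact_mod_cast hv1
      have e3 : a * v ≤ a * U := by gcongr
      have e4 : a * -(U : ℝ) ≤ a * v := by gcongr
      constructor <;> linarith
  have h2 : ∀ m ∈ A.image fun v : ℤ => round (a * v),
      (#{v ∈ A | round (a * (v : ℤ)) = m} : ℝ) ≤ 2 * τ / a + 1 := by
    intro m _
    have := card_int_between_le (A := {v ∈ A | round (a * (v : ℤ)) = m}) (a := (m - τ) / a)
      (b := (m + τ) / a) (by gcongr; linarith) ?_
    · refine this.trans_eq ?_
      field_simp; ring
    · intro v hv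
      simp only [hA, Finset.mem_filter] at hv
      obtain ⟨⟨-, hv⟩, rfl⟩ := hv
      rw [abs_lt] at hv
      rw [div_le_iff₀ ha, le_div_iff₀ ha]
      constructor <;> linarith
  rw [hfib]
  push_cast
  refine (Finset.sum_le_card_nsmul _ _ _ h2).trans ?_
  rw [nsmul_eq_mul]
  gcongr

lemma bilinearCoord_le {a τ : ℝ} (ha : a ≠ 0) (hτ : 0 < τ) (hτ1 : τ ≤ 1) (U : ℕ) :
    bilinearCoord a U ≤ (2 * U + 1) * (1 / (2 * τ))
      + (2 * U + 1) * ((2 * (|a| * U) + 3) * (2 * τ / |a| + 1)) := by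
  have hab : bilinearCoord a U = bilinearCoord |a| U := by
    rcases abs_cases a with ⟨h, -⟩ | ⟨h, -⟩
    · rw [h]
    · rw [h, bilinearCoord_neg]
  have ha' : 0 < |a| := abs_pos.2 ha
  rw [hab]
  generalize |a| = b at ha'
  have key : ∀ v ∈ Finset.Icc (-(U : ℤ)) U,
      ‖∑ u ∈ Finset.Icc (-(U : ℤ)) U, expi (b * u * v)‖ ≤ 1 / (2 * τ)
        + if |b * v - round (b * v)| < τ then (2 * U + 1 : ℝ) else 0 := by
    intro v _
    simp only [mul_right_comm b]
    split_ifs with h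
    · have := norm_sum_expi_le_card U (b * v)
      have : 0 ≤ 1 / (2 * τ) := by positivity
      linarith
    · rw [add_zero]
      exact norm_sum_expi_le U hτ (not_lt.1 h)
  unfold bilinearCoord
  refine (Finset.sum_le_sum key).trans ?_
  rw [Finset.sum_add_distrib, Finset.sum_const, Int.card_Icc,
    show ((U : ℤ) + 1 - -(U : ℤ)).toNat = 2 * U + 1 by omega, nsmul_eq_mul,
    ← Finset.sum_filter, Finset.sum_const, nsmul_eq_mul, mul_comm _ (2 * (U : ℝ) + 1)]
  push_cast
  gcongr
  exact card_near_int_le ha' hτ hτ1 U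

end CoordinateSum

section Assembly

lemma bilinearCoord_le_sqrt {a : ℝ} (ha : a ≠ 0) (ha1 : |a| ≤ 1) (U : ℕ) :
    bilinearCoord a U ≤ (2 * U + 1) ^ 2 * (3 * √|a| + 10 / (√|a| * (2 * U + 1))) := by
  have ha' : 0 < |a| := abs_pos.2 ha
  set r := √|a| with hr
  have hr0 : 0 < r := Real.sqrt_pos.2 ha'
  have hr1 : r ≤ 1 := Real.sqrt_le_one.2 ha1
  have hrr : |a| = r ^ 2 := (Real.sq_sqrt ha'.le).symm
  refine (bilinearCoord_le ha hr0 hr1 U).trans ?_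
  rw [hrr]
  have hU : (0 : ℝ) ≤ U := Nat.cast_nonneg _
  have e1 : (2 * (U : ℝ) + 1) * (1 / (2 * r))
      + (2 * U + 1) * ((2 * (r ^ 2 * U) + 3) * (2 * r / r ^ 2 + 1))
      = ((2 * U + 1) / r) * (1 / 2 + (2 * (r ^ 2 * U) + 3) * (2 + r)) := by
    field_simp
  have e2 : (2 * (U : ℝ) + 1) ^ 2 * (3 * r + 10 / (r * (2 * U + 1)))
      = ((2 * U + 1) / r) * (3 * r ^ 2 * (2 * U + 1) + 10) := by
    field_simp
  rw [e1, e2]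
  refine mul_le_mul_of_nonneg_left ?_ (by positivity)
  have h1 : (2 * (r ^ 2 * U) + 3) * (2 + r) ≤ (2 * (r ^ 2 * U) + 3) * 3 := by
    gcongr; linarith
  nlinarith [mul_nonneg (sq_nonneg r) hU, sq_nonneg r]

lemma bilinearCoord_saving {N X s j : ℕ} {lam a : ℝ} (hX : (N : ℝ) ^ (2 / 5 : ℝ) / 2 ≤ X)
    (hj : 1 ≤ j) (hsj : j ≤ s) (hs2 : 2 ≤ s) (hlam : 1 / 2 ≤ lam) (hj1 : 2 * lam ≤ j)
    (hj2 : (j : ℝ) ≤ 4 * lam) (hN : 4000 * lam ^ 2 ≤ Real.log N)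
    (ha1 : (N : ℝ) ^ lam / (2 * π * j * (2 * N) ^ j) ≤ |a|) (ha2 : |a| ≤ (N : ℝ) ^ lam / N ^ j) :
    bilinearCoord a (s * X ^ j)
      ≤ (2 * (s * X ^ j : ℕ) + 1) ^ 2 * (N : ℝ) ^ (-(lam / 20)) := by
  have hL : 0 < Real.log N := by nlinarith
  have hN0 : (0 : ℝ) < N := by
    rcases Nat.eq_zero_or_pos N with rfl | h
    · simp at hL
    · exact_mod_cast h
  have hN1 : (1 : ℝ) < N := (Real.log_pos_iff hN0.le).1 hL
  have hj0 : (1 : ℝ) ≤ j := by exact_mod_cast hj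
  have hpos : 0 < |a| := lt_of_lt_of_le (by positivity) ha1
  have ha0 : a ≠ 0 := abs_pos.1 hpos
  have hup : |a| ≤ (N : ℝ) ^ (-lam) := by
    refine ha2.trans ?_
    rw [← Real.rpow_natCast, ← Real.rpow_sub hN0]
    exact Real.rpow_le_rpow_of_exponent_le hN1.le (by linarith)
  have hle1 : |a| ≤ 1 := hup.trans (Real.rpow_le_one_of_one_le_of_nonpos hN1.le (by linarith))
  have hsqrt : √|a| ≤ (N : ℝ) ^ (-(3 * lam / 40)) := by
    refine Real.sqrt_le_iff.2 ⟨by positivity, hup.trans ?_⟩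
    rw [← Real.rpow_natCast, ← Real.rpow_mul hN0.le]
    apply Real.rpow_le_rpow_of_exponent_le hN1.le
    push_cast
    linarith
  have h8 : (8 : ℝ) ^ j ≤ (N : ℝ) ^ (lam / 20) := by
    have h8e : (8 : ℝ) ≤ Real.exp 3 := by
      have := Real.exp_one_gt_d9
      rw [show (3 : ℝ) = 1 + 1 + 1 by norm_num, Real.exp_add, Real.exp_add]
      nlinarith
    calc (8 : ℝ) ^ j ≤ Real.exp 3 ^ j := by gcongr
      _ = Real.exp (j * 3) := by rw [← Real.exp_nat_mul]
      _ ≤ Real.exp (Real.log N * (lam / 20)) := by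
        rw [Real.exp_le_exp]
        have : 1000 ≤ Real.log N := by nlinarith
        nlinarith
      _ = _ := by rw [Real.rpow_def_of_pos hN0]
  have hlow : (N : ℝ) ^ (3 * lam / 40) ≤ √|a| * (2 * (s * X ^ j : ℕ) + 1) := by
    have hX' : ((N : ℝ) ^ (2 / 5 : ℝ) / 2) ^ j ≤ (X : ℝ) ^ j := by gcongr
    have h1 : √|a| * (s * (2 * X ^ j)) ≤ √|a| * (2 * (s * X ^ j : ℕ) + 1) := by
      push_cast
      gcongr
      linarith
    refine le_trans ?_ h1
    refine (pow_le_pow_iff_left₀ (by positivity) (by positivity) two_ne_zero).1 ?_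
    rw [mul_pow, Real.sq_sqrt hpos.le]
    have e1 : ((N : ℝ) ^ (3 * lam / 40)) ^ 2 = (N : ℝ) ^ (3 * lam / 20) := by
      rw [← Real.rpow_natCast, ← Real.rpow_mul hN0.le]; congr 1; push_cast; ring
    have hs : (j : ℝ) ≤ s := by exact_mod_cast hsj
    have hs2' : (2 : ℝ) ≤ s := by exact_mod_cast hs2
    calc ((N : ℝ) ^ (3 * lam / 40)) ^ 2 = (N : ℝ) ^ (lam / 5) / (N : ℝ) ^ (lam / 20) := by
          rw [e1, ← Real.rpow_sub hN0]; congr 1; ring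
      _ ≤ (N : ℝ) ^ (lam / 5) / 8 ^ j := by gcongr
      _ ≤ (N : ℝ) ^ (lam - j / 5) / 8 ^ j := by
          gcongr 1
          exact Real.rpow_le_rpow_of_exponent_le hN1.le (by linarith)
      _ ≤ (N : ℝ) ^ (lam - j / 5) / 8 ^ j * (4 * s ^ 2 / (2 * π * j)) := by
          refine le_mul_of_one_le_right (by positivity) ?_
          rw [one_le_div (by positivity)]
          have : π * j ≤ 4 * s := by
            have := pi_le_four
            gcongr
          nlinarith
      _ = (N : ℝ) ^ lam / (2 * π * j * (2 * N) ^ j)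
          * (s * (2 * ((N : ℝ) ^ (2 / 5 : ℝ) / 2) ^ j)) ^ 2 := by
          have e3 : (N : ℝ) ^ (lam - j / 5) = (N : ℝ) ^ lam / N ^ j * (((N : ℝ) ^ (2 / 5 : ℝ)) ^ j) ^ 2 := by
            have e4 : (((N : ℝ) ^ (2 / 5 : ℝ)) ^ j) ^ 2 = (N : ℝ) ^ (4 / 5 * j : ℝ) := by
              rw [← pow_mul, ← Real.rpow_natCast, ← Real.rpow_mul hN0.le]
              congr 1; push_cast; ring
            rw [e4, ← Real.rpow_natCast, ← Real.rpow_sub hN0, ← Real.rpow_add hN0]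
            congr 1
            ring
          have e5 : (8 : ℝ) ^ j = 2 ^ j * (2 ^ j) ^ 2 := by
            rw [← pow_mul, mul_comm j 2, pow_mul, ← mul_pow]; norm_num
          rw [e3, div_pow, mul_pow 2 (N : ℝ), e5]
          generalize ((N : ℝ) ^ (2 / 5 : ℝ)) ^ j = Q
          field_simp
          ring
      _ ≤ _ := by gcongr
  refine (bilinearCoord_le_sqrt ha0 hle1 _).trans ?_
  gcongr
  have hP : (0 : ℝ) < (N : ℝ) ^ (3 * lam / 40) := by positivity
  have h2 : 10 / (√|a| * (2 * (s * X ^ j : ℕ) + 1)) ≤ 10 / (N : ℝ) ^ (3 * lam / 40) := by gcongr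
  have h3 : 10 / (N : ℝ) ^ (3 * lam / 40) = 10 * (N : ℝ) ^ (-(3 * lam / 40)) := by
    rw [Real.rpow_neg hN0.le]; rfl
  have h13 : 13 ≤ (N : ℝ) ^ (lam / 40) := by
    have : (12 : ℝ) ≤ Real.log N * (lam / 40) := by
      have : 1000 ≤ Real.log N := by nlinarith
      nlinarith
    rw [Real.rpow_def_of_pos hN0]
    linarith [Real.add_one_le_exp (Real.log N * (lam / 40)), Real.exp_le_exp.2 this]
  calc 3 * √|a| + 10 / (√|a| * (2 * (s * X ^ j : ℕ) + 1))
      ≤ 13 * (N : ℝ) ^ (-(3 * lam / 40)) := by linarith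
    _ ≤ (N : ℝ) ^ (lam / 40) * (N : ℝ) ^ (-(3 * lam / 40)) := by gcongr
    _ = _ := by rw [← Real.rpow_add hN0]; congr 1; ring

end Assembly

section DoubleSum

lemma card_good_ge {k : ℕ} {lam : ℝ} (hlam : 1 / 2 ≤ lam) (hk : 4 * lam ≤ k) :
    lam ≤ #{j : Fin k | 2 * lam ≤ ((j : ℕ) + 1 : ℝ) ∧ ((j : ℕ) + 1 : ℝ) ≤ 4 * lam} := by
  set G : Finset (Fin k) := {j : Fin k | 2 * lam ≤ ((j : ℕ) + 1 : ℝ) ∧ ((j : ℕ) + 1 : ℝ) ≤ 4 * lam}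
    with hG
  have h1 : #(Finset.Icc ⌈2 * lam⌉₊ ⌊4 * lam⌋₊) ≤ #G := by
    have hpos : 0 < ⌈2 * lam⌉₊ := Nat.ceil_pos.2 (by linarith)
    refine Finset.card_le_card_of_surjOn (fun j : Fin k => (j : ℕ) + 1) ?_
    intro n hn
    rw [Finset.mem_coe, Finset.mem_Icc] at hn
    have h2 : 2 * lam ≤ n := Nat.ceil_le.1 hn.1
    have h3 : (n : ℝ) ≤ 4 * lam := (Nat.le_floor_iff (by linarith)).1 hn.2
    have h4 : n ≤ k := by exact_mod_cast h3.trans hk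
    have h5 : ((n - 1 : ℕ) : ℝ) + 1 = n := by
      rw [Nat.cast_sub (by omega)]; push_cast; ring
    refine ⟨⟨n - 1, by omega⟩, ?_, by simp only; omega⟩
    simp only [hG, Finset.coe_filter, Finset.mem_univ, true_and, Set.mem_ofPred_eq, h5]
    exact ⟨h2, h3⟩
  rw [Nat.card_Icc] at h1
  have h2 : (⌈2 * lam⌉₊ : ℝ) < 2 * lam + 1 := Nat.ceil_lt_add_one (by linarith)
  have h3 : 4 * lam < ⌊4 * lam⌋₊ + 1 := Nat.lt_floor_add_one _
  have h4 : ⌈2 * lam⌉₊ < ⌊4 * lam⌋₊ + 1 := by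
    have : (⌈2 * lam⌉₊ : ℝ) < (⌊4 * lam⌋₊ + 1 : ℕ) := by push_cast; linarith
    exact_mod_cast this
  rcases le_or_gt 1 lam with h5 | h5
  · have h6 : (⌊4 * lam⌋₊ : ℝ) + 1 - ⌈2 * lam⌉₊ ≤ #G := by
      have : ⌊4 * lam⌋₊ + 1 ≤ #G + ⌈2 * lam⌉₊ := by omega
      have : ((⌊4 * lam⌋₊ + 1 : ℕ) : ℝ) ≤ (#G + ⌈2 * lam⌉₊ : ℕ) := by exact_mod_cast this
      push_cast at this
      linarith
    linarith
  · have h6 : 1 ≤ #G := by omega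
    have : (1 : ℝ) ≤ #G := by exact_mod_cast h6
    linarith

lemma prod_bilinearCoord_le {N X s k : ℕ} {lam : ℝ} {α : Fin k → ℝ}
    (hX : (N : ℝ) ^ (2 / 5 : ℝ) / 2 ≤ X) (hX1 : 1 ≤ X) (hks : k ≤ s) (hs2 : 2 ≤ s)
    (hlam : 1 / 2 ≤ lam) (hk : 4 * lam ≤ k) (hN : 4000 * lam ^ 2 ≤ Real.log N)
    (hα : ∀ j : Fin k, (N : ℝ) ^ lam / (2 * π * ((j : ℕ) + 1 : ℕ) * (2 * N) ^ ((j : ℕ) + 1)) ≤ |α j|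
      ∧ |α j| ≤ (N : ℝ) ^ lam / N ^ ((j : ℕ) + 1)) :
    ∏ j, bilinearCoord (α j) (s * X ^ ((j : ℕ) + 1))
      ≤ (3 * s : ℝ) ^ (2 * k) * (X : ℝ) ^ ((k : ℝ) * (k + 1)) * (N : ℝ) ^ (-(lam ^ 2 / 20)) := by
  have hL : 0 < Real.log N := by nlinarith
  have hN0 : (0 : ℝ) < N := by
    rcases Nat.eq_zero_or_pos N with rfl | h
    · simp at hL
    · exact_mod_cast h
  have hN1 : (1 : ℝ) < N := (Real.log_pos_iff hN0.le).1 hL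
  have hX1' : (1 : ℝ) ≤ X := by exact_mod_cast hX1
  have hs2' : (2 : ℝ) ≤ s := by exact_mod_cast hs2
  set q := (N : ℝ) ^ (-(lam / 20)) with hq
  have hq0 : 0 < q := by positivity
  have hq1 : q ≤ 1 := Real.rpow_le_one_of_one_le_of_nonpos hN1.le (by linarith)
  let good : Fin k → Prop := fun j => 2 * lam ≤ ((j : ℕ) + 1 : ℝ) ∧ ((j : ℕ) + 1 : ℝ) ≤ 4 * lam
  have h1 : ∀ j : Fin k, bilinearCoord (α j) (s * X ^ ((j : ℕ) + 1))
      ≤ ((3 * s : ℝ) ^ 2 * (X : ℝ) ^ (2 * ((j : ℕ) + 1))) * if good j then q else 1 := by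
    intro j
    have e : (2 * (s * X ^ ((j : ℕ) + 1) : ℕ) + 1 : ℝ) ^ 2
        ≤ (3 * s : ℝ) ^ 2 * (X : ℝ) ^ (2 * ((j : ℕ) + 1)) := by
      rw [mul_comm 2 ((j : ℕ) + 1), pow_mul (X : ℝ), ← mul_pow]
      gcongr
      push_cast
      have : (1 : ℝ) ≤ (X : ℝ) ^ ((j : ℕ) + 1) := one_le_pow₀ hX1'
      nlinarith
    split_ifs with hg
    · have := bilinearCoord_saving (s := s) hX (Nat.succ_pos j) (by have := j.2; omega) hs2 hlam
        (by push_cast; exact hg.1) (by push_cast; exact hg.2) hN (hα j).1 (hα j).2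
      refine this.trans ?_
      gcongr
    · rw [mul_one]
      exact (bilinearCoord_le_sq _ _).trans e
  have h0 : ∀ j : Fin k, 0 ≤ bilinearCoord (α j) (s * X ^ ((j : ℕ) + 1)) := fun j =>
    Finset.sum_nonneg fun v _ => norm_nonneg _
  refine (Finset.prod_le_prod (fun j _ => h0 j) fun j _ => h1 j).trans ?_
  rw [Finset.prod_mul_distrib, Finset.prod_mul_distrib, Finset.prod_const, Finset.card_univ,
    Fintype.card_fin, ← pow_mul, Finset.prod_pow_eq_pow_sum, Finset.prod_ite, Finset.prod_const,
    Finset.prod_const_one, mul_one]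
  have hsum : ∑ j : Fin k, 2 * ((j : ℕ) + 1) = k * (k + 1) := by
    rw [Fin.sum_univ_eq_sum_range (fun j => 2 * (j + 1)) k]
    clear * -
    induction k with
    | zero => rfl
    | succ k ih => rw [Finset.sum_range_succ, ih]; ring
  rw [hsum, ← Real.rpow_natCast (X : ℝ) (k * (k + 1))]
  push_cast
  gcongr
  have hc : lam ≤ #{j : Fin k | good j} := by
    convert card_good_ge hlam hk
  calc q ^ #{j : Fin k | good j} = (N : ℝ) ^ (-(lam / 20) * #{j : Fin k | good j}) := by
        rw [hq, ← Real.rpow_natCast, ← Real.rpow_mul hN0.le]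
    _ ≤ _ := by
        apply Real.rpow_le_rpow_of_exponent_le hN1.le
        nlinarith

/-- The double sum arising from the shift by `x * y`. -/
theorem doubleSum_le : ∃ K c : ℝ, 4000 ≤ K ∧ 0 < c ∧ ∀ (N k : ℕ) (lam : ℝ), 1 / 2 ≤ lam →
    K * lam ^ 2 ≤ Real.log N → 5 * lam + 2 ≤ k → (k : ℝ) ≤ 5 * lam + 3 → ∀ α : Fin k → ℝ,
    (∀ j : Fin k, (N : ℝ) ^ lam / (2 * π * ((j : ℕ) + 1 : ℕ) * (2 * N) ^ ((j : ℕ) + 1)) ≤ |α j|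
      ∧ |α j| ≤ (N : ℝ) ^ lam / N ^ ((j : ℕ) + 1)) →
    ‖∑ x ∈ Finset.Ico (0 : ℤ) (⌊(N : ℝ) ^ (2 / 5 : ℝ)⌋₊ : ℕ),
      ∑ y ∈ Finset.Ico (0 : ℤ) (⌊(N : ℝ) ^ (2 / 5 : ℝ)⌋₊ : ℕ),
        expi (∑ j, α j * ((x : ℝ) * y) ^ ((j : ℕ) + 1))‖
      ≤ (⌊(N : ℝ) ^ (2 / 5 : ℝ)⌋₊ : ℝ) ^ 2 * (N : ℝ) ^ (-(c / lam ^ 2)) := by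
  obtain ⟨C, hC, hmv⟩ := vinogradovCount_le 10
  refine ⟨4000 + 80 * ((2 * C + 66) * 14641), 1 / (160 * 1331 ^ 2), by nlinarith, by norm_num, ?_⟩
  intro N k lam hlam hN hk1 hk2 α hα
  have hN' : 4000 * lam ^ 2 ≤ Real.log N := by nlinarith [mul_nonneg hC.le (sq_nonneg lam), sq_nonneg lam]
  have hN'' : (2 * C + 66) * 14641 * lam ^ 2 ≤ Real.log N * (1 / 80) := by
    nlinarith [sq_nonneg lam]
  have hL : 0 < Real.log N := by nlinarith
  have hN0 : (0 : ℝ) < N := by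
    rcases Nat.eq_zero_or_pos N with rfl | h
    · simp at hL
    · exact_mod_cast h
  have hN1 : (1 : ℝ) < N := (Real.log_pos_iff hN0.le).1 hL
  set X := ⌊(N : ℝ) ^ (2 / 5 : ℝ)⌋₊ with hXdef
  have hR1 : 1 ≤ (N : ℝ) ^ (2 / 5 : ℝ) := Real.one_le_rpow hN1.le (by norm_num)
  have hX1 : 1 ≤ X := by rw [hXdef, Nat.one_le_floor_iff]; exact hR1
  have hX1' : (1 : ℝ) ≤ X := by exact_mod_cast hX1
  have hX : (N : ℝ) ^ (2 / 5 : ℝ) / 2 ≤ X := by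
    have := Nat.lt_floor_add_one ((N : ℝ) ^ (2 / 5 : ℝ))
    rw [← hXdef] at this
    linarith
  have hXu : (X : ℝ) ≤ (N : ℝ) ^ (2 / 5 : ℝ) := Nat.floor_le (by positivity)
  have hk4 : 4 ≤ k := by
    have : (4 : ℝ) ≤ k := by linarith
    exact_mod_cast this
  have hk11 : (k : ℝ) ≤ 11 * lam := by linarith
  set s := k ^ 2 * (1 + 10) with hs
  have hks : k ≤ s := by nlinarith
  have hs2 : 2 ≤ s := by omega
  have hs0 : (0 : ℝ) < s := by positivity
  have hJ := hmv k (by omega) X hX1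
  rw [← hs] at hJ
  have hD := prod_bilinearCoord_le (s := s) hX hX1 hks hs2 hlam (by linarith) hN' hα
  have hB := bilinear_bound (s := s) X (by omega) α
  set W := ‖∑ x ∈ Finset.Ico (0 : ℤ) X, ∑ y ∈ Finset.Ico (0 : ℤ) X,
        expi (∑ j, α j * ((x : ℝ) * y) ^ ((j : ℕ) + 1))‖ with hW
  have hW0 : 0 ≤ W := norm_nonneg _
  have hX0 : (0 : ℝ) < X := by linarith
  have h8 : 4 * s ≤ 8 * s ^ 2 := by nlinarith
  have hexpm : Real.exp (-((10 : ℕ) : ℝ)) ≤ 1 / 10000 := by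
    rw [Real.exp_neg, ← one_div]
    apply one_div_le_one_div_of_le (by norm_num)
    have h1 := Real.exp_one_gt_d9
    have h2 : Real.exp ((10 : ℕ) : ℝ) = Real.exp 1 ^ 10 := by rw [← Real.exp_nat_mul]; simp
    rw [h2]
    calc (10000 : ℝ) ≤ 2.7 ^ 10 := by norm_num
      _ ≤ _ := by gcongr; linarith
  have hκ : (k : ℝ) * (k + 1) ≤ 143 * lam ^ 2 := by nlinarith
  have h3s : (3 * s : ℝ) ^ (2 * k) ≤ Real.exp (66 * (k : ℝ) ^ 4) := by
    calc (3 * s : ℝ) ^ (2 * k) ≤ Real.exp (3 * s) ^ (2 * k) := by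
          gcongr; linarith [Real.add_one_le_exp (3 * s : ℝ)]
      _ = Real.exp (66 * (k : ℝ) ^ 3) := by
          rw [← Real.exp_nat_mul, hs]; congr 1; push_cast; ring
      _ ≤ _ := by
          gcongr
          · exact_mod_cast (by omega : 1 ≤ k)
          · norm_num
  have hmain : W ^ (2 * s * (2 * s)) ≤ (X : ℝ) ^ ((8 : ℝ) * s ^ 2) * (N : ℝ) ^ (-(lam ^ 2 / 40)) := by
    refine hB.trans ?_
    calc (X : ℝ) ^ (8 * s ^ 2 - 4 * s) * (vinogradovCount k s (Finset.Ico (0 : ℤ) X) : ℝ) ^ 2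
        * ∏ j, bilinearCoord (α j) (s * X ^ ((j : ℕ) + 1))
        ≤ (X : ℝ) ^ ((8 : ℝ) * s ^ 2 - 4 * s) * (Real.exp (C * k ^ 4)
          * (X : ℝ) ^ (2 * (s : ℝ) - k * (k + 1) / 2 + k * (k + 1) / 2 * Real.exp (-((10 : ℕ) : ℝ)))) ^ 2
          * (Real.exp (66 * (k : ℝ) ^ 4) * (X : ℝ) ^ ((k : ℝ) * (k + 1)) * (N : ℝ) ^ (-(lam ^ 2 / 20))) := by
          have e : (X : ℝ) ^ (8 * s ^ 2 - 4 * s) = (X : ℝ) ^ ((8 : ℝ) * s ^ 2 - 4 * s) := by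
            rw [← Real.rpow_natCast, Nat.cast_sub h8]; push_cast; rfl
          rw [e]
          have hD' : ∏ j, bilinearCoord (α j) (s * X ^ ((j : ℕ) + 1))
              ≤ Real.exp (66 * (k : ℝ) ^ 4) * (X : ℝ) ^ ((k : ℝ) * (k + 1))
                * (N : ℝ) ^ (-(lam ^ 2 / 20)) := hD.trans (by gcongr)
          gcongr
          · exact Finset.prod_nonneg fun j _ => Finset.sum_nonneg fun v _ => norm_nonneg _
      _ = (X : ℝ) ^ ((8 : ℝ) * s ^ 2) * (Real.exp ((2 * C + 66) * k ^ 4)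
          * (X : ℝ) ^ (k * (k + 1) * Real.exp (-((10 : ℕ) : ℝ))) * (N : ℝ) ^ (-(lam ^ 2 / 20))) := by
          have e1 : Real.exp ((2 * C + 66) * k ^ 4) = Real.exp (C * k ^ 4) ^ 2 * Real.exp (66 * (k : ℝ) ^ 4) := by
            rw [← Real.exp_nat_mul, ← Real.exp_add]; congr 1; push_cast; ring
          have e2 : (X : ℝ) ^ ((8 : ℝ) * s ^ 2) * (X : ℝ) ^ (k * (k + 1) * Real.exp (-((10 : ℕ) : ℝ)))
              = (X : ℝ) ^ ((8 : ℝ) * s ^ 2 - 4 * s) * ((X : ℝ) ^ (2 * (s : ℝ) - k * (k + 1) / 2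
                + k * (k + 1) / 2 * Real.exp (-((10 : ℕ) : ℝ)))) ^ 2 * (X : ℝ) ^ ((k : ℝ) * (k + 1)) := by
            have hsq (E : ℝ) : ((X : ℝ) ^ E) ^ 2 = (X : ℝ) ^ (E * 2) := by
              rw [← Real.rpow_natCast, ← Real.rpow_mul hX0.le]; norm_num
            rw [hsq, ← Real.rpow_add hX0, ← Real.rpow_add hX0, ← Real.rpow_add hX0]
            congr 1
            ring
          rw [e1]
          linear_combination (-(Real.exp (C * k ^ 4) ^ 2 * Real.exp (66 * (k : ℝ) ^ 4)
            * (N : ℝ) ^ (-(lam ^ 2 / 20)))) * e2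
      _ ≤ (X : ℝ) ^ ((8 : ℝ) * s ^ 2) * ((N : ℝ) ^ (lam ^ 2 / 80) * (N : ℝ) ^ (lam ^ 2 / 80)
          * (N : ℝ) ^ (-(lam ^ 2 / 20))) := by
          gcongr
          · rw [Real.rpow_def_of_pos hN0, Real.exp_le_exp]
            have hk4 : (k : ℝ) ^ 4 ≤ 14641 * lam ^ 4 := by
              calc (k : ℝ) ^ 4 ≤ (11 * lam) ^ 4 := by gcongr
                _ = _ := by ring
            calc (2 * C + 66) * (k : ℝ) ^ 4 ≤ (2 * C + 66) * (14641 * lam ^ 4) := by gcongr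
              _ = ((2 * C + 66) * 14641 * lam ^ 2) * lam ^ 2 := by ring
              _ ≤ (Real.log N * (1 / 80)) * lam ^ 2 := by gcongr
              _ = _ := by ring
          · calc (X : ℝ) ^ (k * (k + 1) * Real.exp (-((10 : ℕ) : ℝ)))
                ≤ (X : ℝ) ^ (143 * lam ^ 2 * (1 / 10000)) := by
                  apply Real.rpow_le_rpow_of_exponent_le hX1'
                  gcongr
              _ ≤ ((N : ℝ) ^ (2 / 5 : ℝ)) ^ (143 * lam ^ 2 * (1 / 10000)) := by gcongr
              _ = (N : ℝ) ^ (2 / 5 * (143 * lam ^ 2 * (1 / 10000))) := by rw [Real.rpow_mul hN0.le]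
              _ ≤ _ := by
                  apply Real.rpow_le_rpow_of_exponent_le hN1.le
                  nlinarith [sq_nonneg lam]
      _ = _ := by
          rw [← Real.rpow_add hN0, ← Real.rpow_add hN0]; congr 2; ring
  have hroot : W ≤ (X : ℝ) ^ 2 * (N : ℝ) ^ (-(lam ^ 2 / 40 / (4 * s ^ 2))) := by
    refine (pow_le_pow_iff_left₀ hW0 (by positivity) (n := 2 * s * (2 * s)) (by positivity)).1 ?_
    refine hmain.trans_eq ?_
    rw [mul_pow, ← Real.rpow_natCast ((N : ℝ) ^ _), ← Real.rpow_mul hN0.le, ← pow_mul,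
      ← Real.rpow_natCast (X : ℝ)]
    congr 2
    · push_cast; ring
    · push_cast; field_simp
      ring
  refine hroot.trans ?_
  refine mul_le_mul_of_nonneg_left ?_ (by positivity)
  refine Real.rpow_le_rpow_of_exponent_le hN1.le (neg_le_neg ?_)
  have hs1331 : (s : ℝ) ≤ 1331 * lam ^ 2 := by
    rw [hs]; push_cast
    calc (k : ℝ) ^ 2 * 11 ≤ (11 * lam) ^ 2 * 11 := by gcongr
      _ = _ := by ring
  have hlam0 : 0 < lam := by linarith
  calc 1 / (160 * 1331 ^ 2) / lam ^ 2 = lam ^ 2 / 40 / (4 * (1331 * lam ^ 2) ^ 2) := by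
        field_simp; norm_num
    _ ≤ _ := by gcongr

end DoubleSum

section ZetaSum

theorem norm_expi_sub_le (a b : ℝ) : ‖expi a - expi b‖ ≤ 2 * π * |a - b| := by
  have h : expi a - expi b = expi b * (expi (a - b) - 1) := by
    rw [mul_sub, ← expi_add]; ring_nf
  rw [h, norm_mul, norm_expi, one_mul]
  have := Real.norm_exp_I_mul_ofReal_sub_one_le (x := 2 * π * (a - b))
  unfold expi
  refine (le_of_eq ?_).trans (this.trans_eq ?_)
  · congr 3; push_cast; ring
  · rw [Real.norm_eq_abs, abs_mul, abs_of_pos (by positivity : (0 : ℝ) < 2 * π)]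

theorem sum_Ico_int {M : Type*} [AddCommMonoid M] (X : ℕ) (F : ℤ → M) :
    ∑ x ∈ Finset.Ico (0 : ℤ) X, F x = ∑ x ∈ Finset.range X, F (x : ℤ) := by
  symm
  refine Finset.sum_bij (fun x _ => (x : ℤ)) ?_ ?_ ?_ (fun _ _ => rfl)
  · intro x hx; simp at hx ⊢; omega
  · intro a _ b _ h; exact_mod_cast h
  · intro b hb
    simp at hb
    exact ⟨b.toNat, by simp; omega, by simp; omega⟩

theorem norm_sum_shift_sub_le {a : ℕ → ℂ} (ha : ∀ n, ‖a n‖ ≤ 1) (M N h : ℕ) :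
    ‖∑ n ∈ Finset.Ico M N, a n - ∑ n ∈ Finset.Ico M N, a (n + h)‖ ≤ 2 * h := by
  induction h with
  | zero => simp
  | succ h ih =>
    have key : ‖∑ n ∈ Finset.Ico M N, a (n + h) - ∑ n ∈ Finset.Ico M N, a (n + (h + 1))‖ ≤ 2 := by
      rcases le_total M N with hMN | hMN
      · rw [← Finset.sum_sub_distrib]
        have := Finset.sum_Ico_sub (fun n => a (n + h)) hMN
        have e : ∑ n ∈ Finset.Ico M N, (a (n + h) - a (n + (h + 1))) = a (M + h) - a (N + h) := by
          rw [← neg_sub (a (N + h)), ← this, ← Finset.sum_neg_distrib]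
          exact Finset.sum_congr rfl fun n _ => by rw [neg_sub]; congr 2; ring
        rw [e]
        exact (norm_sub_le _ _).trans (by linarith [ha (M + h), ha (N + h)])
      · simp [Finset.Ico_eq_empty_of_le hMN]
    calc _ ≤ _ := norm_sub_le_norm_sub_add_norm_sub _ (∑ n ∈ Finset.Ico M N, a (n + h)) _
      _ ≤ _ := by push_cast; linarith

theorem norm_sum_le_shift {a : ℕ → ℂ} (ha : ∀ n, ‖a n‖ ≤ 1) (M N X : ℕ) {B : ℝ}
    (hB : ∀ n ∈ Finset.Ico M N,
      ‖∑ x ∈ Finset.range X, ∑ y ∈ Finset.range X, a (n + x * y)‖ ≤ X ^ 2 * B) (hX : 0 < X) :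
    ‖∑ n ∈ Finset.Ico M N, a n‖ ≤ (N - M : ℕ) * B + 2 * X ^ 2 := by
  set S := ∑ n ∈ Finset.Ico M N, a n
  have hX' : (0 : ℝ) < (X : ℝ) ^ 2 := by positivity
  have h1 : ‖∑ x ∈ Finset.range X, ∑ y ∈ Finset.range X,
      (S - ∑ n ∈ Finset.Ico M N, a (n + x * y))‖ ≤ X ^ 2 * (2 * X ^ 2) := by
    calc _ ≤ ∑ x ∈ Finset.range X, ∑ y ∈ Finset.range X, 2 * (X : ℝ) ^ 2 := by
          refine norm_sum_le_of_le _ fun x hx => norm_sum_le_of_le _ fun y hy => ?_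
          refine (norm_sum_shift_sub_le ha M N (x * y)).trans ?_
          push_cast
          rw [Finset.mem_range] at hx hy
          rw [sq]
          have hx' : (x : ℝ) ≤ X := by exact_mod_cast hx.le
          have hy' : (y : ℝ) ≤ X := by exact_mod_cast hy.le
          gcongr
      _ = _ := by simp; ring
  have h2 : ∑ x ∈ Finset.range X, ∑ y ∈ Finset.range X,
      (S - ∑ n ∈ Finset.Ico M N, a (n + x * y)) = (X : ℂ) ^ 2 * S
        - ∑ n ∈ Finset.Ico M N, ∑ x ∈ Finset.range X, ∑ y ∈ Finset.range X, a (n + x * y) := by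
    simp_rw [Finset.sum_sub_distrib]
    congr 1
    · simp; ring
    · simp_rw [Finset.sum_comm (s := Finset.range X) (t := Finset.Ico M N)]
  rw [h2] at h1
  have h3 : ‖∑ n ∈ Finset.Ico M N, ∑ x ∈ Finset.range X, ∑ y ∈ Finset.range X, a (n + x * y)‖
      ≤ (N - M : ℕ) * (X ^ 2 * B) := by
    refine (norm_sum_le_of_le _ hB).trans_eq ?_
    simp
  have h4 : (X : ℝ) ^ 2 * ‖S‖ ≤ X ^ 2 * ((N - M : ℕ) * B + 2 * X ^ 2) := by
    have : ‖(X : ℂ) ^ 2 * S‖ = (X : ℝ) ^ 2 * ‖S‖ := by simp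
    rw [← this]
    have := norm_le_norm_add_norm_sub' ((X : ℂ) ^ 2 * S)
      (∑ n ∈ Finset.Ico M N, ∑ x ∈ Finset.range X, ∑ y ∈ Finset.range X, a (n + x * y))
    linarith
  exact le_of_mul_le_mul_left h4 hX'

theorem abs_log_one_add_sub_le {z : ℝ} (hz0 : 0 ≤ z) (hz : z ≤ 1 / 2) (k : ℕ) :
    |Real.log (1 + z) - ∑ j : Fin k, (-1) ^ (j : ℕ) * z ^ ((j : ℕ) + 1) / ((j : ℕ) + 1)|
      ≤ 2 * z ^ (k + 1) := by
  have h := Real.abs_log_sub_add_sum_range_le (x := -z) (by rw [abs_neg, abs_of_nonneg hz0]; linarith) k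
  rw [abs_neg, abs_of_nonneg hz0, sub_neg_eq_add] at h
  rw [Fin.sum_univ_eq_sum_range (fun j => (-1) ^ j * z ^ (j + 1) / ((j : ℝ) + 1))]
  have e : ∑ i ∈ Finset.range k, (-z) ^ (i + 1) / ((i : ℝ) + 1)
      = -∑ j ∈ Finset.range k, (-1) ^ j * z ^ (j + 1) / ((j : ℝ) + 1) := by
    rw [← Finset.sum_neg_distrib]
    refine Finset.sum_congr rfl fun i _ => ?_
    rw [neg_pow z, pow_succ (-1 : ℝ)]; ring
  rw [e] at h
  refine (le_of_eq ?_).trans (h.trans ?_)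
  · congr 1; ring
  · rw [div_le_iff₀ (by linarith)]
    nlinarith [pow_nonneg hz0 (k + 1)]

theorem natCast_cpow_neg_mul_I {n : ℕ} (hn : 0 < n) (t : ℝ) :
    (n : ℂ) ^ (-(t * Complex.I)) = expi (-(t / (2 * π)) * Real.log n) := by
  have : (n : ℂ) ≠ 0 := by exact_mod_cast hn.ne'
  rw [Complex.cpow_def_of_ne_zero this, expi, ← Complex.natCast_log]
  congr 1
  have := Real.pi_ne_zero
  push_cast
  field_simp

/-- One long block of shifted terms. -/
theorem norm_block_le {N k n X : ℕ} {t lam B : ℝ} (hN : 32 ≤ N) (ht : t = (N : ℝ) ^ lam)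
    (hX : (X : ℝ) ≤ (N : ℝ) ^ (2 / 5 : ℝ)) (hk : 5 * lam + 2 ≤ k) (hn : N ≤ n) (hn2 : n ≤ 2 * N)
    (hB : ∀ α : Fin k → ℝ, (∀ j : Fin k,
      (N : ℝ) ^ lam / (2 * π * ((j : ℕ) + 1 : ℕ) * (2 * N) ^ ((j : ℕ) + 1)) ≤ |α j|
      ∧ |α j| ≤ (N : ℝ) ^ lam / N ^ ((j : ℕ) + 1)) →
      ‖∑ x ∈ Finset.Ico (0 : ℤ) X, ∑ y ∈ Finset.Ico (0 : ℤ) X,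
        expi (∑ j, α j * ((x : ℝ) * y) ^ ((j : ℕ) + 1))‖ ≤ (X : ℝ) ^ 2 * B) :
    ‖∑ x ∈ Finset.range X, ∑ y ∈ Finset.range X,
      ((n + x * y : ℕ) : ℂ) ^ (-(t * Complex.I))‖ ≤ (X : ℝ) ^ 2 * (B + 2 * (N : ℝ) ^ (-(3 / 5) : ℝ)) := by
  have hN0 : (0 : ℝ) < N := by positivity
  have hN1 : (1 : ℝ) ≤ N := by exact_mod_cast (by omega : 1 ≤ N)
  have hn0 : (0 : ℝ) < n := by exact_mod_cast (by omega : 0 < n)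
  have hnN : (N : ℝ) ≤ n := by exact_mod_cast hn
  have hn2N : (n : ℝ) ≤ 2 * N := by exact_mod_cast hn2
  have ht0 : 0 < t := by rw [ht]; positivity
  set α : Fin k → ℝ := fun j => -(t / (2 * π)) * ((-1) ^ (j : ℕ) / (((j : ℕ) + 1) * n ^ ((j : ℕ) + 1)))
  have hα : ∀ j, |α j| = t / (2 * π * ((j : ℕ) + 1 : ℕ) * n ^ ((j : ℕ) + 1)) := by
    intro j
    have h1 : (0 : ℝ) < ((j : ℕ) + 1) * (n : ℝ) ^ ((j : ℕ) + 1) := by positivity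
    simp only [α]
    rw [abs_mul, abs_neg, abs_of_pos (by positivity : 0 < t / (2 * π)), abs_div, abs_pow, abs_neg,
      abs_one, one_pow, abs_of_pos h1, div_mul_div_comm]
    push_cast
    rw [mul_one, mul_assoc (2 * π)]
  have hBα := hB α fun j => by
    rw [hα, ← ht]
    constructor
    · gcongr
    · gcongr
      have h2 : (1 : ℝ) ≤ 2 * π * ((j : ℕ) + 1 : ℕ) := by
        have := Real.pi_gt_three
        push_cast
        nlinarith [Nat.cast_nonneg (α := ℝ) (j : ℕ)]
      calc (N : ℝ) ^ ((j : ℕ) + 1) ≤ n ^ ((j : ℕ) + 1) := by gcongr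
        _ ≤ _ := le_mul_of_one_le_left (by positivity) h2
  rw [sum_Ico_int] at hBα
  simp_rw [sum_Ico_int] at hBα
  have hz : ∀ x ∈ Finset.range X, ∀ y ∈ Finset.range X,
      (x * y : ℝ) / n ≤ (N : ℝ) ^ (-(1 / 5) : ℝ) := by
    intro x hx y hy
    rw [Finset.mem_range] at hx hy
    have hx' : (x : ℝ) ≤ (N : ℝ) ^ (2 / 5 : ℝ) := hX.trans' (by exact_mod_cast hx.le)
    have hy' : (y : ℝ) ≤ (N : ℝ) ^ (2 / 5 : ℝ) := hX.trans' (by exact_mod_cast hy.le)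
    calc (x * y : ℝ) / n ≤ ((N : ℝ) ^ (2 / 5 : ℝ) * (N : ℝ) ^ (2 / 5 : ℝ)) / N := by gcongr
      _ = (N : ℝ) ^ (2 / 5 + 2 / 5 - 1 : ℝ) := by
        rw [Real.rpow_sub hN0, Real.rpow_add hN0, Real.rpow_one]
      _ = _ := by norm_num
  have hhalf : (N : ℝ) ^ (-(1 / 5) : ℝ) ≤ 1 / 2 := by
    calc (N : ℝ) ^ (-(1 / 5) : ℝ) ≤ (2 ^ (5 : ℝ)) ^ (-(1 / 5) : ℝ) := by
          apply Real.rpow_le_rpow_of_nonpos (by positivity) _ (by norm_num)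
          norm_num
          exact_mod_cast hN
      _ = 1 / 2 := by rw [← Real.rpow_mul (by norm_num)]; norm_num [Real.rpow_neg_one]
  set G := ∑ x ∈ Finset.range X, ∑ y ∈ Finset.range X,
    expi (∑ j, α j * (((x : ℤ) : ℝ) * ((y : ℤ) : ℝ)) ^ ((j : ℕ) + 1)) with hG
  have hdiff : ‖∑ x ∈ Finset.range X, ∑ y ∈ Finset.range X, ((n + x * y : ℕ) : ℂ) ^ (-(t * Complex.I))
      - expi (-(t / (2 * π)) * Real.log n) * G‖ ≤ X ^ 2 * (2 * (N : ℝ) ^ (-(3 / 5) : ℝ)) := by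
    rw [hG, Finset.mul_sum, ← Finset.sum_sub_distrib]
    calc _ ≤ ∑ x ∈ Finset.range X, ∑ y ∈ Finset.range X, 2 * (N : ℝ) ^ (-(3 / 5) : ℝ) := by
          refine norm_sum_le_of_le _ fun x hx => ?_
          rw [Finset.mul_sum, ← Finset.sum_sub_distrib]
          refine norm_sum_le_of_le _ fun y hy => ?_
          have hzxy := hz x hx y hy
          have hz0 : 0 ≤ (x * y : ℝ) / n := by positivity
          have hlog := abs_log_one_add_sub_le hz0 (hzxy.trans hhalf) k
          rw [natCast_cpow_neg_mul_I (by omega), ← expi_add]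
          refine (norm_expi_sub_le _ _).trans ?_
          have e : -(t / (2 * π)) * Real.log ((n + x * y : ℕ) : ℝ)
              - (-(t / (2 * π)) * Real.log n
                + ∑ j, α j * (((x : ℤ) : ℝ) * ((y : ℤ) : ℝ)) ^ ((j : ℕ) + 1))
              = -(t / (2 * π)) * (Real.log (1 + x * y / n)
                - ∑ j : Fin k, (-1) ^ (j : ℕ) * ((x * y : ℝ) / n) ^ ((j : ℕ) + 1) / ((j : ℕ) + 1)) := by
            have e1 : Real.log ((n + x * y : ℕ) : ℝ) = Real.log n + Real.log (1 + x * y / n) := by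
              rw [← Real.log_mul hn0.ne' (by positivity)]
              congr 1; push_cast; field_simp
            have e2 : ∑ j, α j * (((x : ℤ) : ℝ) * ((y : ℤ) : ℝ)) ^ ((j : ℕ) + 1)
                = -(t / (2 * π)) * ∑ j : Fin k,
                  (-1) ^ (j : ℕ) * ((x * y : ℝ) / n) ^ ((j : ℕ) + 1) / ((j : ℕ) + 1) := by
              rw [Finset.mul_sum]
              refine Finset.sum_congr rfl fun j _ => ?_
              simp only [α]
              push_cast
              rw [div_pow]
              field_simp
            rw [e1, e2]; ring
          rw [e, abs_mul, abs_neg, abs_of_pos (by positivity : 0 < t / (2 * π))]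
          have e3 (A : ℝ) : 2 * π * (t / (2 * π) * A) = t * A := by field_simp
          rw [e3]
          calc _ ≤ t * (2 * ((x * y : ℝ) / n) ^ (k + 1)) := by gcongr
            _ ≤ t * (2 * ((N : ℝ) ^ (-(1 / 5) : ℝ)) ^ (k + 1)) := by gcongr
            _ = 2 * (N : ℝ) ^ (lam - (k + 1) / 5) := by
              rw [ht, ← Real.rpow_natCast, ← Real.rpow_mul hN0.le, sub_eq_add_neg, Real.rpow_add hN0]
              push_cast
              rw [show -(1 / 5) * ((k : ℝ) + 1) = -((k + 1) / 5) by ring]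
              ring
            _ ≤ _ := by
              gcongr
              linarith
      _ = _ := by simp; ring
  have hfin : ‖expi (-(t / (2 * π)) * Real.log n) * G‖ ≤ (X : ℝ) ^ 2 * B := by
    rw [norm_mul, norm_expi, one_mul]; exact hBα
  have := norm_le_norm_add_norm_sub' (∑ x ∈ Finset.range X, ∑ y ∈ Finset.range X,
    ((n + x * y : ℕ) : ℂ) ^ (-(t * Complex.I))) (expi (-(t / (2 * π)) * Real.log n) * G)
  linarith

theorem zetaSum_le : ∃ C c : ℝ, 0 < C ∧ 0 < c ∧ ∀ (M N N' : ℕ) (t : ℝ), 2 ≤ t → 1 ≤ N →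
    (N : ℝ) ≤ t ^ 2 → N ≤ M → N' ≤ 2 * N →
    ‖∑ n ∈ Finset.Ico M N', (n : ℂ) ^ (-(t * Complex.I))‖
      ≤ C * N * Real.exp (-(c * Real.log N ^ 3 / Real.log t ^ 2)) := by
  obtain ⟨K, c₀, hK, hc₀, hdouble⟩ := doubleSum_le
  set c := min c₀ (1 / 20) with hc
  have hc0 : 0 < c := by positivity
  refine ⟨5 + Real.exp (c * K), c, by positivity, hc0, ?_⟩
  intro M N N' t ht hN1 hNt hMN hN'
  have hlt : 0 < Real.log t := Real.log_pos (by linarith)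
  have hN1' : (1 : ℝ) ≤ N := by exact_mod_cast hN1
  have hN0 : (0 : ℝ) < N := by linarith
  have hcard : ((N' - M : ℕ) : ℝ) ≤ N := by exact_mod_cast (by omega : N' - M ≤ N)
  have hunit : ∀ n : ℕ, ‖(n : ℂ) ^ (-(t * Complex.I))‖ ≤ 1 := by
    intro n
    rcases Nat.eq_zero_or_pos n with rfl | hn
    · rw [Nat.cast_zero, Complex.zero_cpow]
      · simp
      · simp; linarith
    · rw [natCast_cpow_neg_mul_I hn, norm_expi]
  have hexp0 := Real.exp_pos (-(c * Real.log N ^ 3 / Real.log t ^ 2))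
  rcases lt_or_ge (Real.log N ^ 3) (K * Real.log t ^ 2) with hsmall | hbig
  · calc _ ≤ ∑ n ∈ Finset.Ico M N', (1 : ℝ) := norm_sum_le_of_le _ fun n _ => hunit n
      _ = ((N' - M : ℕ) : ℝ) := by simp
      _ ≤ N := hcard
      _ = N * 1 := (mul_one _).symm
      _ ≤ N * ((5 + Real.exp (c * K)) * Real.exp (-(c * Real.log N ^ 3 / Real.log t ^ 2))) := by
        gcongr
        rw [add_mul, ← Real.exp_add]
        have : 0 ≤ c * K + -(c * Real.log N ^ 3 / Real.log t ^ 2) := by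
          rw [mul_div_assoc]
          have : Real.log N ^ 3 / Real.log t ^ 2 ≤ K := by
            rw [div_le_iff₀ (by positivity)]; exact hsmall.le
          nlinarith
        have := Real.one_le_exp this
        nlinarith
      _ = _ := by ring
  · have hlN : 0 < Real.log N := by
      by_contra h
      have h0 : 0 ≤ Real.log N := Real.log_nonneg hN1'
      have : Real.log N = 0 := by linarith
      rw [this] at hbig
      have : 0 < K * Real.log t ^ 2 := by positivity
      norm_num at hbig
      linarith
    set lam := Real.log t / Real.log N with hlam
    have hlam0 : 0 < lam := by positivity
    have hlt' : Real.log t = lam * Real.log N := by rw [hlam]; field_simp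
    have htN : t = (N : ℝ) ^ lam := by
      rw [Real.rpow_def_of_pos hN0, mul_comm, ← hlt', Real.exp_log (by linarith)]
    have hlam2 : 1 / 2 ≤ lam := by
      have := Real.log_le_log hN0 hNt
      rw [Real.log_pow] at this
      rw [hlam, le_div_iff₀ hlN]
      push_cast at this
      linarith
    have hKl : K * lam ^ 2 ≤ Real.log N := by
      rw [hlt'] at hbig
      have : (K * lam ^ 2) * Real.log N ^ 2 ≤ Real.log N * Real.log N ^ 2 := by linarith
      exact le_of_mul_le_mul_right this (by positivity)
    have hN32 : 32 ≤ N := by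
      have h1 : (1000 : ℝ) ≤ Real.log N := by nlinarith
      have h2 := Real.log_le_sub_one_of_pos hN0
      have : (32 : ℝ) ≤ N := by linarith
      exact_mod_cast this
    set k := ⌈5 * lam + 2⌉₊ with hk
    have hk1 : 5 * lam + 2 ≤ k := Nat.le_ceil _
    have hk2 : (k : ℝ) ≤ 5 * lam + 3 := by
      have := Nat.ceil_lt_add_one (a := 5 * lam + 2) (by linarith)
      rw [← hk] at this; linarith
    set X := ⌊(N : ℝ) ^ (2 / 5 : ℝ)⌋₊ with hX
    have hXu : (X : ℝ) ≤ (N : ℝ) ^ (2 / 5 : ℝ) := Nat.floor_le (by positivity)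
    have hX1 : 0 < X := by
      rw [hX, Nat.floor_pos]; exact Real.one_le_rpow hN1' (by norm_num)
    set B := (N : ℝ) ^ (-(c₀ / lam ^ 2)) with hB
    have hS := norm_sum_le_shift hunit M N' X (B := B + 2 * (N : ℝ) ^ (-(3 / 5) : ℝ))
      (fun n hn => by
        rw [Finset.mem_Ico] at hn
        exact norm_block_le hN32 htN hXu hk1 (by omega) (by omega)
          (fun α hα => hdouble N k lam hlam2 hKl hk1 hk2 α hα)) hX1
    have hE : Real.exp (-(c * Real.log N ^ 3 / Real.log t ^ 2)) = (N : ℝ) ^ (-(c / lam ^ 2)) := by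
      rw [Real.rpow_def_of_pos hN0, hlt']
      congr 1
      field_simp
    rw [hE]
    have hcl : c / lam ^ 2 ≤ 1 / 5 := by
      rw [div_le_iff₀ (by positivity)]
      have : c ≤ 1 / 20 := min_le_right _ _
      nlinarith
    set E := (N : ℝ) ^ (-(c / lam ^ 2)) with hEdef
    have hE0 : 0 < E := by positivity
    have hBE : B ≤ E := by
      apply Real.rpow_le_rpow_of_exponent_le hN1'
      have : c ≤ c₀ := min_le_left _ _
      have : c / lam ^ 2 ≤ c₀ / lam ^ 2 := by gcongr
      linarith
    have h3 : (N : ℝ) ^ (-(3 / 5) : ℝ) ≤ E :=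
      Real.rpow_le_rpow_of_exponent_le hN1' (by linarith)
    have h5 : (X : ℝ) ^ 2 ≤ N * E := by
      calc (X : ℝ) ^ 2 ≤ ((N : ℝ) ^ (2 / 5 : ℝ)) ^ 2 := by gcongr
        _ = N * (N : ℝ) ^ (-(1 / 5) : ℝ) := by
          rw [← Real.rpow_natCast, ← Real.rpow_mul hN0.le, ← Real.rpow_one_add' hN0.le (by norm_num)]
          norm_num
        _ ≤ _ := by
          gcongr
          exact Real.rpow_le_rpow_of_exponent_le hN1' (by linarith)
    calc _ ≤ _ := hS
      _ ≤ N * (E + 2 * E) + 2 * (N * E) := by gcongr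
      _ ≤ _ := by nlinarith [Real.exp_pos (c * K), mul_pos hN0 hE0, mul_pos (mul_pos hN0 hE0) (Real.exp_pos (c * K))]

end ZetaSum

section ZetaApprox

/-- The difference between `n ^ (-s)` and the integral of `x ^ (-s)` over `[n, n + 1]`. -/
noncomputable def zetaRemainder (n : ℕ) (s : ℂ) : ℂ :=
  (n : ℂ) ^ (-s) - (((n + 1 : ℕ) : ℂ) ^ (1 - s) - (n : ℂ) ^ (1 - s)) / (1 - s)

theorem hasDerivAt_ofReal_cpow' {x : ℝ} (hx : 0 < x) (r : ℂ) :
    HasDerivAt (fun y : ℝ => (y : ℂ) ^ r) (r * (x : ℂ) ^ (r - 1)) x := by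
  rcases eq_or_ne r 0 with rfl | hr
  · simpa using hasDerivAt_const x (1 : ℂ)
  · have h := hasDerivAt_ofReal_cpow_const' (x := x) hx.ne' (r := r - 1) (by
      intro h; exact hr (by linear_combination h))
    simp only [sub_add_cancel] at h
    have := h.const_mul r
    refine this.congr_of_eventuallyEq ?_
    filter_upwards with y
    field_simp

theorem norm_zetaRemainder_le {n : ℕ} (hn : 0 < n) {s : ℂ} (hs : 0 < s.re) (hs1 : s ≠ 1) :
    ‖zetaRemainder n s‖ ≤ ‖s‖ * (n : ℝ) ^ (-s.re - 1) := by
  have hn0 : (0 : ℝ) < n := by exact_mod_cast hn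
  have h1s : 1 - s ≠ 0 := sub_ne_zero.2 hs1.symm
  set S := Set.Icc (n : ℝ) (n + 1)
  have hconv : Convex ℝ S := convex_Icc _ _
  have hnS : (n : ℝ) ∈ S := ⟨le_rfl, by linarith⟩
  have hn1S : (n + 1 : ℝ) ∈ S := ⟨by linarith, le_rfl⟩
  have hstep : ∀ x ∈ S, ‖(n : ℂ) ^ (-s) - (x : ℂ) ^ (-s)‖ ≤ ‖s‖ * (n : ℝ) ^ (-s.re - 1) := by
    intro x hx
    have hd : ∀ y ∈ S, HasDerivWithinAt (fun y : ℝ => (y : ℂ) ^ (-s)) (-s * (y : ℂ) ^ (-s - 1)) S y :=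
      fun y hy => (hasDerivAt_ofReal_cpow' (hn0.trans_le hy.1) (-s)).hasDerivWithinAt
    have hb : ∀ y ∈ S, ‖-s * (y : ℂ) ^ (-s - 1)‖ ≤ ‖s‖ * (n : ℝ) ^ (-s.re - 1) := by
      intro y hy
      have hy0 : 0 < y := hn0.trans_le hy.1
      rw [norm_mul, norm_neg, Complex.norm_cpow_eq_rpow_re_of_pos hy0]
      refine mul_le_mul_of_nonneg_left ?_ (norm_nonneg _)
      simp only [Complex.sub_re, Complex.neg_re, Complex.one_re]
      exact Real.rpow_le_rpow_of_nonpos hn0 hy.1 (by linarith)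
    have := hconv.norm_image_sub_le_of_norm_hasDerivWithin_le hd hb hx hnS
    rw [Complex.ofReal_natCast] at this
    refine this.trans ?_
    have hle : ‖(n : ℝ) - x‖ ≤ 1 := by
      rw [Real.norm_eq_abs, abs_le]; constructor <;> linarith [hx.1, hx.2]
    exact mul_le_of_le_one_right (by positivity) hle
  have hd : ∀ y ∈ S, HasDerivWithinAt
      (fun y : ℝ => (n : ℂ) ^ (-s) * y - (y : ℂ) ^ (1 - s) / (1 - s))
      ((n : ℂ) ^ (-s) - (y : ℂ) ^ (-s)) S y := by
    intro y hy
    have h1 := (hasDerivAt_ofReal_cpow' (hn0.trans_le hy.1) (1 - s)).div_const (1 - s)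
    have h2 : HasDerivAt (fun y : ℝ => (n : ℂ) ^ (-s) * y) ((n : ℂ) ^ (-s)) y := by
      simpa using (Complex.ofRealCLM.hasDerivAt (x := y)).const_mul ((n : ℂ) ^ (-s))
    have h3 := h2.sub h1
    rw [mul_div_cancel_left₀ _ h1s, show 1 - s - 1 = -s by ring] at h3
    exact h3.hasDerivWithinAt
  have := hconv.norm_image_sub_le_of_norm_hasDerivWithin_le hd hstep hnS hn1S
  have e : (n + 1 : ℝ) - n = 1 := by ring
  rw [e, norm_one, mul_one] at this
  refine (le_of_eq ?_).trans this
  congr 1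
  unfold zetaRemainder
  push_cast
  ring

theorem differentiableAt_zetaRemainder {n : ℕ} (hn : 0 < n) {s : ℂ} (hs1 : s ≠ 1) :
    DifferentiableAt ℂ (zetaRemainder n) s := by
  unfold zetaRemainder
  have h1s : 1 - s ≠ 0 := sub_ne_zero.2 hs1.symm
  have hn' : (n : ℂ) ≠ 0 := by exact_mod_cast hn.ne'
  have hn1' : ((n + 1 : ℕ) : ℂ) ≠ 0 := by exact_mod_cast n.succ_ne_zero
  refine DifferentiableAt.sub ?_ (DifferentiableAt.div (DifferentiableAt.sub ?_ ?_) (by fun_prop) h1s)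
  · exact DifferentiableAt.const_cpow (by fun_prop) (.inl hn')
  · exact DifferentiableAt.const_cpow (by fun_prop) (.inl hn1')
  · exact DifferentiableAt.const_cpow (by fun_prop) (.inl hn')

theorem sum_zetaRemainder (M K : ℕ) (s : ℂ) :
    ∑ n ∈ Finset.range K, zetaRemainder (n + M) s = ∑ n ∈ Finset.range K, ((n + M : ℕ) : ℂ) ^ (-s)
      - (((K + M : ℕ) : ℂ) ^ (1 - s) - (M : ℂ) ^ (1 - s)) / (1 - s) := by
  induction K with
  | zero => simp
  | succ K ih =>
    rw [Finset.sum_range_succ, ih, Finset.sum_range_succ, zetaRemainder]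
    rw [show K + M + 1 = K + 1 + M by ring]
    ring

theorem summable_natCast_add_rpow (M : ℕ) {a : ℝ} (ha : 0 < a) :
    Summable fun n : ℕ => ((n + M : ℕ) : ℝ) ^ (-a - 1) :=
  (summable_nat_add_iff M).2 (Real.summable_nat_rpow.2 (by linarith))

theorem riemannZeta_eq_of_one_lt_re {M : ℕ} (hM : 0 < M) {s : ℂ} (hs : 1 < s.re) :
    riemannZeta s = ∑ n ∈ Finset.Ico 1 M, (n : ℂ) ^ (-s) - (M : ℂ) ^ (1 - s) / (1 - s)
      + ∑' n : ℕ, zetaRemainder (n + M) s := by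
  have hs0 : s ≠ 0 := by rintro rfl; simp at hs; linarith
  have hs1 : s ≠ 1 := by rintro rfl; simp at hs
  have hsum : Summable fun n : ℕ => (n : ℂ) ^ (-s) := by
    have := Complex.summable_one_div_nat_cpow.2 hs
    simpa [Complex.cpow_neg] using this
  have hz : riemannZeta s = ∑' n : ℕ, (n : ℂ) ^ (-s) := by
    rw [zeta_eq_tsum_one_div_nat_cpow hs]
    simp [Complex.cpow_neg]
  have hr : Summable fun n : ℕ => zetaRemainder (n + M) s := by
    refine Summable.of_norm_bounded (g := fun n : ℕ => ‖s‖ * ((n + M : ℕ) : ℝ) ^ (-s.re - 1))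
      ((summable_natCast_add_rpow M (by linarith)).mul_left _) fun n => ?_
    exact norm_zetaRemainder_le (by omega) (by linarith) hs1
  have h1 : Filter.Tendsto (fun K : ℕ => ∑ n ∈ Finset.range K, zetaRemainder (n + M) s) Filter.atTop
      (nhds (∑' n : ℕ, ((n + M : ℕ) : ℂ) ^ (-s) - (0 - (M : ℂ) ^ (1 - s)) / (1 - s))) := by
    simp_rw [sum_zetaRemainder]
    refine Filter.Tendsto.sub ?_ ((Filter.Tendsto.sub ?_ tendsto_const_nhds).div_const _)
    · exact ((summable_nat_add_iff M).2 hsum).hasSum.tendsto_sum_nat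
    · rw [tendsto_zero_iff_norm_tendsto_zero]
      have h : Filter.Tendsto (fun K : ℕ => ((K + M : ℕ) : ℝ) ^ (-(s.re - 1))) Filter.atTop (nhds 0) :=
        (tendsto_rpow_neg_atTop (by linarith)).comp
          (tendsto_natCast_atTop_atTop.comp (Filter.tendsto_add_atTop_nat M))
      refine h.congr fun K => ?_
      rw [Complex.norm_natCast_cpow_of_pos (by omega)]
      simp
  have h2 := tendsto_nhds_unique hr.hasSum.tendsto_sum_nat h1
  rw [h2, hz, ← hsum.sum_add_tsum_nat_add M, Finset.range_eq_Ico, Finset.sum_eq_sum_Ico_succ_bot hM]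
  rw [Nat.cast_zero, Complex.zero_cpow (neg_ne_zero.2 hs0)]
  ring

theorem convex_reProdIm {u v : Set ℝ} (hu : Convex ℝ u) (hv : Convex ℝ v) : Convex ℝ (u ×ℂ v) :=
  (hu.linear_preimage Complex.reLm).inter (hv.linear_preimage Complex.imLm)

theorem riemannZeta_eq_of_im_pos {M : ℕ} (hM : 0 < M) {s : ℂ} (hs : 0 < s.re) (hs' : 0 < s.im) :
    riemannZeta s = ∑ n ∈ Finset.Ico 1 M, (n : ℂ) ^ (-s) - (M : ℂ) ^ (1 - s) / (1 - s)
      + ∑' n : ℕ, zetaRemainder (n + M) s := by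
  set B := s.re + s.im + 3 with hB
  set U : Set ℂ := Set.Ioo (s.re / 2) B ×ℂ Set.Ioo 0 B with hU
  have hUo : IsOpen U := isOpen_Ioo.reProdIm isOpen_Ioo
  have hUc : IsPreconnected U := (convex_reProdIm (convex_Ioo _ _) (convex_Ioo _ _)).isPreconnected
  have hU1 : ∀ z ∈ U, z ≠ 1 := by
    rintro z hz rfl
    have := hz.2.1
    simp at this
  have hM' : (M : ℂ) ≠ 0 := by exact_mod_cast hM.ne'
  have hf : AnalyticOnNhd ℂ riemannZeta U := DifferentiableOn.analyticOnNhd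
    (fun z hz => (differentiableAt_riemannZeta (hU1 z hz)).differentiableWithinAt) hUo
  have hg : AnalyticOnNhd ℂ (fun s => ∑ n ∈ Finset.Ico 1 M, (n : ℂ) ^ (-s)
      - (M : ℂ) ^ (1 - s) / (1 - s) + ∑' n : ℕ, zetaRemainder (n + M) s) U := by
    refine DifferentiableOn.analyticOnNhd (DifferentiableOn.add ?_ ?_) hUo
    · refine fun z hz => DifferentiableAt.differentiableWithinAt (DifferentiableAt.sub ?_
        (DifferentiableAt.div ?_ (by fun_prop) (sub_ne_zero.2 (hU1 z hz).symm)))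
      · refine DifferentiableAt.fun_sum fun n hn => ?_
        have : (n : ℂ) ≠ 0 := by
          rw [Finset.mem_Ico] at hn
          exact_mod_cast (by omega : n ≠ 0)
        exact DifferentiableAt.const_cpow (by fun_prop) (.inl this)
      · exact DifferentiableAt.const_cpow (by fun_prop) (.inl hM')
    · refine Complex.differentiableOn_tsum_of_summable_norm
        (u := fun n : ℕ => (2 * B) * ((n + M : ℕ) : ℝ) ^ (-(s.re / 2) - 1))
        ((summable_natCast_add_rpow M (by linarith)).mul_left _) ?_ hUo ?_
      · exact fun n z hz => (differentiableAt_zetaRemainder (by omega)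
          (hU1 z hz)).differentiableWithinAt
      · intro n z hz
        have hzre := hz.1
        have hzim := hz.2
        simp only [Set.mem_preimage, Set.mem_Ioo] at hzre hzim
        refine (norm_zetaRemainder_le (by omega) (by linarith) (hU1 z hz)).trans ?_
        refine mul_le_mul ?_ ?_ (by positivity) (by linarith)
        · refine (Complex.norm_le_abs_re_add_abs_im z).trans ?_
          rw [abs_of_pos (by linarith), abs_of_pos (by linarith)]
          linarith
        · refine Real.rpow_le_rpow_of_exponent_le ?_ (by linarith)
          exact_mod_cast (by omega : 1 ≤ n + M)
  have hz₀ : (⟨s.re + 2, s.im⟩ : ℂ) ∈ U :=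
    ⟨⟨by simp; linarith, by simp; linarith⟩, ⟨hs', by simp; linarith⟩⟩
  have hsU : s ∈ U := ⟨⟨by linarith, by linarith⟩, ⟨hs', by linarith⟩⟩
  refine hf.eqOn_of_preconnected_of_eventuallyEq hg hUc hz₀ ?_ hsU
  have hopen : IsOpen {z : ℂ | 1 < z.re} := isOpen_lt continuous_const Complex.continuous_re
  filter_upwards [hopen.mem_nhds (show (⟨s.re + 2, s.im⟩ : ℂ) ∈ {z : ℂ | 1 < z.re} by
    simp only [Set.mem_ofPred_eq]; linarith)] with z hz
  exact riemannZeta_eq_of_one_lt_re hM hz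

/-- Approximation of `ζ` by a partial sum of length about the square of the height. -/
theorem norm_riemannZeta_sub_sum_le : ∃ C : ℝ, 0 < C ∧ ∀ (s : ℂ) (M : ℕ), 3 / 4 ≤ s.re → s.re ≤ 3 →
    2 ≤ s.im → s.im ^ 2 / 2 ≤ M → (M : ℝ) ≤ s.im ^ 2 →
    ‖riemannZeta s - ∑ n ∈ Finset.Ico 1 M, (n : ℂ) ^ (-s)‖ ≤ C := by
  set D := ∑' n : ℕ, ((n + 1 : ℕ) : ℝ) ^ (-(1 / 4 : ℝ) - 1) with hD
  have hD0 : 0 ≤ D := tsum_nonneg fun n => by positivity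
  refine ⟨1 + 6 * D, by positivity, fun s M h1 h2 h3 h4 h5 => ?_⟩
  have hM : 0 < M := by
    have : (0 : ℝ) < M := by nlinarith
    exact_mod_cast this
  have hM1 : (1 : ℝ) ≤ M := by exact_mod_cast hM
  have hs1 : s ≠ 1 := by rintro rfl; simp at h3; linarith
  rw [riemannZeta_eq_of_im_pos hM (by linarith) (by linarith)]
  have e : ∀ a b c : ℂ, a - b + c - a = c - b := by intros; ring
  rw [e]
  refine (norm_sub_le _ _).trans ?_
  have hroot : (M : ℝ) ^ (1 / 2 : ℝ) ≤ s.im := by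
    rw [← Real.sqrt_eq_rpow]
    exact Real.sqrt_le_iff.2 ⟨by linarith, h5⟩
  have hroot2 : s.im ≤ 2 * (M : ℝ) ^ (1 / 2 : ℝ) := by
    rw [← Real.sqrt_eq_rpow]
    have h0 := Real.sqrt_nonneg (M : ℝ)
    have := Real.sq_sqrt (by linarith : (0 : ℝ) ≤ M)
    nlinarith
  have hA : ‖(M : ℂ) ^ (1 - s) / (1 - s)‖ ≤ 1 := by
    rw [norm_div, Complex.norm_natCast_cpow_of_pos hM]
    have him : s.im ≤ ‖1 - s‖ := by
      have := Complex.abs_im_le_norm (1 - s)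
      simp at this
      exact (le_abs_self _).trans this
    rw [div_le_one (by linarith)]
    refine le_trans ?_ (hroot.trans him)
    exact Real.rpow_le_rpow_of_exponent_le hM1 (by simp; linarith)
  have hsn : ‖s‖ ≤ 3 * s.im := by
    refine (Complex.norm_le_abs_re_add_abs_im s).trans ?_
    rw [abs_of_pos (by linarith), abs_of_pos (by linarith)]
    linarith
  have hBn : ∀ n : ℕ, ‖zetaRemainder (n + M) s‖ ≤ 6 * ((n + 1 : ℕ) : ℝ) ^ (-(1 / 4 : ℝ) - 1) := by
    intro n
    refine (norm_zetaRemainder_le (by omega) (by linarith) hs1).trans ?_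
    have hnM : (1 : ℝ) ≤ (n + M : ℕ) := by exact_mod_cast (by omega : 1 ≤ n + M)
    have h0 : (0 : ℝ) < (n + M : ℕ) := by linarith
    calc ‖s‖ * ((n + M : ℕ) : ℝ) ^ (-s.re - 1)
        ≤ (6 * (M : ℝ) ^ (1 / 2 : ℝ)) * ((n + M : ℕ) : ℝ) ^ (-(1 / 2 : ℝ) + (-(1 / 4 : ℝ) - 1)) := by
          refine mul_le_mul (by linarith) ?_ (by positivity) (by positivity)
          exact Real.rpow_le_rpow_of_exponent_le hnM (by linarith)
      _ = 6 * ((M : ℝ) ^ (1 / 2 : ℝ) * ((n + M : ℕ) : ℝ) ^ (-(1 / 2 : ℝ)))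
          * ((n + M : ℕ) : ℝ) ^ (-(1 / 4 : ℝ) - 1) := by
          rw [Real.rpow_add h0]; ring
      _ ≤ 6 * ((M : ℝ) ^ (1 / 2 : ℝ) * (M : ℝ) ^ (-(1 / 2 : ℝ)))
          * ((n + 1 : ℕ) : ℝ) ^ (-(1 / 4 : ℝ) - 1) := by
          have i1 : ((n + M : ℕ) : ℝ) ^ (-(1 / 2 : ℝ)) ≤ (M : ℝ) ^ (-(1 / 2 : ℝ)) :=
            Real.rpow_le_rpow_of_nonpos (by linarith) (by exact_mod_cast (by omega)) (by norm_num)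
          have i2 : ((n + M : ℕ) : ℝ) ^ (-(1 / 4 : ℝ) - 1) ≤ ((n + 1 : ℕ) : ℝ) ^ (-(1 / 4 : ℝ) - 1) :=
            Real.rpow_le_rpow_of_nonpos (by positivity) (by exact_mod_cast (by omega)) (by norm_num)
          gcongr
      _ = _ := by
          rw [← Real.rpow_add (by linarith)]; simp
  have hB : ‖∑' n : ℕ, zetaRemainder (n + M) s‖ ≤ 6 * D := by
    refine tsum_of_norm_bounded ?_ hBn
    exact (summable_natCast_add_rpow 1 (by norm_num)).hasSum.mul_left 6
  linarith

end ZetaApprox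

section ZetaBound

theorem norm_sum_mul_le_of_antitone {f : ℕ → ℝ} {a : ℕ → ℂ} {M N : ℕ} {B : ℝ}
    (hf0 : ∀ n, M ≤ n → 0 ≤ f n) (hf : ∀ n, M ≤ n → f (n + 1) ≤ f n) (hMN : M ≤ N)
    (hB : ∀ n, M ≤ n → n ≤ N → ‖∑ k ∈ Finset.Ico M n, a k‖ ≤ B) :
    ‖∑ k ∈ Finset.Ico M N, (f k : ℂ) * a k‖ ≤ f M * B := by
  have key : ∀ n, M ≤ n → n ≤ N → ‖∑ k ∈ Finset.Ico M n, (f k : ℂ) * a k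
      - f n * ∑ k ∈ Finset.Ico M n, a k‖ ≤ (f M - f n) * B := by
    intro n hn
    induction n, hn using Nat.le_induction with
    | base => simp
    | succ n hn ih =>
      intro hnN
      have h1 := ih (by omega)
      have h2 := hB (n + 1) (by omega) hnN
      rw [Finset.sum_Ico_succ_top hn] at h2
      rw [Finset.sum_Ico_succ_top hn, Finset.sum_Ico_succ_top hn]
      have e : ∑ k ∈ Finset.Ico M n, (f k : ℂ) * a k + f n * a n
          - f (n + 1) * (∑ k ∈ Finset.Ico M n, a k + a n)
          = (∑ k ∈ Finset.Ico M n, (f k : ℂ) * a k - f n * ∑ k ∈ Finset.Ico M n, a k)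
            + ((f n - f (n + 1) : ℝ) : ℂ) * (∑ k ∈ Finset.Ico M n, a k + a n) := by
        push_cast; ring
      rw [e]
      refine (norm_add_le _ _).trans ?_
      rw [norm_mul, Complex.norm_real, Real.norm_of_nonneg (by linarith [hf n hn])]
      have := mul_le_mul_of_nonneg_left h2 (by linarith [hf n hn] : 0 ≤ f n - f (n + 1))
      linarith
  have h1 := key N hMN le_rfl
  have h2 := hB N hMN le_rfl
  have h3 := norm_le_norm_add_norm_sub' (∑ k ∈ Finset.Ico M N, (f k : ℂ) * a k)
    (f N * ∑ k ∈ Finset.Ico M N, a k)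
  rw [norm_mul, Complex.norm_real, Real.norm_of_nonneg (hf0 N hMN)] at h3
  have := mul_le_mul_of_nonneg_left h2 (hf0 N hMN)
  linarith

theorem linear_sub_cubic_le {η u c L : ℝ} (hη : 0 ≤ η) (hu : 0 ≤ u) (hc : 0 < c) (hL : 0 < L) :
    η * u - c * u ^ 3 / L ^ 2 ≤ η * √η * L / √c := by
  have hsc : 0 < √c := Real.sqrt_pos.2 hc
  rcases le_or_gt u (√η * L / √c) with h | h
  · have h1 : 0 ≤ c * u ^ 3 / L ^ 2 := by positivity
    calc _ ≤ η * u := by linarith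
      _ ≤ η * (√η * L / √c) := by gcongr
      _ = _ := by ring
  · have h0 : 0 ≤ η * √η * L / √c := by positivity
    refine le_trans ?_ h0
    rw [sub_nonpos, le_div_iff₀ (by positivity)]
    rw [div_lt_iff₀ hsc] at h
    have h2 : (√η * L) ^ 2 ≤ (u * √c) ^ 2 := by gcongr
    rw [mul_pow, mul_pow, Real.sq_sqrt hη, Real.sq_sqrt hc.le] at h2
    nlinarith

theorem norm_block_cpow_le : ∃ C A : ℝ, 0 < C ∧ 0 < A ∧ ∀ (T : ℝ) (s : ℂ) (j : ℕ), 16 ≤ T →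
    2 ≤ s.im → s.im ≤ T → 0 ≤ s.re → 1 - (Real.log (Real.log T) / Real.log T) ^ (2 / 3 : ℝ) ≤ s.re →
    ((2 ^ j : ℕ) : ℝ) ≤ s.im ^ 2 →
    ‖∑ n ∈ Finset.Ico ((2 : ℕ) ^ j) (2 ^ (j + 1)), (n : ℂ) ^ (-s)‖ ≤ C * Real.log T ^ A := by
  obtain ⟨C, c, hC, hc, h⟩ := zetaSum_le
  refine ⟨C, 1 / √c, hC, by positivity, fun T s j hT ht2 htT hs0 hs hj => ?_⟩
  set t := s.im
  set L := Real.log T with hL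
  have hL1 : 1 < L := by
    rw [hL, Real.lt_log_iff_exp_lt (by linarith)]
    linarith [Real.exp_one_lt_d9]
  have hlL : 0 < Real.log L := Real.log_pos hL1
  set η := (Real.log L / L) ^ (2 / 3 : ℝ) with hη
  have hη0 : 0 ≤ η := by positivity
  have hη3 : η * √η * L = Real.log L := by
    have : η * √η = Real.log L / L := by
      rw [Real.sqrt_eq_rpow, hη, ← Real.rpow_mul (by positivity), ← Real.rpow_add (by positivity)]
      norm_num
    rw [this]; field_simp
  have hpos : 0 < (2 : ℕ) ^ j := by positivity
  have hlt : 0 < Real.log t := Real.log_pos (by linarith)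
  have hltL : Real.log t ≤ L := Real.log_le_log (by linarith) htT
  have h2j : (0 : ℝ) < ((2 ^ j : ℕ) : ℝ) := by exact_mod_cast hpos
  have hu0 : 0 ≤ Real.log ((2 ^ j : ℕ) : ℝ) := Real.log_nonneg (by exact_mod_cast hpos)
  set u := Real.log ((2 ^ j : ℕ) : ℝ) with hu
  have hsplit : ∀ n ∈ Finset.Ico ((2 : ℕ) ^ j) (2 ^ (j + 1)), (n : ℂ) ^ (-s)
      = (((n : ℝ) ^ (-s.re) : ℝ) : ℂ) * (n : ℂ) ^ (-(t * Complex.I)) := by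
    intro n hn
    rw [Finset.mem_Ico] at hn
    have hn0 : (n : ℂ) ≠ 0 := by exact_mod_cast (by omega : n ≠ 0)
    rw [Complex.ofReal_cpow (Nat.cast_nonneg n), Complex.ofReal_natCast, ← Complex.cpow_add _ _ hn0]
    congr 1
    nth_rw 1 [← Complex.re_add_im s]
    push_cast
    ring
  rw [Finset.sum_congr rfl hsplit]
  have hpow : (2 : ℕ) ^ j ≤ 2 ^ (j + 1) := Nat.pow_le_pow_right (by norm_num) (by omega)
  have hanti : ∀ n : ℕ, 2 ^ j ≤ n → ((n + 1 : ℕ) : ℝ) ^ (-s.re) ≤ (n : ℝ) ^ (-s.re) := by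
    intro n hn
    apply Real.rpow_le_rpow_of_nonpos _ (by push_cast; linarith) (by linarith)
    exact_mod_cast (by omega : 0 < n)
  have := norm_sum_mul_le_of_antitone (f := fun n : ℕ => (n : ℝ) ^ (-s.re))
    (a := fun n : ℕ => (n : ℂ) ^ (-(t * Complex.I))) (M := 2 ^ j) (N := 2 ^ (j + 1))
    (B := C * ((2 ^ j : ℕ) : ℝ) * Real.exp (-(c * u ^ 3 / Real.log t ^ 2)))
    (fun n _ => by positivity) hanti hpow
    (fun n hn hn' => h (2 ^ j) (2 ^ j) n t ht2 (by omega) hj le_rfl (by rw [pow_succ] at hn'; omega))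
  refine this.trans ?_
  calc ((2 ^ j : ℕ) : ℝ) ^ (-s.re) * (C * ((2 ^ j : ℕ) : ℝ) * Real.exp (-(c * u ^ 3 / Real.log t ^ 2)))
      = C * (Real.exp ((1 - s.re) * u) * Real.exp (-(c * u ^ 3 / Real.log t ^ 2))) := by
        have e1 : ((2 ^ j : ℕ) : ℝ) ^ (-s.re) = Real.exp (-s.re * u) := by
          rw [Real.rpow_def_of_pos h2j, mul_comm]
        have e2 : ((2 ^ j : ℕ) : ℝ) = Real.exp u := (Real.exp_log h2j).symm
        have e3 : Real.exp ((1 - s.re) * u) = Real.exp (-s.re * u) * Real.exp u := by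
          rw [← Real.exp_add]; ring_nf
        rw [e1, e3, ← e2]; ring
    _ ≤ C * (Real.exp (η * u) * Real.exp (-(c * u ^ 3 / L ^ 2))) := by
        gcongr
        linarith
    _ = C * Real.exp (η * u - c * u ^ 3 / L ^ 2) := by rw [← Real.exp_add]; ring_nf
    _ ≤ C * Real.exp (η * √η * L / √c) := by
        gcongr
        exact linear_sub_cubic_le hη0 hu0 hc (by linarith)
    _ = C * L ^ (1 / √c) := by
        rw [hη3, Real.rpow_def_of_pos (by linarith)]; ring_nf

theorem sum_Ico_two_pow {M : Type*} [AddCommMonoid M] (f : ℕ → M) (J : ℕ) :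
    ∑ n ∈ Finset.Ico 1 ((2 : ℕ) ^ J), f n
      = ∑ j ∈ Finset.range J, ∑ n ∈ Finset.Ico ((2 : ℕ) ^ j) (2 ^ (j + 1)), f n := by
  induction J with
  | zero => simp
  | succ J ih =>
    rw [Finset.sum_range_succ, ← ih, Finset.sum_Ico_consecutive _ Nat.one_le_two_pow
      (Nat.pow_le_pow_right (by norm_num) (by omega))]

/-- Richert-type bound for `ζ` close to the line `Re s = 1`. -/
theorem norm_riemannZeta_le : ∃ C A : ℝ, 0 < C ∧ 0 < A ∧ ∀ (T : ℝ) (s : ℂ), 16 ≤ T →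
    2 ≤ |s.im| → |s.im| ≤ T → 3 / 4 ≤ s.re → s.re ≤ 3 →
    1 - (Real.log (Real.log T) / Real.log T) ^ (2 / 3 : ℝ) ≤ s.re →
    ‖riemannZeta s‖ ≤ C * Real.log T ^ A := by
  obtain ⟨C₁, hC₁, h₁⟩ := norm_riemannZeta_sub_sum_le
  obtain ⟨C₂, A, hC₂, hA, h₂⟩ := norm_block_cpow_le
  have main : ∀ (T : ℝ) (s : ℂ), 16 ≤ T → 2 ≤ s.im → s.im ≤ T → 3 / 4 ≤ s.re → s.re ≤ 3 →
    1 - (Real.log (Real.log T) / Real.log T) ^ (2 / 3 : ℝ) ≤ s.re →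
    ‖riemannZeta s‖ ≤ (C₁ + 3 * C₂) * Real.log T ^ (A + 1) := by
    intro T s hT ht htT hs1 hs2 hs
    set L := Real.log T with hL
    have hL1 : 1 ≤ L := by
      rw [hL, Real.le_log_iff_exp_le (by linarith)]
      linarith [Real.exp_one_lt_d9]
    have ht0 : (0 : ℝ) < s.im ^ 2 := by nlinarith
    have hfl : ⌊s.im ^ 2⌋₊ ≠ 0 := (Nat.floor_pos.2 (by nlinarith)).ne'
    set J := Nat.log 2 ⌊s.im ^ 2⌋₊ with hJ
    have hJ1 : ((2 ^ J : ℕ) : ℝ) ≤ s.im ^ 2 :=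
      (Nat.le_floor_iff ht0.le).1 (Nat.pow_log_le_self 2 hfl)
    have hJ2 : s.im ^ 2 / 2 ≤ ((2 ^ J : ℕ) : ℝ) := by
      have h := Nat.lt_pow_succ_log_self (b := 2) (by norm_num) ⌊s.im ^ 2⌋₊
      rw [← hJ, Nat.floor_lt ht0.le] at h
      push_cast [Nat.succ_eq_add_one, pow_succ (2 : ℕ) J] at h ⊢
      linarith
    have hJL : (J : ℝ) ≤ 3 * L := by
      have h := Real.log_le_log (by positivity) hJ1
      push_cast at h
      rw [Real.log_pow, Real.log_pow] at h
      have h2 := Real.log_two_gt_d9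
      have h3 : Real.log s.im ≤ L := Real.log_le_log (by linarith) htT
      push_cast at h
      nlinarith [Nat.cast_nonneg (α := ℝ) J]
    have hsum : ‖∑ n ∈ Finset.Ico 1 ((2 : ℕ) ^ J), (n : ℂ) ^ (-s)‖ ≤ J * (C₂ * L ^ A) := by
      rw [sum_Ico_two_pow]
      refine (norm_sum_le_of_le _ (f := fun _ : ℕ => _) (fun j hj => h₂ T s j hT ht htT (by linarith) hs ?_)).trans_eq ?_
      · rw [Finset.mem_range] at hj
        refine le_trans ?_ hJ1
        exact_mod_cast Nat.pow_le_pow_right (by norm_num) hj.le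
      · simp [← hL]
    have h3 := norm_le_norm_add_norm_sub' (riemannZeta s) (∑ n ∈ Finset.Ico 1 ((2 : ℕ) ^ J), (n : ℂ) ^ (-s))
    have h4 := h₁ s (2 ^ J) hs1 hs2 ht hJ2 hJ1
    have hLA : 1 ≤ L ^ (A + 1) := Real.one_le_rpow hL1 (by linarith)
    calc _ ≤ J * (C₂ * L ^ A) + C₁ := by linarith
      _ ≤ (3 * L) * (C₂ * L ^ A) + C₁ * L ^ (A + 1) := by
        gcongr
        exact le_mul_of_one_le_right hC₁.le hLA
      _ = _ := by rw [Real.rpow_add_one (by linarith)]; ring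
  refine ⟨C₁ + 3 * C₂, A + 1, by positivity, by positivity, ?_⟩
  intro T s hT ht htT hs1 hs2 hs
  rcases le_total 0 s.im with him | him
  · rw [abs_of_nonneg him] at ht htT
    exact main T s hT ht htT hs1 hs2 hs
  · rw [abs_of_nonpos him] at ht htT
    have := main T ((starRingEnd ℂ) s) hT (by simpa using ht) (by simpa using htT) (by simpa using hs1)
      (by simpa using hs2) (by simpa using hs)
    rwa [riemannZeta_conj, RCLike.norm_conj] at this

end ZetaBound

section LogDerivative
open Metric

/-- Borel–Carathéodory for the logarithm of a nonvanishing function. -/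
theorem exists_log_of_ne_zero {f : ℂ → ℂ} {c : ℂ} {r M : ℝ} (hr : 0 < r) (hM : 0 < M)
    (hf : DifferentiableOn ℂ f (ball c r)) (h0 : ∀ z ∈ ball c r, f z ≠ 0)
    (hb : ∀ z ∈ ball c r, ‖f z‖ ≤ Real.exp M * ‖f c‖) :
    ∃ g : ℂ → ℂ, (∀ z ∈ ball c r, HasDerivAt g (deriv f z / f z) z) ∧
      (∀ z ∈ ball c r, f z = f c * Complex.exp (g z)) ∧
      ∀ z ∈ ball c r, ‖g z‖ ≤ 2 * M * ‖z - c‖ / (r - ‖z - c‖) := by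
  have hcb : c ∈ ball c r := mem_ball_self hr
  have hdiff : DifferentiableOn ℂ (fun z => deriv f z / f z) (ball c r) :=
    (hf.deriv isOpen_ball).div hf h0
  obtain ⟨g, hgc, hg⟩ := hdiff.isExactOn_ball.with_val_at c 0
  have hgd : DifferentiableOn ℂ g (ball c r) := fun z hz => (hg z hz).differentiableAt.differentiableWithinAt
  have hexp : ∀ z ∈ ball c r, f z = f c * Complex.exp (g z) := by
    have hconst : ∀ z ∈ ball c r, f z * Complex.exp (-g z) = f c * Complex.exp (-g c) := by
      intro z hz
      refine (convex_ball c r).is_const_of_fderivWithin_eq_zero (𝕜 := ℂ)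
        (f := fun z => f z * Complex.exp (-g z)) ?_ ?_ hz hcb
      · exact hf.mul (hgd.neg.cexp)
      · intro w hw
        have hfw : HasDerivAt f (deriv f w) w :=
          (hf.differentiableAt (isOpen_ball.mem_nhds hw)).hasDerivAt
        have := hfw.mul ((hg w hw).neg.cexp)
        have hz0 : deriv f w * Complex.exp (-g w) + f w * (Complex.exp (-g w) * -(deriv f w / f w)) = 0 := by
          have := h0 w hw
          field_simp
          ring
        have h2 := this.hasFDerivAt.hasFDerivWithinAt (s := ball c r)
        have h3 := h2.fderivWithin (isOpen_ball.uniqueDiffWithinAt hw)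
        refine Eq.trans h3 ?_
        ext
        simpa using hz0
    intro z hz
    have := hconst z hz
    rw [hgc, neg_zero, Complex.exp_zero, mul_one, Complex.exp_neg] at this
    rw [← this, mul_assoc, inv_mul_cancel₀ (Complex.exp_ne_zero _), mul_one]
  refine ⟨g, hg, hexp, ?_⟩
  have hre : ∀ z ∈ ball c r, (g z).re ≤ M := by
    intro z hz
    have h1 := hb z hz
    rw [hexp z hz, norm_mul, mul_comm, Complex.norm_exp] at h1
    have := le_of_mul_le_mul_right h1 (norm_pos_iff.2 (h0 c hcb))
    exact Real.exp_le_exp.1 this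
  intro z hz
  have hshift : ∀ w ∈ ball (0 : ℂ) r, c + w ∈ ball c r := by
    intro w hw; simpa [dist_eq_norm] using hw
  have hzc : z - c ∈ ball (0 : ℂ) r := by simpa [dist_eq_norm] using hz
  have := Complex.borelCaratheodory_zero (f := fun w => g (c + w)) hM (R := r) (z := z - c)
    (fun w hw => ((hgd.differentiableAt (isOpen_ball.mem_nhds (hshift w hw))).comp w
      (by fun_prop : DifferentiableAt ℂ (fun w => c + w) w)).differentiableWithinAt)
    (fun w hw => hre _ (hshift w hw)) hr hzc (by simpa using hgc)
  simpa using this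

theorem norm_logDeriv_le_of_ne_zero {f : ℂ → ℂ} {c : ℂ} {r M : ℝ} (hr : 0 < r) (hM : 0 < M)
    (hf : DifferentiableOn ℂ f (ball c r)) (h0 : ∀ z ∈ ball c r, f z ≠ 0)
    (hb : ∀ z ∈ ball c r, ‖f z‖ ≤ Real.exp M * ‖f c‖) :
    ‖deriv f c / f c‖ ≤ 4 * M / r := by
  obtain ⟨g, hg, -, hgn⟩ := exists_log_of_ne_zero hr hM hf h0 hb
  have hsub : closedBall c (r / 2) ⊆ ball c r := closedBall_subset_ball (by linarith)
  have hgd : DifferentiableOn ℂ g (closure (ball c (r / 2))) := fun z hz =>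
    (hg z (hsub (closure_ball_subset_closedBall hz))).differentiableAt.differentiableWithinAt
  have := Complex.norm_deriv_le_of_forall_mem_sphere_norm_le (f := g) (c := c) (R := r / 2) (C := 2 * M)
    (by linarith) hgd.diffContOnCl fun z hz => by
      have h1 := hgn z (hsub (sphere_subset_closedBall hz))
      rw [mem_sphere, dist_eq_norm] at hz
      rw [hz] at h1
      refine h1.trans_eq ?_
      field_simp
      ring
  rw [(hg c (mem_ball_self hr)).deriv] at this
  refine this.trans_eq ?_
  field_simp
  ring

/-- Dividing out a zero close to the centre of a disc. -/
theorem exists_div_zero {f : ℂ → ℂ} {U : Set ℂ} {c ρ : ℂ} {r M : ℝ} (hr : 0 < r) (hU : IsOpen U)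
    (hrU : closedBall c r ⊆ U) (hf : DifferentiableOn ℂ f U) (hc : f c ≠ 0)
    (hb : ∀ z ∈ closedBall c r, ‖f z‖ ≤ Real.exp M * ‖f c‖) (hρ : ρ ∈ ball c (r / 3)) (hρ0 : f ρ = 0) :
    ∃ g : ℂ → ℂ, DifferentiableOn ℂ g U ∧ g c ≠ 0 ∧
      (∀ z ∈ closedBall c r, ‖g z‖ ≤ Real.exp (M - Real.log 2) * ‖g c‖) ∧
      (∀ z, g z = 0 → z ∈ U → f z = 0) ∧ deriv f c / f c = deriv g c / g c + 1 / (c - ρ) := by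
  have hρU : ρ ∈ U := hrU (ball_subset_closedBall (ball_subset_ball (by linarith) hρ))
  have hcU : c ∈ U := hrU (mem_closedBall_self hr.le)
  set g := dslope f ρ with hg
  have hfg : ∀ z, f z = (z - ρ) * g z := by
    intro z
    have := sub_smul_dslope f ρ z
    rw [hρ0, sub_zero, smul_eq_mul] at this
    exact this.symm
  have hgd : DifferentiableOn ℂ g U := (Complex.differentiableOn_dslope (hU.mem_nhds hρU)).2 hf
  have hcρ : c - ρ ≠ 0 := by
    intro h; apply hc; rw [hfg, h, zero_mul]
  have hgc : g c ≠ 0 := by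
    intro h; apply hc; rw [hfg, h, mul_zero]
  have hρ' : ‖c - ρ‖ < r / 3 := by rwa [mem_ball, dist_comm, dist_eq_norm] at hρ
  refine ⟨g, hgd, hgc, ?_, fun z hz _ => by rw [hfg, hz, mul_zero], ?_⟩
  · have hcl : closure (ball c r) = closedBall c r := closure_ball c hr.ne'
    have hgd' : DiffContOnCl ℂ g (ball c r) :=
      (hgd.mono (by rw [hcl]; exact hrU)).diffContOnCl
    intro z hz
    refine Complex.norm_le_of_forall_mem_frontier_norm_le isBounded_ball hgd' ?_ (by rwa [hcl])
    intro w hw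
    rw [frontier_ball c hr.ne'] at hw
    have hw' : ‖w - c‖ = r := by rwa [mem_sphere, dist_eq_norm] at hw
    have h1 := hb w (sphere_subset_closedBall hw)
    rw [hfg w, hfg c, norm_mul, norm_mul] at h1
    have h2 : 2 * r / 3 ≤ ‖w - ρ‖ := by
      have h3 : ‖w - c‖ ≤ ‖w - ρ‖ + ‖c - ρ‖ := by
        have := norm_sub_le (w - ρ) (c - ρ)
        rwa [sub_sub_sub_cancel_right] at this
      linarith
    rw [Real.exp_sub, Real.exp_log (by norm_num)]
    have h4 : (2 * r / 3) * ‖g w‖ ≤ Real.exp M * ((r / 3) * ‖g c‖) := by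
      calc _ ≤ ‖w - ρ‖ * ‖g w‖ := by gcongr
        _ ≤ _ := h1
        _ ≤ _ := by gcongr
    have h5 : (2 * r / 3) * ‖g w‖ ≤ (2 * r / 3) * (Real.exp M / 2 * ‖g c‖) := by linarith
    exact le_of_mul_le_mul_left h5 (by positivity)
  · have hgc' : HasDerivAt g (deriv g c) c := (hgd.differentiableAt (hU.mem_nhds hcU)).hasDerivAt
    have h1 : HasDerivAt (fun z => (z - ρ) * g z) (1 * g c + (c - ρ) * deriv g c) c :=
      ((hasDerivAt_id c).sub_const ρ).mul hgc'
    have h2 : deriv f c = 1 * g c + (c - ρ) * deriv g c := by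
      rw [← h1.deriv]; congr 1; funext z; exact hfg z
    rw [h2, hfg c]
    field_simp
    ring

theorem re_inv_nonneg {z : ℂ} (hz : 0 ≤ z.re) : 0 ≤ (1 / z).re := by
  rw [one_div, Complex.inv_re]
  exact div_nonneg hz (Complex.normSq_nonneg _)

/-- Landau's lemma. -/
theorem neg_le_re_logDeriv {f : ℂ → ℂ} {U : Set ℂ} {c : ℂ} {r M : ℝ} (hr : 0 < r) (hU : IsOpen U)
    (hrU : closedBall c r ⊆ U) (hf : DifferentiableOn ℂ f U) (hc : f c ≠ 0)
    (hb : ∀ z ∈ closedBall c r, ‖f z‖ ≤ Real.exp M * ‖f c‖)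
    (hz : ∀ z ∈ ball c (r / 3), f z = 0 → z.re ≤ c.re) :
    -(12 * (M + 1) / r) ≤ (deriv f c / f c).re := by
  obtain ⟨n, hn⟩ := exists_nat_gt (M / Real.log 2)
  rw [div_lt_iff₀ (Real.log_pos (by norm_num))] at hn
  have hpos : ∀ (M : ℝ) (f : ℂ → ℂ), f c ≠ 0 →
      (∀ z ∈ closedBall c r, ‖f z‖ ≤ Real.exp M * ‖f c‖) → 0 ≤ M := by
    intro M f hc hb
    have h1 := hb c (mem_closedBall_self hr.le)
    have h2 : 1 * ‖f c‖ ≤ Real.exp M * ‖f c‖ := by rwa [one_mul]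
    have h3 := le_of_mul_le_mul_right h2 (norm_pos_iff.2 hc)
    rwa [Real.one_le_exp_iff] at h3
  induction n generalizing f M with
  | zero =>
    have := hpos M f hc hb
    simp at hn; linarith
  | succ n ih =>
    have hl2 := Real.log_pos (by norm_num : (1 : ℝ) < 2)
    have hM := hpos M f hc hb
    by_cases h : ∃ ρ ∈ ball c (r / 3), f ρ = 0
    · obtain ⟨ρ, hρ, hρ0⟩ := h
      obtain ⟨g, hgd, hgc, hgb, hg0, hder⟩ := exists_div_zero hr hU hrU hf hc hb hρ hρ0
      have := ih hgd hgc hgb (fun z hz' hgz => hz z hz' (hg0 z hgz (hrU (ball_subset_closedBall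
        (ball_subset_ball (by linarith) hz'))))) (by push_cast at hn; linarith)
      rw [hder, Complex.add_re]
      have h1 : 0 ≤ (1 / (c - ρ)).re := re_inv_nonneg (by
        rw [Complex.sub_re]; linarith [hz ρ hρ hρ0])
      have h2 : 12 * (M - Real.log 2 + 1) / r ≤ 12 * (M + 1) / r := by
        gcongr; linarith
      linarith
    · push Not at h
      have hsub : ball c (r / 3) ⊆ closedBall c r :=
        ball_subset_closedBall.trans (closedBall_subset_closedBall (by linarith))
      have := norm_logDeriv_le_of_ne_zero (M := M + 1) (by linarith : 0 < r / 3) (by linarith)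
        (hf.mono (hsub.trans hrU)) h fun z hz' => (hb z (hsub hz')).trans (by gcongr; linarith)
      have h1 := (abs_le.1 ((Complex.abs_re_le_norm _).trans this)).1
      refine le_trans (le_of_eq ?_) h1
      field_simp
      ring

theorem neg_le_re_logDeriv_of_zero {f : ℂ → ℂ} {U : Set ℂ} {c ρ : ℂ} {r M : ℝ} (hr : 0 < r)
    (hU : IsOpen U) (hrU : closedBall c r ⊆ U) (hf : DifferentiableOn ℂ f U) (hc : f c ≠ 0)
    (hb : ∀ z ∈ closedBall c r, ‖f z‖ ≤ Real.exp M * ‖f c‖)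
    (hz : ∀ z ∈ ball c (r / 3), f z = 0 → z.re ≤ c.re) (hρ : ρ ∈ ball c (r / 3)) (hρ0 : f ρ = 0) :
    (1 / (c - ρ)).re - (12 * (M + 1) / r) ≤ (deriv f c / f c).re := by
  obtain ⟨g, hgd, hgc, hgb, hg0, hder⟩ := exists_div_zero hr hU hrU hf hc hb hρ hρ0
  have hl2 := Real.log_pos (by norm_num : (1 : ℝ) < 2)
  have := neg_le_re_logDeriv hr hU hrU hgd hgc hgb
    (fun z hz' hgz => hz z hz' (hg0 z hgz (hrU (ball_subset_closedBall
        (ball_subset_ball (by linarith) hz')))))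
  rw [hder, Complex.add_re]
  have h2 : 12 * (M - Real.log 2 + 1) / r ≤ 12 * (M + 1) / r := by
    gcongr; linarith
  linarith

end LogDerivative

section ZetaNearOneLine
open Metric ArithmeticFunction

theorem riemannZeta₁_ne_zero_of_one_le_re {s : ℂ} (hs : 1 ≤ s.re) : riemannZeta₁ s ≠ 0 := by
  rcases eq_or_ne s 1 with rfl | h
  · simp
  · have := riemannZeta_ne_zero_of_one_le_re hs
    rw [riemannZeta_eq_inv_sub_mul h] at this
    exact right_ne_zero_of_mul this

theorem norm_inv_riemannZeta_le {s : ℂ} (hs : 1 < s.re) :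
    ‖(riemannZeta s)⁻¹‖ ≤ ‖riemannZeta (s.re : ℂ)‖ := by
  have hre : 1 < ((s.re : ℝ) : ℂ).re := by simpa using hs
  have h1 := LSeries_zeta_mul_Lseries_moebius hs
  rw [LSeries_zeta_eq_riemannZeta hs] at h1
  rw [← eq_inv_of_mul_eq_one_right h1]
  have hsum : LSeriesSummable (fun n => ((moebius n : ℤ) : ℂ)) s := LSeriesSummable_moebius_iff.2 hs
  have h2 := LSeriesHasSum_one hre
  have h3 : ∀ n, ‖LSeries.term (fun n => ((moebius n : ℤ) : ℂ)) s n‖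
      ≤ ‖LSeries.term 1 (s.re : ℂ) n‖ := by
    intro n
    rw [LSeries.norm_term_eq, LSeries.norm_term_eq]
    split_ifs with h
    · exact le_rfl
    · simp only [Pi.one_apply, norm_one, Complex.ofReal_re]
      gcongr
      rw [Complex.norm_intCast]
      exact_mod_cast abs_moebius_le_one
  have h4 : ∀ n, LSeries.term 1 (s.re : ℂ) n = (‖LSeries.term 1 (s.re : ℂ) n‖ : ℝ) := by
    intro n
    rcases eq_or_ne n 0 with rfl | h
    · simp
    · rw [LSeries.norm_term_eq, if_neg h, LSeries.term_of_ne_zero h]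
      simp only [Pi.one_apply, norm_one, Complex.ofReal_re]
      push_cast
      rw [Complex.ofReal_cpow (by positivity)]
      simp
  have h5 : Summable fun n => ‖LSeries.term 1 (s.re : ℂ) n‖ := h2.summable.norm
  have h6 : riemannZeta (s.re : ℂ) = ((∑' n, ‖LSeries.term 1 (s.re : ℂ) n‖ : ℝ) : ℂ) := by
    rw [← h2.LSeries_eq, LSeries, Complex.ofReal_tsum]
    exact tsum_congr h4
  rw [h6, Complex.norm_real, Real.norm_of_nonneg (tsum_nonneg fun _ => norm_nonneg _)]
  exact tsum_of_norm_bounded h5.hasSum h3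

theorem exists_norm_inv_riemannZeta_le :
    ∃ C : ℝ, 0 < C ∧ ∀ s : ℂ, 1 < s.re → s.re ≤ 3 → ‖(riemannZeta s)⁻¹‖ ≤ C / (s.re - 1) := by
  obtain ⟨C, hC⟩ := (isCompact_Icc (a := (1 : ℝ)) (b := 3)).exists_bound_of_continuousOn
    (f := fun x : ℝ => riemannZeta₁ (x : ℂ))
    (differentiable_riemannZeta₁.continuous.comp Complex.continuous_ofReal).continuousOn
  refine ⟨|C| + 1, by positivity, fun s h1 h3 => (norm_inv_riemannZeta_le h1).trans ?_⟩
  have hne : (s.re : ℂ) ≠ 1 := by exact_mod_cast h1.ne'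
  rw [riemannZeta_eq_inv_sub_mul hne, norm_mul, norm_inv, ← Complex.ofReal_one,
    ← Complex.ofReal_sub, Complex.norm_real, Real.norm_of_nonneg (by linarith), inv_mul_eq_div]
  have : ‖riemannZeta₁ (s.re : ℂ)‖ ≤ C := hC s.re ⟨h1.le, h3⟩
  have h0 : 0 < s.re - 1 := by linarith
  gcongr
  linarith [le_abs_self C]

theorem exists_neg_logDeriv_riemannZeta_le :
    ∃ C : ℝ, 0 < C ∧ ∀ x : ℝ, 1 < x → x ≤ 2 →
      (-deriv riemannZeta x / riemannZeta x).re ≤ 1 / (x - 1) + C := by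
  have hcont : ContinuousOn (fun x : ℝ => deriv riemannZeta₁ (x : ℂ) / riemannZeta₁ (x : ℂ))
      (Set.Icc 1 2) := by
    refine ContinuousOn.div ?_ ?_ fun x hx => riemannZeta₁_ne_zero_of_one_le_re (by simpa using hx.1)
    · exact ((differentiable_riemannZeta₁.contDiff (n := 1)).continuous_deriv le_rfl |>.comp
        Complex.continuous_ofReal).continuousOn
    · exact (differentiable_riemannZeta₁.continuous.comp Complex.continuous_ofReal).continuousOn
  obtain ⟨C, hC⟩ := isCompact_Icc.exists_bound_of_continuousOn hcont
  refine ⟨|C| + 1, by positivity, fun x h1 h2 => ?_⟩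
  have hne : (x : ℂ) ≠ 1 := by exact_mod_cast h1.ne'
  have hz : riemannZeta₁ (x : ℂ) ≠ 0 := riemannZeta₁_ne_zero_of_one_le_re (by simpa using h1.le)
  have hx : (x : ℂ) - 1 ≠ 0 := sub_ne_zero.2 hne
  have hd : HasDerivAt riemannZeta
      (-((x : ℂ) - 1)⁻¹ ^ 2 * riemannZeta₁ x + ((x : ℂ) - 1)⁻¹ * deriv riemannZeta₁ x) x := by
    have h : HasDerivAt (fun s : ℂ => (s - 1)⁻¹ * riemannZeta₁ s)
        (-((x : ℂ) - 1)⁻¹ ^ 2 * riemannZeta₁ x + ((x : ℂ) - 1)⁻¹ * deriv riemannZeta₁ x) x := by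
      have h1 := (((hasDerivAt_id (x : ℂ)).sub_const 1).inv hx).mul
        (differentiable_riemannZeta₁ x).hasDerivAt
      refine HasDerivAt.congr_deriv h1 ?_
      simp only [id, Pi.inv_apply, inv_pow]
      rw [neg_div, one_div]
    refine h.congr_of_eventuallyEq ?_
    filter_upwards [isOpen_ne.mem_nhds hne] with s hs
    exact riemannZeta_eq_inv_sub_mul hs
  have heq : -deriv riemannZeta x / riemannZeta x
      = ((1 / (x - 1) : ℝ) : ℂ) - deriv riemannZeta₁ (x : ℂ) / riemannZeta₁ (x : ℂ) := by
    rw [hd.deriv, riemannZeta_eq_inv_sub_mul hne]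
    push_cast
    field_simp
    ring
  rw [heq, Complex.sub_re, Complex.ofReal_re]
  have h3 := hC x ⟨h1.le, h2⟩
  have h4 := (abs_le.1 ((Complex.abs_re_le_norm _).trans h3)).1
  linarith [le_abs_self C]

theorem three_four_one_logDeriv {x t : ℝ} (hx : 1 < x) :
    0 ≤ 3 * (-deriv riemannZeta x / riemannZeta x).re
      + 4 * (-deriv riemannZeta (x + t * Complex.I) / riemannZeta (x + t * Complex.I)).re
      + (-deriv riemannZeta (x + (2 * t : ℝ) * Complex.I)
          / riemannZeta (x + (2 * t : ℝ) * Complex.I)).re := by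
  have key : ∀ u : ℝ, HasSum
      (fun n : ℕ => vonMangoldt n * (n : ℝ) ^ (-x) * Real.cos (u * Real.log n))
      (-deriv riemannZeta (x + u * Complex.I) / riemannZeta (x + u * Complex.I)).re := by
    intro u
    have hre : 1 < ((x : ℂ) + u * Complex.I).re := by simpa using hx
    rw [← LSeries_vonMangoldt_eq_deriv_riemannZeta_div hre]
    have h := (Complex.hasSum_re (LSeriesSummable_vonMangoldt hre).hasSum)
    rw [← LSeries] at h
    convert h using 1
    funext n
    rcases eq_or_ne n 0 with rfl | hn
    · simp
    · have hn0 : (0 : ℝ) < n := by positivity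
      rw [LSeries.term_of_ne_zero hn, div_eq_mul_inv, ← Complex.cpow_neg, Complex.re_ofReal_mul,
        Complex.cpow_def_of_ne_zero (by exact_mod_cast hn), Complex.exp_re,
        ← Complex.ofReal_natCast, ← Complex.ofReal_log hn0.le, Complex.re_ofReal_mul,
        Complex.im_ofReal_mul, Real.rpow_def_of_pos hn0, mul_assoc]
      simp only [Complex.neg_re, Complex.neg_im, Complex.add_re, Complex.add_im, Complex.mul_re,
        Complex.mul_im, Complex.ofReal_re, Complex.ofReal_im, Complex.I_re, Complex.I_im, mul_zero,
        mul_one, sub_zero, add_zero, zero_add, mul_neg, Real.cos_neg]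
      rw [mul_comm u]
  have h0 := key 0
  simp only [Complex.ofReal_zero, zero_mul, add_zero] at h0
  have h := ((h0.mul_left 3).add ((key t).mul_left 4)).add (key (2 * t))
  refine h.nonneg fun n => ?_
  have : Real.cos (2 * t * Real.log n) = 2 * Real.cos (t * Real.log n) ^ 2 - 1 := by
    rw [mul_assoc, Real.cos_two_mul]
  rw [this, Real.cos_zero]
  have hv : 0 ≤ vonMangoldt n * (n : ℝ) ^ (-x) := mul_nonneg vonMangoldt_nonneg (by positivity)
  nlinarith [mul_nonneg hv (sq_nonneg (Real.cos (t * Real.log n) + 1))]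

/-- The width of the Vinogradov–Korobov region at height `T`. -/
noncomputable def width (T : ℝ) : ℝ :=
  Real.log T ^ (-2 / 3 : ℝ) * Real.log (Real.log T) ^ (-1 / 3 : ℝ)

theorem tendsto_log_log_atTop :
    Filter.Tendsto (fun T => Real.log (Real.log T)) Filter.atTop Filter.atTop :=
  Real.tendsto_log_atTop.comp Real.tendsto_log_atTop

theorem exists_forall_width (N : ℝ) : ∃ T₀ : ℝ, 16 ≤ T₀ ∧ ∀ T, T₀ ≤ T →
    N ≤ Real.log (Real.log T) ∧ 1 ≤ Real.log (Real.log T) ∧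
    (Real.log (Real.log T) / Real.log T) ^ (2 / 3 : ℝ) = Real.log (Real.log T) * width T ∧
    1 ≤ width T * Real.log T ∧ Real.log (Real.log T) * width T ≤ 1 / 4 ∧ 0 < width T ∧
    width T ≤ 2 * width (T ^ 2) ∧
    Real.log (Real.log T) < Real.log T := by
  have h1 := tendsto_log_log_atTop.eventually_ge_atTop (max N 1)
  have h2 : ∀ᶠ T : ℝ in Filter.atTop,
      (Real.log (Real.log T) / Real.log T) ^ (2 / 3 : ℝ) ≤ 1 / 4 := by
    have h3 : Filter.Tendsto (fun T : ℝ => Real.log (Real.log T) / Real.log T) Filter.atTop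
        (nhds 0) := by
      have := Real.isLittleO_log_id_atTop.tendsto_div_nhds_zero
      exact this.comp Real.tendsto_log_atTop
    have h4 : Filter.Tendsto (fun T : ℝ => (Real.log (Real.log T) / Real.log T) ^ (2 / 3 : ℝ))
        Filter.atTop (nhds 0) := by
      have := h3.rpow_const (p := (2 / 3 : ℝ)) (Or.inr (by norm_num))
      rwa [Real.zero_rpow (by norm_num)] at this
    exact h4.eventually_le_const (by norm_num)
  obtain ⟨T₁, hT₁⟩ := Filter.eventually_atTop.1 (h1.and h2)
  refine ⟨max T₁ 16, le_max_right _ _, fun T hT => ?_⟩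
  obtain ⟨ha, hb⟩ := hT₁ T ((le_max_left _ _).trans hT)
  have hT16 : 16 ≤ T := (le_max_right _ _).trans hT
  have hl1 : 1 ≤ Real.log (Real.log T) := (le_max_right _ _).trans ha
  have hL0 : 0 < Real.log T := Real.log_pos (by linarith)
  have hlt : Real.log (Real.log T) < Real.log T := by
    have := Real.log_le_sub_one_of_pos hL0
    linarith
  set L := Real.log T with hL
  set l := Real.log L with hl
  have hl0 : 0 < l := by linarith
  have hw : 0 < width T := by unfold width; rw [← hL, ← hl]; positivity
  have e1 : (l / L) ^ (2 / 3 : ℝ) = l * width T := by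
    unfold width
    rw [← hL, ← hl, Real.div_rpow hl0.le hL0.le, div_eq_mul_inv, ← Real.rpow_neg hL0.le,
      mul_comm (L ^ (-2 / 3 : ℝ)), ← mul_assoc]
    nth_rw 2 [← Real.rpow_one l]
    rw [← Real.rpow_add hl0]
    norm_num
  have e2 : width T = l ^ (-1 / 3 : ℝ) * L ^ (-2 / 3 : ℝ) := by
    unfold width; rw [← hL, ← hl, mul_comm]
  refine ⟨(le_max_left _ _).trans ha, hl1, e1, ?_, e1 ▸ hb, hw, ?_, hlt⟩
  · rw [e2, mul_assoc]
    have h3 : L ^ (-2 / 3 : ℝ) * L = L ^ (1 / 3 : ℝ) := by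
      nth_rw 2 [← Real.rpow_one L]
      rw [← Real.rpow_add hL0]; norm_num
    rw [h3]
    have h4 : l ^ (-1 / 3 : ℝ) = (l ^ (1 / 3 : ℝ))⁻¹ := by
      rw [← Real.rpow_neg hl0.le]; norm_num
    rw [h4, inv_mul_eq_div, one_le_div (by positivity)]
    gcongr
  · have h5 : Real.log (T ^ 2) = 2 * L := by rw [Real.log_pow, ← hL]; norm_num
    have h6 : Real.log (2 * L) = Real.log 2 + l := Real.log_mul (by norm_num) hL0.ne'
    have h7 : Real.log 2 + l ≤ 2 * l := by linarith [Real.log_two_lt_d9]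
    have h8 : 0 < Real.log 2 + l := by linarith [Real.log_two_gt_d9]
    unfold width
    rw [h5, h6, ← hL, ← hl]
    have h9 : (2 * l) ^ (-1 / 3 : ℝ) ≤ (Real.log 2 + l) ^ (-1 / 3 : ℝ) :=
      Real.rpow_le_rpow_of_nonpos h8 h7 (by norm_num)
    calc _ = 2 * ((2 * L) ^ (-2 / 3 : ℝ) * (2 * l) ^ (-1 / 3 : ℝ)) := by
          rw [Real.mul_rpow (by norm_num) hL0.le, Real.mul_rpow (by norm_num) hl0.le]
          have : (2 : ℝ) * (2 ^ (-2 / 3 : ℝ) * 2 ^ (-1 / 3 : ℝ)) = 1 := by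
            rw [← Real.rpow_add (by norm_num)]
            norm_num [Real.rpow_neg_one]
          linear_combination -(L ^ (-2 / 3 : ℝ) * l ^ (-1 / 3 : ℝ)) * this
      _ ≤ _ := by gcongr

end ZetaNearOneLine

section ZeroFreeRegion
open Metric

theorem norm_riemannZeta_le_exp_mul : ∃ B : ℝ, 1 ≤ B ∧ ∀ K : ℝ, 0 < K → ∃ T₀ : ℝ, ∀ T, T₀ ≤ T →
    ∀ s : ℂ, K * width T ≤ s.re - 1 → s.re ≤ 2 → 5 / 2 ≤ |s.im| → |s.im| + 1 ≤ T →
      ∀ z ∈ closedBall s (Real.log (Real.log T) * width T / 2),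
        ‖riemannZeta z‖ ≤ Real.exp (B * Real.log (Real.log T)) * ‖riemannZeta s‖ := by
  obtain ⟨C, A, hC, hA, hζ⟩ := norm_riemannZeta_le
  obtain ⟨D, hD, hinv⟩ := exists_norm_inv_riemannZeta_le
  refine ⟨A + 2, by linarith, fun K hK => ?_⟩
  obtain ⟨T₀, hT₀, hw⟩ := exists_forall_width (C * D / K)
  refine ⟨T₀, fun T hT s hs1 hs2 ht htT z hz => ?_⟩
  obtain ⟨hN, hl1, hθ, hwL, hlw, hwpos, -, -⟩ := hw T hT
  have hL0 : 0 < Real.log T := Real.log_pos (by linarith)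
  set l := Real.log (Real.log T) with hl
  have hLe : Real.log T = Real.exp l := (Real.exp_log hL0).symm
  have hre := (Complex.abs_re_le_norm (z - s)).trans (mem_closedBall_iff_norm.1 hz)
  have him := (Complex.abs_im_le_norm (z - s)).trans (mem_closedBall_iff_norm.1 hz)
  rw [Complex.sub_re] at hre
  rw [Complex.sub_im] at him
  have him' := (abs_abs_sub_abs_le_abs_sub z.im s.im).trans him
  rw [abs_le] at him' hre
  have hKw : 0 < K * width T := by positivity
  have h1 := hζ T z (by linarith) (by linarith) (by linarith) (by linarith) (by linarith)
    (by rw [hθ]; linarith)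
  have h2 := hinv s (by linarith) (by linarith)
  have h3 : D / (s.re - 1) ≤ D / K * Real.exp l := by
    calc D / (s.re - 1) ≤ D / (K * width T) := by gcongr
      _ = D / K * (1 / width T) := by field_simp
      _ ≤ D / K * Real.exp l := by
        gcongr
        rw [div_le_iff₀ hwpos, ← hLe]
        linarith
  have hne : riemannZeta s ≠ 0 := riemannZeta_ne_zero_of_one_lt_re (by linarith)
  have h4 : C * D / K ≤ Real.exp l := hN.trans (by linarith [Real.add_one_le_exp l])
  calc ‖riemannZeta z‖ = ‖riemannZeta z‖ * ‖(riemannZeta s)⁻¹‖ * ‖riemannZeta s‖ := by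
        rw [norm_inv, mul_assoc, inv_mul_cancel₀ (norm_ne_zero_iff.2 hne), mul_one]
    _ ≤ (C * Real.exp (A * l)) * (D / K * Real.exp l) * ‖riemannZeta s‖ := by
        gcongr
        · refine h1.trans_eq ?_
          rw [Real.rpow_def_of_pos hL0, ← hl, mul_comm l]
        · exact h2.trans h3
    _ = (C * D / K) * Real.exp ((A + 1) * l) * ‖riemannZeta s‖ := by
        rw [add_mul, Real.exp_add, one_mul]; ring
    _ ≤ Real.exp l * Real.exp ((A + 1) * l) * ‖riemannZeta s‖ := by gcongr
    _ = _ := by rw [← Real.exp_add]; ring_nf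

theorem differentiableOn_riemannZeta_compl : DifferentiableOn ℂ riemannZeta {1}ᶜ :=
  fun _ hs => (differentiableAt_riemannZeta hs).differentiableWithinAt

theorem closedBall_subset_compl_one {s : ℂ} {r : ℝ} (hs : r < |s.im|) :
    closedBall s r ⊆ {1}ᶜ := by
  rintro z hz rfl
  have := (Complex.abs_im_le_norm (1 - s)).trans (mem_closedBall_iff_norm.1 hz)
  rw [Complex.sub_im, Complex.one_im, zero_sub, abs_neg] at this
  linarith

/-- The Vinogradov–Korobov zero-free region. -/
theorem exists_zeroFree : ∃ h T₀ : ℝ, 0 < h ∧ ∀ T, T₀ ≤ T → ∀ s : ℂ, 5 / 2 ≤ |s.im| →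
    2 * |s.im| + 1 ≤ T → 1 - h * width T ≤ s.re → riemannZeta s ≠ 0 := by
  obtain ⟨B, hB, hgrow⟩ := norm_riemannZeta_le_exp_mul
  obtain ⟨C, hC, hlog⟩ := exists_neg_logDeriv_riemannZeta_le
  set D := 5 * (24 * (B + 1)) + 3 * C with hD
  have hD0 : 0 < D := by positivity
  set K := 1 / (2 * D) with hK
  have hK0 : 0 < K := by positivity
  obtain ⟨T₁, hT₁⟩ := hgrow K hK0
  obtain ⟨T₂, hT₂, hw⟩ := exists_forall_width (12 * K)
  refine ⟨K / 15, max T₁ T₂, by positivity, fun T hT s hs1 hs2 hs3 hzero => ?_⟩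
  obtain ⟨hN, hl1, hθ, hwL, hlw, hwpos, -, -⟩ := hw T ((le_max_right _ _).trans hT)
  have hgrow := hT₁ T ((le_max_left _ _).trans hT)
  set l := Real.log (Real.log T) with hl
  set w := width T with hw'
  have hKw : 0 < K * w := by positivity
  have h12 : 12 * (K * w) ≤ l * w := by nlinarith
  have hw1 : w ≤ 1 / 4 := by nlinarith
  have hre1 : s.re < 1 := by
    by_contra! h
    exact riemannZeta_ne_zero_of_one_le_re h hzero
  set x := 1 + K * w with hx
  have hr : 0 < l * w / 2 := by positivity
  have hne : ∀ t : ℝ, riemannZeta (x + t * Complex.I) ≠ 0 := fun t =>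
    riemannZeta_ne_zero_of_one_lt_re (by simp; linarith)
  have herr : ∀ t : ℝ, 12 * (B * l + 1) / (l * w / 2) ≤ 24 * (B + 1) / w := by
    intro t
    rw [div_le_div_iff₀ hr hwpos]
    nlinarith
  have hzer : ∀ t : ℝ, ∀ z ∈ ball ((x : ℂ) + t * Complex.I) (l * w / 2 / 3), riemannZeta z = 0 →
      z.re ≤ ((x : ℂ) + t * Complex.I).re := by
    intro t z _ hz
    by_contra! h
    simp at h
    exact riemannZeta_ne_zero_of_one_le_re (by linarith) hz
  have hball : ∀ t : ℝ, 5 / 2 ≤ |t| →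
      closedBall ((x : ℂ) + t * Complex.I) (l * w / 2) ⊆ {1}ᶜ := by
    intro t ht
    refine closedBall_subset_compl_one ?_
    simp
    linarith
  have hg : ∀ t : ℝ, 5 / 2 ≤ |t| → |t| + 1 ≤ T →
      ∀ z ∈ closedBall ((x : ℂ) + t * Complex.I) (l * w / 2),
      ‖riemannZeta z‖ ≤ Real.exp (B * l) * ‖riemannZeta (x + t * Complex.I)‖ := fun t h1 h2 =>
    hgrow _ (by simp [hx]) (by simp; linarith) (by simpa using h1) (by simpa using h2)
  have h2t : |2 * s.im| = 2 * |s.im| := by rw [abs_mul, abs_of_pos two_pos]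
  have i1 := neg_le_re_logDeriv_of_zero (ρ := s) hr isOpen_compl_singleton (hball s.im hs1)
    differentiableOn_riemannZeta_compl (hne s.im) (M := B * l)
    (hg s.im hs1 (by linarith)) (hzer s.im) (by
      have : s - ((x : ℂ) + s.im * Complex.I) = ((s.re - x : ℝ) : ℂ) := by
        apply Complex.ext <;> simp
      rw [mem_ball_iff_norm, this, Complex.norm_real, Real.norm_eq_abs, abs_lt]
      constructor <;> linarith) hzero
  have i2 := neg_le_re_logDeriv hr isOpen_compl_singleton (hball (2 * s.im) (by linarith))
    differentiableOn_riemannZeta_compl (hne (2 * s.im)) (M := B * l)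
    (hg _ (by linarith) (by linarith)) (hzer (2 * s.im))
  have i3 := hlog x (by linarith) (by linarith)
  have i4 := three_four_one_logDeriv (x := x) (t := s.im) (by linarith)
  rw [neg_div, neg_div, neg_div, Complex.neg_re, Complex.neg_re, Complex.neg_re] at i4
  rw [neg_div, Complex.neg_re] at i3
  have i5 : (1 / ((x : ℂ) + s.im * Complex.I - s)).re = 1 / (x - s.re) := by
    have : (x : ℂ) + s.im * Complex.I - s = ((x - s.re : ℝ) : ℂ) := by
      apply Complex.ext <;> simp
    rw [this, ← Complex.ofReal_one, ← Complex.ofReal_div, Complex.ofReal_re]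
  rw [i5] at i1
  have i6 : 1 / (16 / 15 * (K * w)) ≤ 1 / (x - s.re) := by
    apply one_div_le_one_div_of_le <;> linarith
  have i7 : x - 1 = K * w := by simp [hx]
  rw [i7] at i3
  have i8 := herr s.im
  have i9 : C ≤ C / w := by rw [le_div_iff₀ hwpos]; nlinarith
  have i10 : 0 ≤ 3 * (1 / (K * w)) + 3 * (C / w) + 5 * (24 * (B + 1) / w)
      - 4 * (1 / (16 / 15 * (K * w))) := by linarith
  have i11 : 3 * (1 / (K * w)) + 3 * (C / w) + 5 * (24 * (B + 1) / w)
      - 4 * (1 / (16 / 15 * (K * w))) = (D - 3 / 4 * (1 / K)) / w := by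
    rw [hD]; field_simp; ring
  have i12 : 1 / K = 2 * D := by rw [hK]; simp
  rw [i11, i12] at i10
  have : (D - 3 / 4 * (2 * D)) / w < 0 := div_neg_of_neg_of_pos (by linarith) hwpos
  linarith

theorem exists_norm_inv_riemannZeta_le_rpow : ∃ h A T₀ : ℝ, 0 < h ∧ 0 < A ∧ 16 ≤ T₀ ∧
    ∀ T, T₀ ≤ T → ∀ s : ℂ, 5 / 2 + 1 / 4 ≤ |s.im| → |s.im| ≤ T → 1 - h * width T ≤ s.re →
      s.re ≤ 2 → riemannZeta s ≠ 0 ∧ ‖(riemannZeta s)⁻¹‖ ≤ Real.log T ^ A := by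
  obtain ⟨B, hB, hgrow⟩ := norm_riemannZeta_le_exp_mul
  obtain ⟨h, T₁, hh, hzf⟩ := exists_zeroFree
  obtain ⟨T₂, hT₂⟩ := hgrow (h / 2) (by positivity)
  obtain ⟨D, hD, hinv⟩ := exists_norm_inv_riemannZeta_le
  obtain ⟨T₃, hT₃, hw⟩ := exists_forall_width (max (4 * h) (4 * D / h))
  refine ⟨h / 8, 2 * (6 * B + 2), max (max T₁ T₂) T₃, by positivity, by positivity,
    hT₃.trans (le_max_right _ _), fun T hT s hs1 hs2 hs3 hs4 => ?_⟩
  have hT1 : T₁ ≤ T := ((le_max_left _ _).trans (le_max_left _ _)).trans hT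
  have hT2 : T₂ ≤ T := ((le_max_right _ _).trans (le_max_left _ _)).trans hT
  have hT3 : T₃ ≤ T := (le_max_right _ _).trans hT
  have hTT : T + T + 2 ≤ T ^ 2 := by nlinarith
  obtain ⟨-, hl1', -, -, -, -, hww, hlL⟩ := hw T hT3
  obtain ⟨hN, hl1, hθ, hwL, hlw, hwpos, -, -⟩ := hw (T ^ 2) (by linarith)
  have hzf := hzf (T ^ 2) (by linarith)
  have hgrow := hT₂ (T ^ 2) (by linarith)
  have hL0 : 0 < Real.log T := Real.log_pos (by linarith)
  have hL2 : Real.log (T ^ 2) = 2 * Real.log T := by rw [Real.log_pow]; norm_num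
  have hL0' : 0 < Real.log (T ^ 2) := by rw [hL2]; linarith
  have hll : Real.log (Real.log (T ^ 2)) ≤ 2 * Real.log (Real.log T) := by
    rw [hL2, Real.log_mul (by norm_num) hL0.ne']
    linarith [Real.log_two_lt_d9]
  set l := Real.log (Real.log (T ^ 2)) with hl
  set w := width (T ^ 2) with hw'
  have hLe : Real.log (T ^ 2) = Real.exp l := (Real.exp_log hL0').symm
  have h1N : 4 * h ≤ l := (le_max_left _ _).trans hN
  have h2N : 4 * D / h ≤ l := (le_max_right _ _).trans hN
  have h4w : 4 * h * w ≤ l * w := by gcongr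
  have hhw : 0 < h * w := by positivity
  have hfin : Real.exp ((6 * B + 2) * l) ≤ Real.log T ^ (2 * (6 * B + 2)) := by
    rw [Real.rpow_def_of_pos hL0]
    apply Real.exp_le_exp.2
    nlinarith
  have hDw : ∀ a : ℝ, h / 4 * w ≤ a → D / a ≤ Real.exp (2 * l) := by
    intro a ha
    calc D / a ≤ D / (h / 4 * w) := by gcongr
      _ = (4 * D / h) * (1 / w) := by field_simp
      _ ≤ Real.exp l * Real.exp l := by
        gcongr
        · linarith [Real.add_one_le_exp l]
        · rw [div_le_iff₀ hwpos, ← hLe]; linarith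
      _ = _ := by rw [← Real.exp_add]; ring_nf
  have hre : 1 - h / 4 * w ≤ s.re := by nlinarith
  refine ⟨hzf s (by linarith) (by linarith) (by linarith), ?_⟩
  rcases le_total (1 + h / 4 * w) s.re with hbig | hsmall
  · refine (hinv s (by linarith) (by linarith)).trans ((hDw _ (by linarith)).trans
      (le_trans ?_ hfin))
    apply Real.exp_le_exp.2
    nlinarith
  · set c : ℂ := (1 + h / 2 * w : ℝ) + s.im * Complex.I with hc
    have hcre : c.re = 1 + h / 2 * w := by simp [hc]
    have hcim : c.im = s.im := by simp [hc]
    have hsub : closedBall c (h * w) ⊆ closedBall c (l * w / 2) :=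
      closedBall_subset_closedBall (by linarith)
    have hgr := hgrow c (by rw [hcre]; linarith) (by rw [hcre]; linarith) (by rw [hcim]; linarith)
      (by rw [hcim]; linarith)
    have hzfree : ∀ z ∈ ball c (h * w), riemannZeta z ≠ 0 := by
      intro z hz
      have h1 := (Complex.abs_re_le_norm (z - c)).trans_lt (mem_ball_iff_norm.1 hz)
      have h2 := (Complex.abs_im_le_norm (z - c)).trans_lt (mem_ball_iff_norm.1 hz)
      rw [Complex.sub_re, hcre, abs_lt] at h1
      rw [Complex.sub_im, hcim] at h2
      have h3 := abs_lt.1 ((abs_abs_sub_abs_le_abs_sub z.im s.im).trans_lt h2)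
      exact hzf z (by linarith) (by linarith) (by linarith)
    have hM : 0 < B * l := by positivity
    obtain ⟨g, -, hg, hgb⟩ := exists_log_of_ne_zero hhw hM
      (differentiableOn_riemannZeta_compl.mono (ball_subset_closedBall.trans
        (closedBall_subset_compl_one (by rw [hcim]; linarith)))) hzfree
      (fun z hz => hgr z (hsub (ball_subset_closedBall hz)))
    have hsc : s - c = ((s.re - (1 + h / 2 * w) : ℝ) : ℂ) := by
      apply Complex.ext <;> simp [hc]
    have hnorm : ‖s - c‖ ≤ 3 / 4 * (h * w) := by
      rw [hsc, Complex.norm_real, Real.norm_eq_abs, abs_le]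
      constructor <;> linarith
    have hsb : s ∈ ball c (h * w) := by rw [mem_ball_iff_norm]; linarith
    have hgs : ‖g s‖ ≤ 6 * (B * l) := by
      refine (hgb s hsb).trans ?_
      rw [div_le_iff₀ (by linarith)]
      nlinarith
    have hfc := (hinv c (by rw [hcre]; linarith) (by rw [hcre]; linarith)).trans
      (hDw _ (by rw [hcre]; linarith))
    rw [hg s hsb, mul_inv, ← Complex.exp_neg, norm_mul, Complex.norm_exp, Complex.neg_re]
    have h5 := (abs_le.1 ((Complex.abs_re_le_norm _).trans hgs)).1
    calc _ ≤ Real.exp (2 * l) * Real.exp (6 * (B * l)) := by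
          gcongr; linarith
      _ = Real.exp ((6 * B + 2) * l) := by rw [← Real.exp_add]; ring_nf
      _ ≤ _ := hfin

theorem exists_bound_inv_riemannZeta₁ : ∃ ε C : ℝ, 0 < ε ∧ 0 < C ∧ ∀ s : ℂ, |s.im| ≤ 3 →
    1 - ε ≤ s.re → s.re ≤ 2 → riemannZeta₁ s ≠ 0 ∧ ‖(riemannZeta₁ s)⁻¹‖ ≤ C := by
  have hcpt : IsCompact (Set.Icc (1 : ℝ) 2 ×ℂ Set.Icc (-3 : ℝ) 3) :=
    isCompact_Icc.reProdIm isCompact_Icc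
  have hopen : IsOpen {s : ℂ | riemannZeta₁ s ≠ 0} :=
    isOpen_ne_fun differentiable_riemannZeta₁.continuous continuous_const
  obtain ⟨ε, hε, hsub⟩ := hcpt.exists_cthickening_subset_open hopen
    fun s hs => riemannZeta₁_ne_zero_of_one_le_re hs.1.1
  obtain ⟨C, hC⟩ := (hcpt.cthickening (r := ε)).exists_bound_of_continuousOn
    (f := fun s => (riemannZeta₁ s)⁻¹)
    (differentiable_riemannZeta₁.continuous.continuousOn.inv₀ fun s hs => hsub hs)
  refine ⟨ε, |C| + 1, hε, by positivity, fun s h1 h2 h3 => ?_⟩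
  have hmem : s ∈ cthickening ε (Set.Icc (1 : ℝ) 2 ×ℂ Set.Icc (-3 : ℝ) 3) := by
    refine mem_cthickening_of_dist_le s ((max s.re 1 : ℝ) + s.im * Complex.I) _ _
      ⟨by simp [h3], by simpa using abs_le.1 h1⟩ ?_
    have : s - ((max s.re 1 : ℝ) + s.im * Complex.I) = ((s.re - max s.re 1 : ℝ) : ℂ) := by
      apply Complex.ext <;> simp
    rw [dist_eq_norm, this, Complex.norm_real, Real.norm_eq_abs, abs_le]
    constructor
    · rcases max_cases s.re 1 with h | h <;> linarith
    · linarith [le_max_left s.re 1]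
  exact ⟨hsub hmem, (hC s hmem).trans (by linarith [le_abs_self C])⟩

/-- `1/ζ` continues analytically and grows slowly in the Vinogradov–Korobov region. -/
theorem exists_norm_sub_one_div_riemannZeta₁_le : ∃ h A C T₀ : ℝ, 0 < h ∧ 0 < A ∧ 0 < C ∧
    16 ≤ T₀ ∧ ∀ T, T₀ ≤ T → ∀ s : ℂ, |s.im| ≤ T → 1 - h * width T ≤ s.re → s.re ≤ 2 →
      riemannZeta₁ s ≠ 0 ∧ ‖(s - 1) / riemannZeta₁ s‖ ≤ C * Real.log T ^ A := by
  obtain ⟨h, A, T₀, hh, hA, hT₀, H⟩ := exists_norm_inv_riemannZeta_le_rpow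
  obtain ⟨ε, C, hε, hC, H1⟩ := exists_bound_inv_riemannZeta₁
  obtain ⟨T₁, hT₁, hw⟩ := exists_forall_width (max (h / ε) h)
  refine ⟨h, A, 4 * C + 1, max T₀ T₁, hh, hA, by positivity, hT₀.trans (le_max_left _ _),
    fun T hT s hs1 hs2 hs3 => ?_⟩
  obtain ⟨hN, hl1, -, -, hlw, hwpos, -, hlL⟩ := hw T ((le_max_right _ _).trans hT)
  have hN1 : h / ε ≤ Real.log (Real.log T) := (le_max_left _ _).trans hN
  have hN2 : h ≤ Real.log (Real.log T) := (le_max_right _ _).trans hN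
  have hLA : 1 ≤ Real.log T ^ A := Real.one_le_rpow (by linarith) hA.le
  rcases le_total 3 |s.im| with h3 | h3
  · obtain ⟨h4, h5⟩ := H T ((le_max_left _ _).trans hT) s (by linarith) hs1 hs2 hs3
    have hne : s ≠ 1 := by
      rintro rfl
      simp at h3
      linarith
    have hs0 : s - 1 ≠ 0 := sub_ne_zero.2 hne
    rw [riemannZeta_eq_inv_sub_mul hne] at h4 h5
    refine ⟨right_ne_zero_of_mul h4, ?_⟩
    rw [mul_inv, inv_inv, ← div_eq_mul_inv] at h5
    refine h5.trans ?_
    nlinarith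
  · have h6 : h * width T ≤ ε := by
      rw [div_le_iff₀ hε] at hN1
      have : h * width T ≤ ε * (Real.log (Real.log T) * width T) := by nlinarith
      nlinarith
    have h7 : h * width T ≤ 1 / 4 := by nlinarith
    obtain ⟨h4, h5⟩ := H1 s h3 (by linarith) hs3
    refine ⟨h4, ?_⟩
    rw [div_eq_mul_inv, norm_mul]
    have h8 : ‖s - 1‖ ≤ 4 := by
      refine (Complex.norm_le_abs_re_add_abs_im _).trans ?_
      simp only [Complex.sub_re, Complex.one_re, Complex.sub_im, Complex.one_im, sub_zero]
      have : |s.re - 1| ≤ 1 := by rw [abs_le]; constructor <;> linarith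
      linarith
    calc _ ≤ 4 * C := by gcongr
      _ ≤ (4 * C + 1) * 1 := by linarith
      _ ≤ _ := by gcongr

end ZeroFreeRegion

section PerronFormula
open MeasureTheory ArithmeticFunction

theorem norm_inv_mul_add_one_le {s : ℂ} (hs : 1 / 2 ≤ s.re) :
    ‖(s * (s + 1))⁻¹‖ ≤ 2 * (1 + s.im ^ 2)⁻¹ := by
  have h1 : ∀ z : ℂ, ‖z‖ ^ 2 = z.re ^ 2 + z.im ^ 2 := fun z => by
    rw [← Complex.normSq_eq_norm_sq, Complex.normSq_apply]; ring
  have h2 : (1 + s.im ^ 2) / 4 ≤ ‖s‖ ^ 2 := by rw [h1]; nlinarith [sq_nonneg s.im]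
  have h3 : 1 + s.im ^ 2 ≤ ‖s + 1‖ ^ 2 := by
    rw [h1]; simp only [Complex.add_re, Complex.one_re, Complex.add_im, Complex.one_im]; nlinarith
  have h4 : 0 < 1 + s.im ^ 2 := by positivity
  have h5 : (1 + s.im ^ 2) / 2 ≤ ‖s‖ * ‖s + 1‖ := by
    refine (pow_le_pow_iff_left₀ (by positivity) (by positivity) two_ne_zero).1 ?_
    rw [mul_pow]
    nlinarith
  rw [norm_inv, norm_mul]
  calc _ ≤ ((1 + s.im ^ 2) / 2)⁻¹ := by gcongr
    _ = _ := by rw [inv_div, div_eq_mul_inv]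

theorem ne_zero_of_half_le_re {s : ℂ} (hs : 1 / 2 ≤ s.re) : s * (s + 1) ≠ 0 := by
  refine mul_ne_zero ?_ ?_ <;> intro h
  · rw [h] at hs; norm_num at hs
  · have := congrArg Complex.re h
    simp at this; linarith

theorem integrable_perron_kernel {x : ℝ} (hx : 1 / 2 ≤ x) :
    Integrable fun y : ℝ => (((x : ℂ) + y * Complex.I) * (x + y * Complex.I + 1))⁻¹ := by
  refine (integrable_inv_one_add_sq.const_mul 2).mono' ?_ (ae_of_all _ fun y => ?_)
  · refine (Continuous.inv₀ (by fun_prop) fun y => ?_).aestronglyMeasurable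
    exact ne_zero_of_half_le_re (by simpa using hx)
  · simpa using norm_inv_mul_add_one_le (s := (x : ℂ) + y * Complex.I) (by simpa using hx)

theorem hasMellin_one_sub {s : ℂ} (hs : 1 / 2 ≤ s.re) :
    HasMellin (fun u : ℝ => Set.indicator (Set.Ioc 0 1) (fun _ => (1 : ℂ)) u
      - Set.indicator (Set.Ioc 0 1) (fun t : ℝ => (t : ℂ) ^ (1 : ℂ)) u) s (s * (s + 1))⁻¹ := by
  have h1 := hasMellin_one_Ioc (s := s) (by linarith)
  have h2 := hasMellin_cpow_Ioc 1 (s := s) (by simp; linarith)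
  have h3 := hasMellin_sub h1.1 h2.1
  rw [h1.2, h2.2] at h3
  have h4 := left_ne_zero_of_mul (ne_zero_of_half_le_re hs)
  have h5 := right_ne_zero_of_mul (ne_zero_of_half_le_re hs)
  have h6 : (s * (s + 1))⁻¹ = 1 / s - 1 / (s + 1) := by field_simp; ring
  rwa [h6]

theorem perron_single {x u : ℝ} (hx : 1 / 2 ≤ x) (hu : 0 < u) :
    (∫ y : ℝ, (u : ℂ) ^ (-((x : ℂ) + y * Complex.I)) *
      (((x : ℂ) + y * Complex.I) * (x + y * Complex.I + 1))⁻¹) = 2 * π * (max (1 - u) 0 : ℝ) := by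
  set f : ℝ → ℂ := fun u : ℝ => Set.indicator (Set.Ioc 0 1) (fun _ => (1 : ℂ)) u
      - Set.indicator (Set.Ioc 0 1) (fun t : ℝ => (t : ℂ) ^ (1 : ℂ)) u with hf
  have hfu : ∀ v : ℝ, 0 < v → f v = ((max (1 - v) 0 : ℝ) : ℂ) := by
    intro v hv
    by_cases h : v ≤ 1
    · have hv1 : v ∈ Set.Ioc (0 : ℝ) 1 := ⟨hv, h⟩
      simp only [hf, Set.indicator_of_mem hv1, Complex.cpow_one]
      rw [max_eq_left (by linarith)]
      push_cast; rfl
    · have hv1 : v ∉ Set.Ioc (0 : ℝ) 1 := fun h' => h h'.2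
      simp only [hf, Set.indicator_of_notMem hv1]
      rw [max_eq_right (by linarith)]
      simp
  have hre : ∀ y : ℝ, 1 / 2 ≤ ((x : ℂ) + y * Complex.I).re := fun y => by simpa using hx
  have hmel : ∀ y : ℝ, mellin f (x + y * Complex.I)
      = (((x : ℂ) + y * Complex.I) * (x + y * Complex.I + 1))⁻¹ := fun y =>
    (hasMellin_one_sub (hre y)).2
  have hvi : Complex.VerticalIntegrable (mellin f) x := by
    unfold Complex.VerticalIntegrable
    simp_rw [hmel]
    exact integrable_perron_kernel hx
  have hcont : ContinuousAt f u := by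
    have : ContinuousAt (fun v : ℝ => ((max (1 - v) 0 : ℝ) : ℂ)) u := by fun_prop
    refine this.congr ?_
    filter_upwards [lt_mem_nhds hu] with v hv
    exact (hfu v hv).symm
  have h := mellinInv_mellin_eq x f hu (hasMellin_one_sub (s := (x : ℂ)) (by simpa using hx)).1 hvi
    hcont
  rw [hfu u hu] at h
  rw [← h, mellinInv]
  simp_rw [hmel, smul_eq_mul]
  have hpi : (π : ℂ) ≠ 0 := by exact_mod_cast Real.pi_ne_zero
  have h2 : 2 * (π : ℂ) * ((1 / (2 * π) : ℝ) : ℂ) = 1 := by push_cast; field_simp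
  rw [Complex.real_smul, ← mul_assoc, h2, one_mul]

theorem norm_ofReal_cpow {u : ℝ} (hu : 0 < u) (x y : ℝ) :
    ‖(u : ℂ) ^ ((x : ℂ) + y * Complex.I)‖ = u ^ x := by
  rw [Complex.norm_cpow_eq_rpow_re_of_pos hu]; simp

/-- The smoothed Perron formula for the Möbius function. -/
theorem perron_moebius {x X : ℝ} (hx : 1 < x) (hX : 0 < X) :
    (∫ y : ℝ, (X : ℂ) ^ ((x : ℂ) + y * Complex.I) *
      (((x : ℂ) + y * Complex.I) * (x + y * Complex.I + 1))⁻¹ *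
        (riemannZeta (x + y * Complex.I))⁻¹)
      = 2 * π * ((∑ n ∈ Finset.Ioc 0 ⌊X⌋₊, (ArithmeticFunction.moebius n : ℝ) * (1 - n / X) : ℝ) : ℂ)
      := by
  have hx2 : 1 / 2 ≤ x := by linarith
  set k : ℝ → ℂ := fun y => (((x : ℂ) + y * Complex.I) * (x + y * Complex.I + 1))⁻¹ with hk
  set m : ℕ → ℂ := fun n => ((ArithmeticFunction.moebius n : ℤ) : ℂ) with hm
  have hre : ∀ y : ℝ, 1 < ((x : ℂ) + y * Complex.I).re := fun y => by simpa using hx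
  set F : ℕ → ℝ → ℂ := fun n y => (X : ℂ) ^ ((x : ℂ) + y * Complex.I) * k y *
    LSeries.term m (x + y * Complex.I) n with hF
  have hFeq : ∀ n : ℕ, n ≠ 0 → F n = fun y : ℝ => m n *
      ((((n : ℝ) / X : ℝ) : ℂ) ^ (-((x : ℂ) + y * Complex.I)) * k y) := by
    intro n hn
    funext y
    have hn0 : (0 : ℝ) < n := by positivity
    simp only [hF]
    have h1 : (((n : ℝ) / X : ℝ) : ℂ) ^ (-((x : ℂ) + y * Complex.I))
        = (X : ℂ) ^ ((x : ℂ) + y * Complex.I) * ((n : ℂ) ^ ((x : ℂ) + y * Complex.I))⁻¹ := by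
      rw [Complex.cpow_neg, div_eq_mul_inv, Complex.ofReal_mul,
        Complex.mul_cpow_ofReal_nonneg hn0.le (by positivity), Complex.ofReal_inv,
        Complex.inv_cpow _ _ (by
          rw [Complex.arg_ofReal_of_nonneg hX.le]; exact Real.pi_pos.ne),
        mul_inv, inv_inv, Complex.ofReal_natCast, mul_comm]
    rw [LSeries.term_of_ne_zero hn, h1]
    ring
  have hnormF : ∀ n y, ‖F n y‖ = X ^ x * ‖LSeries.term m (x : ℂ) n‖ * ‖k y‖ := by
    intro n y
    simp only [hF]
    rw [norm_mul, norm_mul, norm_ofReal_cpow hX, LSeries.norm_term_eq, LSeries.norm_term_eq]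
    split_ifs
    · simp
    · simp
      ring
  have hkint : Integrable k := integrable_perron_kernel hx2
  have hterm0 : ∀ s : ℂ, LSeries.term m s 0 = 0 := fun s => LSeries.term_zero ..
  have hF0 : F 0 = 0 := by
    funext y
    simp [hF]
  have hFint : ∀ n, Integrable (F n) := by
    intro n
    rcases eq_or_ne n 0 with rfl | hn
    · rw [hF0]; exact integrable_zero _ _ _
    · have hn0 : (0 : ℝ) < n := by positivity
      rw [hFeq n hn]
      refine (hkint.norm.const_mul (((n : ℝ) / X) ^ (-x))).mono' ?_ (ae_of_all _ fun y => ?_) |>.const_mul _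
      · refine AEStronglyMeasurable.mul ?_ hkint.aestronglyMeasurable
        refine Continuous.aestronglyMeasurable ?_
        refine Continuous.const_cpow (by fun_prop) (Or.inl ?_)
        exact_mod_cast (by positivity : (n : ℝ) / X ≠ 0)
      · rw [norm_mul, Complex.norm_cpow_eq_rpow_re_of_pos (by positivity)]
        simp
  have hsum : Summable fun n => ∫ y, ‖F n y‖ := by
    have : Summable fun n => X ^ x * ‖LSeries.term m (x : ℂ) n‖ * ∫ y, ‖k y‖ :=
      ((LSeriesSummable_moebius_iff (s := (x : ℂ)).2 (by simpa using hx)).norm.mul_left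
        (X ^ x)).mul_right _
    refine this.congr fun n => ?_
    simp_rw [hnormF]
    rw [integral_const_mul]
  have h := hasSum_integral_of_summable_integral_norm hFint hsum
  have hL : ∀ y : ℝ, ∑' n, F n y = (X : ℂ) ^ ((x : ℂ) + y * Complex.I) * k y *
        (riemannZeta (x + y * Complex.I))⁻¹ := by
    intro y
    simp only [hF]
    rw [tsum_mul_left]
    congr 1
    have h1 := LSeries_zeta_mul_Lseries_moebius (hre y)
    rw [LSeries_zeta_eq_riemannZeta (hre y)] at h1
    exact eq_inv_of_mul_eq_one_right h1
  simp_rw [hL] at h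
  have hI : ∀ n, ∫ y, F n y = if n ∈ Finset.Ioc 0 ⌊X⌋₊ then
      2 * π * (((ArithmeticFunction.moebius n : ℝ) * (1 - n / X) : ℝ) : ℂ) else 0 := by
    intro n
    rcases eq_or_ne n 0 with rfl | hn
    · rw [hF0]; simp
    · have hn0 : (0 : ℝ) < n := by positivity
      rw [hFeq n hn, integral_const_mul, perron_single hx2 (by positivity)]
      split_ifs with hmem
      · rw [Finset.mem_Ioc, Nat.le_floor_iff hX.le] at hmem
        have : (n : ℝ) / X ≤ 1 := by rw [div_le_one hX]; exact hmem.2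
        rw [max_eq_left (by linarith)]
        simp only [hm]
        push_cast
        ring
      · rw [Finset.mem_Ioc, Nat.le_floor_iff hX.le] at hmem
        push Not at hmem
        have : 1 ≤ (n : ℝ) / X := by rw [le_div_iff₀ hX]; linarith [hmem (Nat.pos_of_ne_zero hn)]
        rw [max_eq_right (by linarith)]
        simp
  simp_rw [hI] at h
  have h2 := hasSum_sum_of_ne_finset_zero (s := Finset.Ioc 0 ⌊X⌋₊)
    (L := SummationFilter.unconditional ℕ) (f := fun n => if n ∈ Finset.Ioc 0 ⌊X⌋₊ then
      2 * π * (((ArithmeticFunction.moebius n : ℝ) * (1 - n / X) : ℝ) : ℂ) else 0)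
    (fun n hn => if_neg hn)
  refine (h.unique h2).trans ?_
  rw [Finset.sum_congr rfl (fun n hn => if_pos hn), ← Finset.mul_sum,
    Complex.ofReal_sum]

end PerronFormula

section ContourShift
open MeasureTheory ArithmeticFunction

theorem inv_riemannZeta_eq_div {s : ℂ} (hs : s ≠ 1) :
    (riemannZeta s)⁻¹ = (s - 1) / riemannZeta₁ s := by
  rw [riemannZeta_eq_inv_sub_mul hs, mul_inv, inv_inv, div_eq_mul_inv]

theorem half_pi_sub_arctan_le {T : ℝ} (hT : 0 < T) : π / 2 - Real.arctan T ≤ 1 / T := by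
  rw [← Real.arctan_inv_of_pos hT, one_div]
  have h : 0 ≤ Real.arctan T⁻¹ := Real.arctan_nonneg.2 (by positivity)
  calc Real.arctan T⁻¹ ≤ Real.tan (Real.arctan T⁻¹) :=
        Real.le_tan h (Real.arctan_lt_pi_div_two _)
    _ = T⁻¹ := Real.tan_arctan _

theorem norm_integral_sub_integral_Ioc_le {f : ℝ → ℂ} {D T : ℝ} (hT : 0 < T) (hD : 0 ≤ D)
    (hf : Integrable f) (hb : ∀ y, ‖f y‖ ≤ D * (1 + y ^ 2)⁻¹) :
    ‖(∫ y, f y) - ∫ y in (-T)..T, f y‖ ≤ 2 * D / T := by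
  rw [intervalIntegral.integral_of_le (by linarith), ← integral_add_compl
    (measurableSet_Ioc (a := -T) (b := T)) hf, add_sub_cancel_left]
  have hg : Integrable fun y : ℝ => D * (1 + y ^ 2)⁻¹ := integrable_inv_one_add_sq.const_mul D
  refine (norm_integral_le_of_norm_le hg.integrableOn (ae_of_all _ hb)).trans ?_
  have h1 := integral_add_compl (measurableSet_Ioc (a := -T) (b := T)) hg
  rw [← intervalIntegral.integral_of_le (by linarith), intervalIntegral.integral_const_mul,
    integral_inv_one_add_sq, integral_const_mul, integral_const_mul,
    integral_univ_inv_one_add_sq, Real.arctan_neg] at h1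
  rw [integral_const_mul]
  have h2 := half_pi_sub_arctan_le hT
  have h3 : D * (π / 2 - Real.arctan T) ≤ D * (1 / T) := by gcongr
  have h4 : 2 * D / T = 2 * (D * (1 / T)) := by ring
  rw [h4]
  linarith

theorem exists_abs_sum_moebius_smooth_le : ∃ h A C T₀ : ℝ, 0 < h ∧ 0 < A ∧ 0 < C ∧
    ∀ T X : ℝ, T₀ ≤ T → 3 ≤ X →
      |∑ n ∈ Finset.Ioc 0 ⌊X⌋₊, (moebius n : ℝ) * (1 - n / X)| ≤
        C * X * (Real.log T ^ A * (Real.log X / T + X ^ (-(h * width T)))) := by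
  obtain ⟨h, A, C, T₀, hh, hA, hC, hT₀, H⟩ := exists_norm_sub_one_div_riemannZeta₁_le
  obtain ⟨D, hD, hinv⟩ := exists_norm_inv_riemannZeta_le
  obtain ⟨T₁, hT₁, hw⟩ := exists_forall_width h
  refine ⟨h, A, 12 * D + 7 * C + 24 * C, max T₀ T₁, hh, hA, by positivity, fun T X hT hX => ?_⟩
  obtain ⟨hN, hl1, -, -, hlw, hwpos, -, hlL⟩ := hw T ((le_max_right _ _).trans hT)
  have H := H T ((le_max_left _ _).trans hT)
  have hT16 : 16 ≤ T := hT₀.trans ((le_max_left _ _).trans hT)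
  set η := h * width T with hη
  have hη0 : 0 < η := by positivity
  have hη1 : η ≤ 1 / 4 := by nlinarith
  have hX0 : 0 < X := by linarith
  have hlogX : 1 ≤ Real.log X := by
    rw [Real.le_log_iff_exp_le hX0]
    linarith [Real.exp_one_lt_d9]
  set P := Real.log T ^ A with hP
  have hP1 : 1 ≤ P := Real.one_le_rpow (by linarith) hA.le
  set x := 1 + 1 / Real.log X with hx
  have hx1 : 1 < x := by
    have : 0 < 1 / Real.log X := by positivity
    linarith
  have hx2 : x ≤ 2 := by
    have : 1 / Real.log X ≤ 1 := by rw [div_le_one (by linarith)]; exact hlogX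
    linarith
  have hXx : X ^ x = Real.exp 1 * X := by
    rw [hx, Real.rpow_add hX0, Real.rpow_one, Real.rpow_def_of_pos hX0, mul_one_div_cancel (by linarith),
      mul_comm]
  have hXx3 : X ^ x ≤ 3 * X := by
    rw [hXx]; gcongr; linarith [Real.exp_one_lt_d9]
  set F : ℂ → ℂ := fun s => (X : ℂ) ^ s * (s * (s + 1))⁻¹ * ((s - 1) / riemannZeta₁ s) with hF
  have hXne : (X : ℂ) ≠ 0 := by exact_mod_cast hX0.ne'
  have hFd : ∀ s : ℂ, 1 / 2 ≤ s.re → riemannZeta₁ s ≠ 0 → DifferentiableAt ℂ F s := by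
    intro s h1 h2
    have h3 := ne_zero_of_half_le_re h1
    have h4 := differentiable_riemannZeta₁ s
    refine DifferentiableAt.mul (DifferentiableAt.mul ?_ ?_) ?_
    · exact differentiableAt_id.const_cpow (Or.inl hXne)
    · exact DifferentiableAt.inv (by fun_prop) h3
    · exact DifferentiableAt.div (by fun_prop) h4 h2
  have hFb : ∀ s : ℂ, |s.im| ≤ T → 1 - η ≤ s.re → s.re ≤ x →
      ‖F s‖ ≤ X ^ s.re * (2 * (1 + s.im ^ 2)⁻¹) * (C * P) := by
    intro s h1 h2 h3
    simp only [hF]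
    rw [norm_mul, norm_mul, Complex.norm_cpow_eq_rpow_re_of_pos hX0]
    gcongr
    · exact norm_inv_mul_add_one_le (by linarith)
    · exact (H s h1 h2 (by linarith)).2
  have hre : ∀ y : ℝ, ((x : ℂ) + y * Complex.I).re = x := fun y => by simp
  have him : ∀ y : ℝ, ((x : ℂ) + y * Complex.I).im = y := fun y => by simp
  have hFx : ∀ y : ℝ, F (x + y * Complex.I) = (X : ℂ) ^ ((x : ℂ) + y * Complex.I) *
      (((x : ℂ) + y * Complex.I) * (x + y * Complex.I + 1))⁻¹ *
        (riemannZeta (x + y * Complex.I))⁻¹ := by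
    intro y
    rw [inv_riemannZeta_eq_div]
    intro h1
    have := congrArg Complex.re h1
    rw [hre, Complex.one_re] at this
    linarith
  have hFxb : ∀ y : ℝ, ‖F (x + y * Complex.I)‖ ≤ 6 * X * (D * Real.log X) * (1 + y ^ 2)⁻¹ := by
    intro y
    rw [hFx, norm_mul, norm_mul, norm_ofReal_cpow hX0]
    have h1 := norm_inv_mul_add_one_le (s := (x : ℂ) + y * Complex.I) (by rw [hre]; linarith)
    have h2 := hinv ((x : ℂ) + y * Complex.I) (by rw [hre]; linarith) (by rw [hre]; linarith)
    rw [hre] at h2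
    rw [him] at h1
    have h3 : D / (x - 1) = D * Real.log X := by rw [hx]; simp
    rw [h3] at h2
    calc _ ≤ (3 * X) * (2 * (1 + y ^ 2)⁻¹) * (D * Real.log X) := by gcongr
      _ = _ := by ring
  have hFint : Integrable fun y : ℝ => F (x + y * Complex.I) := by
    refine (integrable_inv_one_add_sq.const_mul (6 * X * (D * Real.log X))).mono' ?_
      (ae_of_all _ hFxb)
    refine Continuous.aestronglyMeasurable (continuous_iff_continuousAt.2 fun y => ?_)
    exact ContinuousAt.comp (f := fun y : ℝ => (x : ℂ) + y * Complex.I)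
      (hFd _ (by rw [hre]; linarith) (riemannZeta₁_ne_zero_of_one_le_re (by
        rw [hre]; linarith))).continuousAt (by fun_prop)
  have hper := perron_moebius hx1 hX0
  simp_rw [← hFx] at hper
  have htail := norm_integral_sub_integral_Ioc_le (T := T) (by linarith) (by positivity) hFint hFxb
  have hrect := Complex.integral_boundary_rect_eq_zero_of_differentiableOn F
    ⟨1 - η, -T⟩ ⟨x, T⟩ (by
      intro s hs
      rw [Complex.mem_reProdIm, Set.uIcc_of_le (by simp; linarith), Set.uIcc_of_le (by simp; linarith)]
        at hs
      exact (hFd s (by linarith [hs.1.1]) (H s (abs_le.2 hs.2) hs.1.1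
        (hs.1.2.trans hx2)).1).differentiableWithinAt)
  simp only at hrect
  have hhor : ∀ t : ℝ, |t| = T →
      ‖∫ u in (1 - η)..x, F (u + t * Complex.I)‖ ≤ 12 * X * (C * P) / T := by
    intro t ht
    have hb : ∀ u ∈ Set.uIoc (1 - η) x, ‖F (u + t * Complex.I)‖ ≤ 6 * X * (C * P) / T := by
      intro u hu
      rw [Set.uIoc_of_le (by linarith)] at hu
      have h1 := hFb ((u : ℂ) + t * Complex.I) (by simp [ht]) (by simpa using hu.1.le)
        (by simpa using hu.2)
      have hure : ((u : ℂ) + t * Complex.I).re = u := by simp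
      have huim : ((u : ℂ) + t * Complex.I).im = t := by simp
      rw [hure, huim, ← sq_abs, ht] at h1
      have h2 : X ^ u ≤ 3 * X :=
        (Real.rpow_le_rpow_of_exponent_le (by linarith) hu.2).trans hXx3
      have h3 : (1 + T ^ 2)⁻¹ ≤ T⁻¹ := by gcongr; nlinarith
      calc _ ≤ _ := h1
        _ ≤ (3 * X) * (2 * T⁻¹) * (C * P) := by gcongr
        _ = _ := by ring
    refine (intervalIntegral.norm_integral_le_of_norm_le_const hb).trans ?_
    have h4 : |x - (1 - η)| ≤ 2 := by rw [abs_le]; constructor <;> linarith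
    calc _ ≤ 6 * X * (C * P) / T * 2 := by gcongr
      _ = _ := by ring
  have hleft : ‖∫ y in (-T)..T, F ((1 - η : ℝ) + y * Complex.I)‖
      ≤ X ^ (1 - η) * (2 * (C * P)) * π := by
    have hb : ∀ᵐ y : ℝ ∂(volume.restrict (Set.uIoc (-T) T)), ‖F ((1 - η : ℝ) + y * Complex.I)‖ ≤
        X ^ (1 - η) * (2 * (C * P)) * (1 + y ^ 2)⁻¹ := by
      refine (ae_restrict_iff' measurableSet_uIoc).2 (ae_of_all _ fun y hy => ?_)
      rw [Set.uIoc_of_le (by linarith)] at hy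
      have hure : (((1 - η : ℝ) : ℂ) + y * Complex.I).re = 1 - η := by simp
      have huim : (((1 - η : ℝ) : ℂ) + y * Complex.I).im = y := by simp
      have h1 := hFb (((1 - η : ℝ) : ℂ) + y * Complex.I)
        (by rw [huim]; exact abs_le.2 ⟨hy.1.le, hy.2⟩) (by rw [hure]) (by rw [hure]; linarith)
      rw [hure, huim] at h1
      exact h1.trans_eq (by ring)
    have h1 := intervalIntegral.norm_integral_le_abs_of_norm_le hb
      ((integrable_inv_one_add_sq.const_mul _).intervalIntegrable)
    refine h1.trans ?_
    rw [intervalIntegral.integral_const_mul, integral_inv_one_add_sq, Real.arctan_neg]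
    have h2 := Real.arctan_lt_pi_div_two T
    have h3 : 0 ≤ Real.arctan T := Real.arctan_nonneg.2 (by linarith)
    have h4 : 0 ≤ Real.arctan T - -Real.arctan T := by linarith
    rw [abs_of_nonneg (by positivity)]
    gcongr
    linarith
  set R := ∫ y in (-T)..T, F (x + y * Complex.I) with hR
  have hRb : ‖R‖ ≤ 12 * X * (C * P) / T + 12 * X * (C * P) / T
      + X ^ (1 - η) * (2 * (C * P)) * π := by
    have h1 : R = Complex.I * ((∫ u in (1 - η)..x, F (u + (-T : ℝ) * Complex.I))
        - ∫ u in (1 - η)..x, F (u + T * Complex.I))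
        + ∫ y in (-T)..T, F ((1 - η : ℝ) + y * Complex.I) := by
      rw [smul_eq_mul, smul_eq_mul] at hrect
      linear_combination (-Complex.I) * hrect +
        (R - ∫ y in (-T)..T, F ((1 - η : ℝ) + y * Complex.I)) * Complex.I_mul_I
    rw [h1]
    refine (norm_add_le _ _).trans (add_le_add ?_ hleft)
    rw [norm_mul, Complex.norm_I, one_mul]
    exact (norm_sub_le _ _).trans (add_le_add (hhor _ (by rw [abs_neg, abs_of_pos]; linarith))
      (hhor _ (abs_of_pos (by linarith))))
  set S := ∑ n ∈ Finset.Ioc 0 ⌊X⌋₊, (moebius n : ℝ) * (1 - n / X) with hS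
  have hSn : 2 * π * |S| = ‖∫ y : ℝ, F (x + y * Complex.I)‖ := by
    rw [hper, norm_mul, Complex.norm_real, Real.norm_eq_abs, norm_mul, Complex.norm_real,
      Real.norm_of_nonneg Real.pi_pos.le]
    simp
  have hpi := Real.pi_gt_three
  have hpi4 := Real.pi_lt_d2
  have hXη : X ^ (1 - η) = X * X ^ (-η) := by
    rw [sub_eq_add_neg, Real.rpow_add hX0, Real.rpow_one]
  have hfull : ‖∫ y : ℝ, F (x + y * Complex.I)‖ ≤ 2 * (6 * X * (D * Real.log X)) / T + ‖R‖ := by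
    have := norm_le_insert' (∫ y : ℝ, F (x + y * Complex.I)) R
    linarith
  have hmain : |S| ≤ ‖∫ y : ℝ, F (x + y * Complex.I)‖ := by
    rw [← hSn]; nlinarith [abs_nonneg S]
  rw [hXη] at hRb
  have hXT : 0 ≤ X / T := by positivity
  have hXe : 0 ≤ X * X ^ (-η) := by positivity
  have e1 : 2 * (6 * X * (D * Real.log X)) / T ≤ 12 * D * (X * (P * (Real.log X / T))) := by
    have : X / T * Real.log X * 1 ≤ X / T * Real.log X * P := by gcongr
    have h5 : 2 * (6 * X * (D * Real.log X)) / T = 12 * D * (X / T * Real.log X * 1) := by ring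
    have h6 : 12 * D * (X * (P * (Real.log X / T))) = 12 * D * (X / T * Real.log X * P) := by ring
    rw [h5, h6]
    gcongr
  have e2 : 12 * X * (C * P) / T + 12 * X * (C * P) / T ≤ 24 * C * (X * (P * (Real.log X / T))) := by
    have h5 : 12 * X * (C * P) / T + 12 * X * (C * P) / T = 24 * C * (X * (P * (1 / T))) := by ring
    rw [h5]
    gcongr
  have e3 : X * X ^ (-η) * (2 * (C * P)) * π ≤ 7 * C * (X * (P * X ^ (-η))) := by
    have h5 : X * X ^ (-η) * (2 * (C * P)) * π = 2 * π * (C * (X * (P * X ^ (-η)))) := by ring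
    rw [h5, mul_assoc 7]
    gcongr
    linarith
  have p1 : 0 ≤ X * (P * (Real.log X / T)) := by positivity
  have p2 : 0 ≤ X * (P * X ^ (-η)) := by positivity
  have e4 : (12 * D + 7 * C + 24 * C) * X * (P * (Real.log X / T + X ^ (-η)))
      = 12 * D * (X * (P * (Real.log X / T))) + 7 * C * (X * (P * (Real.log X / T)))
        + 24 * C * (X * (P * (Real.log X / T))) + 12 * D * (X * (P * X ^ (-η)))
        + 7 * C * (X * (P * X ^ (-η))) + 24 * C * (X * (P * X ^ (-η))) := by ring
  rw [e4]
  have q1 : 0 ≤ 7 * C * (X * (P * (Real.log X / T))) := by positivity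
  have q2 : 0 ≤ 12 * D * (X * (P * X ^ (-η))) := by positivity
  have q3 : 0 ≤ 24 * C * (X * (P * X ^ (-η))) := by positivity
  linarith

end ContourShift

section MertensBound
open ArithmeticFunction

/-- The exponent in the Vinogradov–Korobov error term. -/
noncomputable def vkExponent (x : ℝ) : ℝ :=
  Real.log x ^ (3 / 5 : ℝ) * Real.log (Real.log x) ^ (-(1 / 5) : ℝ)

theorem one_le_log_of_one_le_log_log {x : ℝ} (hx : 1 ≤ x) (h : 1 ≤ Real.log (Real.log x)) :
    Real.exp 1 ≤ Real.log x := by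
  have h0 : 0 < Real.log x := by
    rcases (Real.log_nonneg hx).eq_or_lt with h1 | h1
    · rw [← h1, Real.log_zero] at h; linarith
    · exact h1
  rwa [Real.le_log_iff_exp_le h0] at h

theorem log_rpow_le_vkExponent {x : ℝ} (hx : 1 ≤ x) (h : 1 ≤ Real.log (Real.log x)) :
    Real.log x ^ (2 / 5 : ℝ) ≤ vkExponent x := by
  have h0 : 0 < Real.log x := (Real.exp_pos 1).trans_le (one_le_log_of_one_le_log_log hx h)
  have h1 : Real.log (Real.log x) ≤ Real.log x := by linarith [Real.log_le_sub_one_of_pos h0]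
  have h2 : Real.log x ^ (-(1 / 5) : ℝ) ≤ Real.log (Real.log x) ^ (-(1 / 5) : ℝ) :=
    Real.rpow_le_rpow_of_nonpos (by linarith) h1 (by norm_num)
  calc Real.log x ^ (2 / 5 : ℝ) = Real.log x ^ (3 / 5 : ℝ) * Real.log x ^ (-(1 / 5) : ℝ) := by
        rw [← Real.rpow_add h0]; norm_num
    _ ≤ _ := by unfold vkExponent; gcongr

theorem vkExponent_le_log {x : ℝ} (hx : 1 ≤ x) (h : 1 ≤ Real.log (Real.log x)) :
    vkExponent x ≤ Real.log x := by
  have h1 : 1 ≤ Real.log x :=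
    (Real.one_le_exp zero_le_one).trans (one_le_log_of_one_le_log_log hx h)
  have h2 : Real.log (Real.log x) ^ (-(1 / 5) : ℝ) ≤ 1 :=
    Real.rpow_le_one_of_one_le_of_nonpos h (by norm_num)
  have h3 : Real.log x ^ (3 / 5 : ℝ) ≤ Real.log x := by
    nth_rw 2 [← Real.rpow_one (Real.log x)]
    exact Real.rpow_le_rpow_of_exponent_le h1 (by norm_num)
  calc vkExponent x ≤ Real.log x ^ (3 / 5 : ℝ) * 1 := by unfold vkExponent; gcongr
    _ ≤ _ := by rwa [mul_one]

theorem one_le_vkExponent {x : ℝ} (hx : 1 ≤ x) (h : 1 ≤ Real.log (Real.log x)) :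
    1 ≤ vkExponent x :=
  (Real.one_le_rpow ((Real.one_le_exp zero_le_one).trans (one_le_log_of_one_le_log_log hx h))
    (by norm_num)).trans (log_rpow_le_vkExponent hx h)

theorem rpow_mul_log_rpow_le {a b : ℝ} (ha : Real.exp 1 ≤ a) (hab : a ≤ b) :
    a ^ (3 / 5 : ℝ) * Real.log a ^ (-(1 / 5) : ℝ) ≤ b ^ (3 / 5 : ℝ) * Real.log b ^ (-(1 / 5) : ℝ) := by
  have ha0 : 0 < a := (Real.exp_pos 1).trans_le ha
  have key : ∀ t : ℝ, Real.exp 1 ≤ t → t ^ (3 / 5 : ℝ) * Real.log t ^ (-(1 / 5) : ℝ) =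
      t ^ (2 / 5 : ℝ) * (Real.log t / t) ^ (-(1 / 5) : ℝ) := by
    intro t ht
    have ht0 : 0 < t := (Real.exp_pos 1).trans_le ht
    have hl : 1 ≤ Real.log t := (Real.le_log_iff_exp_le ht0).2 ht
    have h5 : t ^ (3 / 5 : ℝ) = t ^ (2 / 5 : ℝ) * t ^ (1 / 5 : ℝ) := by
      rw [← Real.rpow_add ht0]; norm_num
    rw [Real.div_rpow (by linarith) ht0.le, h5, Real.rpow_neg ht0.le]
    field_simp
  rw [key a ha, key b (ha.trans hab)]
  have hb : 1 ≤ Real.log b := (Real.le_log_iff_exp_le (ha0.trans_le hab)).2 (ha.trans hab)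
  have hla : 1 ≤ Real.log a := (Real.le_log_iff_exp_le ha0).2 ha
  refine mul_le_mul (Real.rpow_le_rpow ha0.le hab (by norm_num)) ?_
    (Real.rpow_nonneg (div_nonneg (by linarith) ha0.le) _)
    (Real.rpow_nonneg (ha0.le.trans hab) _)
  exact Real.rpow_le_rpow_of_nonpos (div_pos (by linarith) (ha0.trans_le hab))
    (Real.log_div_self_antitoneOn ha (ha.trans hab) hab) (by norm_num)

theorem vkExponent_mono {x y : ℝ} (hx : 1 ≤ x) (h : 1 ≤ Real.log (Real.log x)) (hxy : x ≤ y) :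
    vkExponent x ≤ vkExponent y :=
  rpow_mul_log_rpow_le (one_le_log_of_one_le_log_log hx h) (Real.log_le_log (by linarith) hxy)

theorem vkExponent_le_of_rpow_le {x y : ℝ} (hx : 1 ≤ x)
    (h : 1 ≤ Real.log (Real.log x / 8)) (hL : 8 ≤ Real.log x) (hxy : x ^ (1 / 8 : ℝ) ≤ y) :
    vkExponent x ≤ 8 * vkExponent y := by
  have hx0 : 0 < x := by linarith
  have hL8 : Real.exp 1 ≤ Real.log x / 8 := (Real.le_log_iff_exp_le (by linarith)).1 h
  have hy : Real.log x / 8 ≤ Real.log y := by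
    have := Real.log_le_log (by positivity) hxy
    rw [Real.log_rpow hx0] at this
    linarith
  have h1 := rpow_mul_log_rpow_le hL8 hy
  have h2 : Real.log (Real.log x) ^ (-(1 / 5) : ℝ) ≤ Real.log (Real.log x / 8) ^ (-(1 / 5) : ℝ) :=
    Real.rpow_le_rpow_of_nonpos (by linarith) (Real.log_le_log (by linarith) (by linarith))
      (by norm_num)
  have h3 : Real.log x ^ (3 / 5 : ℝ) ≤ 8 * (Real.log x / 8) ^ (3 / 5 : ℝ) := by
    rw [Real.div_rpow (by linarith) (by norm_num), mul_div_assoc', le_div_iff₀ (by positivity),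
      mul_comm]
    gcongr
    nth_rw 2 [← Real.rpow_one 8]
    exact Real.rpow_le_rpow_of_exponent_le (by norm_num) (by norm_num)
  calc vkExponent x ≤ (8 * (Real.log x / 8) ^ (3 / 5 : ℝ)) *
        Real.log (Real.log x / 8) ^ (-(1 / 5) : ℝ) := by
        refine mul_le_mul h3 h2 (Real.rpow_nonneg (Real.log_nonneg ?_) _) (by positivity)
        linarith
    _ = 8 * ((Real.log x / 8) ^ (3 / 5 : ℝ) * Real.log (Real.log x / 8) ^ (-(1 / 5) : ℝ)) := by ring
    _ ≤ _ := by unfold vkExponent; gcongr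

theorem exists_rpow_le_exp (a : ℝ) {b : ℝ} (hb : 0 < b) :
    ∃ C : ℝ, 0 < C ∧ ∀ v : ℝ, 1 ≤ v → v ^ a ≤ C * Real.exp (b * v) := by
  have h := (isLittleO_rpow_exp_pos_mul_atTop a hb).bound one_pos
  obtain ⟨v₀, hv₀⟩ := Filter.eventually_atTop.1 h
  refine ⟨1 + max v₀ 1 ^ |a|, by positivity, fun v hv => ?_⟩
  have hm : 0 ≤ max v₀ 1 ^ |a| := by positivity
  have he : 1 ≤ Real.exp (b * v) := Real.one_le_exp (by positivity)
  rcases le_total v₀ v with h1 | h1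
  · have := hv₀ v h1
    rw [Real.norm_of_nonneg (by positivity), Real.norm_of_nonneg (by positivity), one_mul] at this
    nlinarith
  · have : v ^ a ≤ max v₀ 1 ^ |a| :=
      (Real.rpow_le_rpow_of_exponent_le hv (le_abs_self a)).trans
        (Real.rpow_le_rpow (by linarith) (h1.trans (le_max_left _ _)) (abs_nonneg a))
    nlinarith

theorem vkExponent_le_log_mul_width {x : ℝ} (hx : 1 ≤ x) (h : 1 ≤ Real.log (Real.log x))
    (hV : 1 < vkExponent x) : vkExponent x ≤ Real.log x * width (Real.exp (vkExponent x)) := by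
  have hL : Real.exp 1 ≤ Real.log x := one_le_log_of_one_le_log_log hx h
  have hL0 : 0 < Real.log x := (Real.exp_pos 1).trans_le hL
  have hV0 : 0 < vkExponent x := by linarith
  have hlV : 0 < Real.log (vkExponent x) := Real.log_pos hV
  have h1 : Real.log (vkExponent x) ≤ Real.log (Real.log x) :=
    Real.log_le_log hV0 (vkExponent_le_log hx h)
  have h2 : Real.log (Real.log x) ^ (-1 / 3 : ℝ) ≤ Real.log (vkExponent x) ^ (-1 / 3 : ℝ) :=
    Real.rpow_le_rpow_of_nonpos hlV h1 (by norm_num)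
  have h3 : vkExponent x ^ (5 / 3 : ℝ) = Real.log x * Real.log (Real.log x) ^ (-1 / 3 : ℝ) := by
    unfold vkExponent
    rw [Real.mul_rpow (by positivity) (by positivity), ← Real.rpow_mul hL0.le,
      ← Real.rpow_mul (by linarith)]
    norm_num
  have h4 : vkExponent x = vkExponent x ^ (5 / 3 : ℝ) * vkExponent x ^ (-2 / 3 : ℝ) := by
    rw [← Real.rpow_add hV0]; norm_num
  unfold width
  rw [Real.log_exp]
  calc vkExponent x = Real.log x * (vkExponent x ^ (-2 / 3 : ℝ) *
        Real.log (Real.log x) ^ (-1 / 3 : ℝ)) := by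
        conv_lhs => rw [h4, h3]
        ring
    _ ≤ _ := by gcongr

theorem tendsto_vkExponent_atTop : Filter.Tendsto vkExponent Filter.atTop Filter.atTop := by
  refine Filter.tendsto_atTop_mono' _ ?_
    ((tendsto_rpow_atTop (y := 2 / 5) (by norm_num)).comp Real.tendsto_log_atTop)
  filter_upwards [Filter.eventually_ge_atTop 1,
    tendsto_log_log_atTop.eventually_ge_atTop 1] with x hx h
  exact log_rpow_le_vkExponent hx h

theorem exists_abs_sum_moebius_smooth_le_exp : ∃ c C x₀ : ℝ, 0 < c ∧ c ≤ 1 ∧ 0 < C ∧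
    ∀ X : ℝ, x₀ ≤ X → |∑ n ∈ Finset.Ioc 0 ⌊X⌋₊, (moebius n : ℝ) * (1 - n / X)| ≤
      C * X * Real.exp (-(c * vkExponent X)) := by
  obtain ⟨h, A, C, T₀, hh, hA, hC, H⟩ := exists_abs_sum_moebius_smooth_le
  obtain ⟨C₁, hC₁, H₁⟩ := exists_rpow_le_exp (A + 5 / 2) (b := 1 / 2) (by norm_num)
  obtain ⟨C₂, hC₂, H₂⟩ := exists_rpow_le_exp A (b := h / 2) (by positivity)
  have hev := (Filter.eventually_ge_atTop (3 : ℝ)).and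
    ((tendsto_log_log_atTop.eventually_ge_atTop 1).and
      ((tendsto_vkExponent_atTop.eventually_gt_atTop 1).and
        ((Real.tendsto_exp_atTop.comp tendsto_vkExponent_atTop).eventually_ge_atTop T₀)))
  obtain ⟨x₀, hx₀⟩ := Filter.eventually_atTop.1 hev
  have hc1 : min 1 h / 2 ≤ 1 / 2 := by gcongr; exact min_le_left _ _
  have hch : min 1 h / 2 ≤ h / 2 := by gcongr; exact min_le_right _ _
  refine ⟨min 1 h / 2, C * (C₁ + C₂), x₀, by positivity, by linarith, by positivity,
    fun X hX => ?_⟩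
  obtain ⟨hX3, hll, hV, hT⟩ := hx₀ X hX
  simp only [Function.comp_apply] at hT
  have hX0 : 0 < X := by linarith
  have hmain := H _ X hT hX3
  have hlw := vkExponent_le_log_mul_width (by linarith) hll hV
  have hLV := log_rpow_le_vkExponent (by linarith) hll
  have hL0 : 0 < Real.log X := Real.log_pos (by linarith)
  rw [Real.log_exp] at hmain
  set V := vkExponent X
  have hL : Real.log X ≤ V ^ (5 / 2 : ℝ) := by
    calc Real.log X = (Real.log X ^ (2 / 5 : ℝ)) ^ (5 / 2 : ℝ) := by
          rw [← Real.rpow_mul hL0.le]; norm_num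
      _ ≤ _ := by gcongr
  have hpow : X ^ (-(h * width (Real.exp V))) ≤ Real.exp (-(h * V)) := by
    rw [Real.rpow_def_of_pos hX0, Real.exp_le_exp]
    nlinarith
  have e1 : V ^ A * (Real.log X / Real.exp V) ≤ C₁ * Real.exp (-(min 1 h / 2 * V)) := by
    calc V ^ A * (Real.log X / Real.exp V) ≤ V ^ A * (V ^ (5 / 2 : ℝ) / Real.exp V) := by gcongr
      _ = V ^ (A + 5 / 2) * Real.exp (-V) := by
        rw [Real.rpow_add (by linarith), Real.exp_neg]; ring
      _ ≤ C₁ * Real.exp (1 / 2 * V) * Real.exp (-V) := by gcongr; exact H₁ V hV.le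
      _ = C₁ * Real.exp (-(1 / 2 * V)) := by rw [mul_assoc, ← Real.exp_add]; ring_nf
      _ ≤ _ := by gcongr
  have e2 : V ^ A * X ^ (-(h * width (Real.exp V))) ≤ C₂ * Real.exp (-(min 1 h / 2 * V)) := by
    calc V ^ A * X ^ (-(h * width (Real.exp V))) ≤
          C₂ * Real.exp (h / 2 * V) * Real.exp (-(h * V)) := by gcongr; exact H₂ V hV.le
      _ = C₂ * Real.exp (-(h / 2 * V)) := by rw [mul_assoc, ← Real.exp_add]; ring_nf
      _ ≤ _ := by gcongr
  refine hmain.trans ?_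
  rw [mul_add]
  calc _ ≤ C * X * (C₁ * Real.exp (-(min 1 h / 2 * V)) + C₂ * Real.exp (-(min 1 h / 2 * V))) := by
        gcongr
    _ = _ := by ring

/-- The Mertens function at a real argument. -/
noncomputable def mertens (x : ℝ) : ℝ := ∑ n ∈ Finset.Ioc 0 ⌊x⌋₊, (moebius n : ℝ)

theorem abs_moebius_cast_le_one (n : ℕ) : |(moebius n : ℝ)| ≤ 1 := by
  exact_mod_cast abs_moebius_le_one (n := n)

theorem mul_abs_mertens_le {X H : ℝ} (hX : 0 < X) (hH : 0 < H) :
    H * |mertens X| ≤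
      (X + H) * |∑ n ∈ Finset.Ioc 0 ⌊X + H⌋₊, (moebius n : ℝ) * (1 - n / (X + H))| +
      X * |∑ n ∈ Finset.Ioc 0 ⌊X⌋₊, (moebius n : ℝ) * (1 - n / X)| + H * (H + 1) := by
  have hmul : ∀ Y : ℝ, 0 < Y → Y * |∑ n ∈ Finset.Ioc 0 ⌊Y⌋₊, (moebius n : ℝ) * (1 - n / Y)| =
      |∑ n ∈ Finset.Ioc 0 ⌊Y⌋₊, (moebius n : ℝ) * (Y - n)| := by
    intro Y hY
    rw [← abs_of_pos hY, ← abs_mul, abs_of_pos hY, Finset.mul_sum]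
    congr 1
    refine Finset.sum_congr rfl fun n _ => ?_
    field_simp
  rw [hmul _ (by linarith), hmul _ hX]
  have hle : ⌊X⌋₊ ≤ ⌊X + H⌋₊ := Nat.floor_mono (by linarith)
  have hsplit := Finset.sum_Ioc_consecutive (fun n : ℕ => (moebius n : ℝ) * (X + H - n))
    (Nat.zero_le _) hle
  have hrest : |∑ n ∈ Finset.Ioc ⌊X⌋₊ ⌊X + H⌋₊, (moebius n : ℝ) * (X + H - n)| ≤ H * (H + 1) := by
    refine (Finset.abs_sum_le_sum_abs _ _).trans ?_
    have h1 : ∀ n ∈ Finset.Ioc ⌊X⌋₊ ⌊X + H⌋₊, |(moebius n : ℝ) * (X + H - n)| ≤ H := by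
      intro n hn
      rw [Finset.mem_Ioc] at hn
      have h2 : X < n := (Nat.floor_lt hX.le).1 hn.1
      have h3 : (n : ℝ) ≤ X + H := (Nat.le_floor_iff (by linarith)).1 hn.2
      rw [abs_mul, abs_of_nonneg (by linarith : 0 ≤ X + H - n)]
      have := abs_moebius_cast_le_one n
      nlinarith [abs_nonneg (moebius n : ℝ)]
    refine (Finset.sum_le_card_nsmul _ _ _ h1).trans ?_
    rw [Nat.card_Ioc, nsmul_eq_mul, Nat.cast_sub hle, mul_comm]
    gcongr
    linarith [Nat.floor_le (by linarith : 0 ≤ X + H), Nat.lt_floor_add_one X]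
  have hM : H * mertens X = (∑ n ∈ Finset.Ioc 0 ⌊X + H⌋₊, (moebius n : ℝ) * (X + H - n)) -
      (∑ n ∈ Finset.Ioc 0 ⌊X⌋₊, (moebius n : ℝ) * (X - n)) -
        ∑ n ∈ Finset.Ioc ⌊X⌋₊ ⌊X + H⌋₊, (moebius n : ℝ) * (X + H - n) := by
    rw [← hsplit, mertens, Finset.mul_sum, add_sub_right_comm, add_sub_cancel_right,
      ← Finset.sum_sub_distrib]
    exact Finset.sum_congr rfl fun n _ => by ring
  rw [← abs_of_pos hH, ← abs_mul, abs_of_pos hH, hM]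
  exact (abs_sub _ _).trans (add_le_add (abs_sub _ _) hrest)

theorem exists_abs_mertens_le : ∃ c C x₀ : ℝ, 0 < c ∧ c ≤ 1 ∧ 0 < C ∧ ∀ X : ℝ, x₀ ≤ X →
    |mertens X| ≤ C * X * Real.exp (-(c * vkExponent X)) := by
  obtain ⟨c, C, x₀, hc, hc1, hC, H⟩ := exists_abs_sum_moebius_smooth_le_exp
  have hev := (Filter.eventually_ge_atTop (max x₀ 1)).and
    (tendsto_log_log_atTop.eventually_ge_atTop 1)
  obtain ⟨x₁, hx₁⟩ := Filter.eventually_atTop.1 hev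
  refine ⟨c / 2, 5 * C + 2, x₁, by positivity, by linarith, by positivity, fun X hX => ?_⟩
  obtain ⟨hm, hll⟩ := hx₁ X hX
  have hX1 : 1 ≤ X := (le_max_right _ _).trans hm
  have hX₀ : x₀ ≤ X := (le_max_left _ _).trans hm
  have hVL := vkExponent_le_log hX1 hll
  have hV1 := one_le_vkExponent hX1 hll
  set V := vkExponent X with hV
  set e := Real.exp (-(c / 2 * V)) with he
  have he0 : 0 < e := Real.exp_pos _
  have he1 : e ≤ 1 := Real.exp_le_one_iff.2 (by nlinarith)
  have hee : Real.exp (-(c * V)) = e * e := by rw [he, ← Real.exp_add]; ring_nf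
  have hH0 : 0 < X * e := by positivity
  have hXe : 1 ≤ X * e := by
    rw [he, ← Real.exp_log (by linarith : 0 < X), ← Real.exp_add]
    apply Real.one_le_exp
    nlinarith
  have h1 := H X hX₀
  have h2 := H (X + X * e) (by linarith)
  rw [← hV, hee] at h1
  have h3 : Real.exp (-(c * vkExponent (X + X * e))) ≤ e * e := by
    rw [← hee, Real.exp_le_exp]
    have := vkExponent_mono hX1 hll (by linarith : X ≤ X + X * e)
    nlinarith
  have h4 : X + X * e ≤ 2 * X := by nlinarith
  have hkey := mul_abs_mertens_le (by linarith : 0 < X) hH0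
  have hb2 : (X + X * e) * |∑ n ∈ Finset.Ioc 0 ⌊X + X * e⌋₊,
      (moebius n : ℝ) * (1 - n / (X + X * e))| ≤ (2 * X) * (C * (2 * X) * (e * e)) := by
    refine mul_le_mul h4 (h2.trans ?_) (abs_nonneg _) (by positivity)
    gcongr
  have hb1 : X * |∑ n ∈ Finset.Ioc 0 ⌊X⌋₊, (moebius n : ℝ) * (1 - n / X)| ≤
      X * (C * X * (e * e)) := by gcongr
  have hb3 : X * e * (X * e + 1) ≤ X * e * (2 * (X * e)) := by gcongr; linarith
  refine le_of_mul_le_mul_left ?_ hH0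
  calc _ ≤ _ := hkey
    _ ≤ (2 * X) * (C * (2 * X) * (e * e)) + X * (C * X * (e * e)) + X * e * (2 * (X * e)) := by
      linarith
    _ = _ := by ring

end MertensBound

section SquarefreeCount
open ArithmeticFunction

theorem sq_dvd_sq_mul_iff_of_squarefree {a b d : ℕ} (hb : 0 < b) (ha : Squarefree a) :
    d ^ 2 ∣ b ^ 2 * a ↔ d ∣ b := by
  refine ⟨fun h => ?_, fun h => (pow_dvd_pow_of_dvd h 2).trans (dvd_mul_right _ _)⟩
  obtain ⟨g, d', b', hg, hcop, rfl, rfl⟩ := Nat.exists_coprime' (Nat.gcd_pos_of_pos_right d hb)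
  have h1 : d' ^ 2 ∣ b' ^ 2 * a := by
    have h2 : g ^ 2 * d' ^ 2 ∣ g ^ 2 * (b' ^ 2 * a) := by
      convert h using 1 <;> ring
    exact Nat.dvd_of_mul_dvd_mul_left (by positivity) h2
  have h2 : d' ^ 2 ∣ a := (Nat.Coprime.pow 2 2 hcop).dvd_of_dvd_mul_left h1
  have h3 : d' = 1 := Nat.isUnit_iff.1 (ha d' (by rwa [← sq]))
  rw [h3, one_mul]
  exact dvd_mul_left _ _

theorem moebius_sq_eq_sum {n K : ℕ} (hn : 0 < n) (hK : n ≤ K) :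
    moebius n ^ 2 = ∑ a ∈ (Finset.Ioc 0 K).filter (fun a => a ^ 2 ∣ n), moebius a := by
  obtain ⟨a, b, ha, hb, rfl, hsq⟩ := Nat.sq_mul_squarefree_of_pos hn
  have h1 : (Finset.Ioc 0 K).filter (fun d => d ^ 2 ∣ b ^ 2 * a) = b.divisors := by
    ext d
    rw [Finset.mem_filter, sq_dvd_sq_mul_iff_of_squarefree hb hsq, Finset.mem_Ioc, Nat.mem_divisors]
    refine ⟨fun h => ⟨h.2, hb.ne'⟩, fun h => ⟨⟨Nat.pos_of_dvd_of_pos h.1 hb, ?_⟩, h.1⟩⟩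
    calc d ≤ b := Nat.le_of_dvd hb h.1
      _ ≤ b ^ 2 := Nat.le_self_pow two_ne_zero b
      _ ≤ b ^ 2 * a := Nat.le_mul_of_pos_right _ ha
      _ ≤ K := hK
  have h2 : ∑ d ∈ b.divisors, moebius d = if b = 1 then 1 else 0 := by
    rw [← coe_mul_zeta_apply, moebius_mul_coe_zeta, one_apply]
  rw [h1, h2, moebius_sq]
  congr 1
  refine propext ⟨fun h => ?_, fun h => by simpa [h] using hsq⟩
  exact Nat.isUnit_iff.1 (h b (by rw [← sq]; exact dvd_mul_right _ _))

/-- The number of squarefree positive integers up to a real number. -/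
noncomputable def squarefreeCount (y : ℝ) : ℝ := ∑ n ∈ Finset.Ioc 0 ⌊y⌋₊, (moebius n : ℝ) ^ 2

theorem squarefreeCount_eq_sum_sum {y : ℝ} :
    squarefreeCount y = ∑ a ∈ Finset.Ioc 0 ⌊y⌋₊, ∑ b ∈ Finset.Ioc 0 ⌊y⌋₊,
      if a ^ 2 * b ≤ ⌊y⌋₊ then (moebius a : ℝ) else 0 := by
  set K := ⌊y⌋₊ with hK
  have h1 : ∀ n ∈ Finset.Ioc 0 K, (moebius n : ℝ) ^ 2 =
      ∑ a ∈ Finset.Ioc 0 K, if a ^ 2 ∣ n then (moebius a : ℝ) else 0 := by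
    intro n hn
    rw [Finset.mem_Ioc] at hn
    rw [← Finset.sum_filter]
    exact_mod_cast moebius_sq_eq_sum hn.1 hn.2
  rw [squarefreeCount, ← hK, Finset.sum_congr rfl h1, Finset.sum_comm]
  refine Finset.sum_congr rfl fun a ha => ?_
  rw [← Finset.sum_filter, ← Finset.sum_filter]
  have ha0 : 0 < a ^ 2 := pow_pos (Finset.mem_Ioc.1 ha).1 2
  refine Finset.sum_bij' (fun n _ => n / a ^ 2) (fun b _ => a ^ 2 * b) ?_ ?_ ?_ ?_ ?_
  · intro n hn
    simp only [Finset.mem_filter, Finset.mem_Ioc] at hn ⊢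
    rw [Nat.mul_div_cancel' hn.2]
    exact ⟨⟨Nat.div_pos (Nat.le_of_dvd hn.1.1 hn.2) ha0, (Nat.div_le_self _ _).trans hn.1.2⟩, hn.1.2⟩
  · intro b hb
    simp only [Finset.mem_filter, Finset.mem_Ioc] at hb ⊢
    exact ⟨⟨mul_pos ha0 hb.1.1, hb.2⟩, dvd_mul_right _ _⟩
  · intro n hn
    exact Nat.mul_div_cancel' (Finset.mem_filter.1 hn).2
  · intro b _
    exact Nat.mul_div_cancel_left _ ha0
  · intro n _
    rfl

theorem sum_mul_nonneg_of_antitone {b w : ℕ → ℝ} (hb : ∀ n, 0 ≤ ∑ i ∈ Finset.range n, b i)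
    (hw : Antitone w) (hw0 : ∀ n, 0 ≤ w n) (n : ℕ) : 0 ≤ ∑ i ∈ Finset.range n, b i * w i := by
  have h : ∀ n, (∑ i ∈ Finset.range (n + 1), b i) * w n ≤ ∑ i ∈ Finset.range (n + 1), b i * w i := by
    intro n
    induction n with
    | zero => simp
    | succ n ih =>
      rw [Finset.sum_range_succ _ (n + 1), Finset.sum_range_succ _ (n + 1), add_mul]
      have := mul_le_mul_of_nonneg_left (hw n.le_succ) (hb (n + 1))
      gcongr
      exact this.trans ih
  cases n with
  | zero => simp
  | succ n => exact (mul_nonneg (hb _) (hw0 n)).trans (h n)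

theorem abs_sum_mul_le_of_antitone {a g w : ℕ → ℝ}
    (ha : ∀ n, |∑ i ∈ Finset.range n, a i| ≤ ∑ i ∈ Finset.range n, g i)
    (hw : Antitone w) (hw0 : ∀ n, 0 ≤ w n) (n : ℕ) :
    |∑ i ∈ Finset.range n, a i * w i| ≤ ∑ i ∈ Finset.range n, g i * w i := by
  have h1 := sum_mul_nonneg_of_antitone (b := fun i => g i - a i) (fun n => by
    rw [Finset.sum_sub_distrib]; linarith [(abs_le.1 (ha n)).2]) hw hw0 n
  have h2 := sum_mul_nonneg_of_antitone (b := fun i => g i + a i) (fun n => by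
    rw [Finset.sum_add_distrib]; linarith [(abs_le.1 (ha n)).1]) hw hw0 n
  simp only [sub_mul, add_mul, Finset.sum_sub_distrib, Finset.sum_add_distrib] at h1 h2
  exact abs_le.2 ⟨by linarith, by linarith⟩

theorem sum_Ioc_add_eq_sum_range (f : ℕ → ℝ) (N k : ℕ) :
    ∑ i ∈ Finset.Ioc N (N + k), f i = ∑ i ∈ Finset.range k, f (N + 1 + i) := by
  have h1 : Finset.Ioc N (N + k) = Finset.Ico (N + 1) (N + 1 + k) := by
    ext i
    simp only [Finset.mem_Ioc, Finset.mem_Ico]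
    lia
  rw [h1, Finset.sum_Ico_eq_sum_range, add_tsub_cancel_left]

theorem tendsto_sum_Ioc {f : ℕ → ℝ} (hf : Summable f) (h0 : f 0 = 0) (N : ℕ) :
    Filter.Tendsto (fun M => ∑ i ∈ Finset.Ioc N M, f i) Filter.atTop
      (nhds (∑' i, f i - ∑ i ∈ Finset.Ioc 0 N, f i)) := by
  have h1 := (hf.hasSum.tendsto_sum_nat.comp (Filter.tendsto_add_atTop_nat 1)).sub_const
    (∑ i ∈ Finset.Ioc 0 N, f i)
  refine h1.congr' ?_
  filter_upwards [Filter.eventually_ge_atTop N] with M hMN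
  have h2 := sum_Ioc_add_eq_sum_range f 0 M
  rw [zero_add] at h2
  rw [Function.comp_apply, Finset.sum_range_succ', h0, add_zero, sub_eq_iff_eq_add, add_comm,
    Finset.sum_Ioc_consecutive _ (Nat.zero_le N) hMN, h2]
  exact Finset.sum_congr rfl fun i _ => by rw [zero_add, add_comm]

/-- Summation by parts against a weight antitone beyond `N`, for partial sums of linear growth. -/
theorem abs_sum_Ioc_mul_le {a w : ℕ → ℝ} {N : ℕ} {K : ℝ} (hK : 0 ≤ K)
    (ha : ∀ n, N < n → |∑ i ∈ Finset.Ioc N n, a i| ≤ K * n)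
    (hw : ∀ m n, N < m → m ≤ n → w n ≤ w m) (hw0 : ∀ n, N < n → 0 ≤ w n) (M : ℕ) :
    |∑ i ∈ Finset.Ioc N M, a i * w i| ≤
      K * (N * w (N + 1) + ∑ i ∈ Finset.Ioc N M, w i) := by
  rcases le_total M N with h | h
  · rw [Finset.Ioc_eq_empty (by lia)]
    simp only [Finset.sum_empty, abs_zero, add_zero]
    have := hw0 (N + 1) N.lt_succ_self
    positivity
  obtain ⟨k, rfl⟩ := Nat.exists_eq_add_of_le h
  rw [sum_Ioc_add_eq_sum_range, sum_Ioc_add_eq_sum_range]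
  have hmain := abs_sum_mul_le_of_antitone (a := fun i => a (N + 1 + i))
    (g := fun i => K + if i = 0 then K * N else 0) (w := fun i => w (N + 1 + i)) (fun n => ?_)
    (fun i j hij => hw _ _ (by lia) (by lia)) (fun i => hw0 _ (by lia)) k
  · refine hmain.trans ?_
    simp only [add_mul, Finset.sum_add_distrib, ite_mul, zero_mul, Finset.sum_ite_eq',
      Finset.mem_range, mul_add, Finset.mul_sum, add_zero]
    rw [add_comm]
    gcongr
    have := hw0 (N + 1) N.lt_succ_self
    split_ifs
    · rw [mul_assoc]
    · positivity
  · rcases Nat.eq_zero_or_pos n with rfl | hn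
    · simp
    · rw [← sum_Ioc_add_eq_sum_range]
      refine (ha (N + n) (by lia)).trans (le_of_eq ?_)
      simp [Finset.sum_add_distrib, hn]
      ring

/-- The density of the squarefree numbers. -/
noncomputable def squarefreeDensity : ℝ := ∑' a : ℕ, (moebius a : ℝ) * ((a : ℝ) ^ 2)⁻¹

theorem summable_norm_moebius_mul_inv_sq :
    Summable fun a : ℕ => ‖(moebius a : ℝ) * ((a : ℝ) ^ 2)⁻¹‖ := by
  refine Summable.of_nonneg_of_le (fun _ => norm_nonneg _) (fun a => ?_)
    (Real.summable_nat_pow_inv.2 one_lt_two)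
  rw [norm_mul, Real.norm_eq_abs, Real.norm_of_nonneg (by positivity)]
  exact mul_le_of_le_one_left (by positivity) (abs_moebius_cast_le_one a)

theorem abs_density_sub_sum_le {D η : ℝ} (hD : 1 ≤ D) (hη : 0 ≤ η)
    (hM : ∀ z, D ≤ z → |mertens z| ≤ η * z) :
    |squarefreeDensity - ∑ a ∈ Finset.Ioc 0 ⌊D⌋₊, (moebius a : ℝ) * ((a : ℝ) ^ 2)⁻¹| ≤
      8 * η / D := by
  set N := ⌊D⌋₊ with hN
  have hN1 : 1 ≤ N := Nat.le_floor (by simpa using hD)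
  have hN0 : (0 : ℝ) < N := by exact_mod_cast hN1
  have hDN : D ≤ 2 * N := by
    have h1 : (1 : ℝ) ≤ N := by exact_mod_cast hN1
    linarith [Nat.lt_floor_add_one D]
  have hpart : ∀ n, N < n → |∑ i ∈ Finset.Ioc N n, (moebius i : ℝ)| ≤ 2 * η * n := by
    intro n hn
    have hnD : D ≤ n := (Nat.lt_floor_add_one D).le.trans (by exact_mod_cast hn)
    have h1 := hM n hnD
    have h2 := hM D le_rfl
    have h3 := Finset.sum_Ioc_consecutive (fun i : ℕ => (moebius i : ℝ)) (Nat.zero_le N) hn.le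
    rw [mertens, Nat.floor_natCast] at h1
    rw [mertens, ← hN] at h2
    have h4 : η * D ≤ η * n := by gcongr
    rw [abs_le] at *
    constructor <;> linarith
  have htend : Filter.Tendsto (fun M : ℕ => ∑ a ∈ Finset.Ioc N M, (moebius a : ℝ) * ((a : ℝ) ^ 2)⁻¹)
      Filter.atTop (nhds (squarefreeDensity -
        ∑ a ∈ Finset.Ioc 0 N, (moebius a : ℝ) * ((a : ℝ) ^ 2)⁻¹)) :=
    tendsto_sum_Ioc summable_norm_moebius_mul_inv_sq.of_norm (by simp) N
  refine le_of_tendsto htend.abs (Filter.eventually_atTop.2 ⟨N, fun M hMN => ?_⟩)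
  refine (abs_sum_Ioc_mul_le (w := fun a : ℕ => ((a : ℝ) ^ 2)⁻¹) (by positivity) hpart
    (fun m n h1 h2 => ?_) (fun n _ => by positivity) M).trans ?_
  · have : (0 : ℝ) < m := by exact_mod_cast (Nat.zero_le N).trans_lt h1
    gcongr
  · have h1 := sum_Ioc_inv_sq_le_sub (α := ℝ) (by lia) hMN
    have h2 : (N : ℝ) * (((N + 1 : ℕ) : ℝ) ^ 2)⁻¹ ≤ (N : ℝ)⁻¹ := by
      rw [← div_eq_mul_inv, div_le_iff₀ (by positivity), inv_mul_eq_div, le_div_iff₀ hN0]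
      push_cast
      nlinarith
    have h3 : (0 : ℝ) ≤ (M : ℝ)⁻¹ := by positivity
    have h4 : (N : ℝ)⁻¹ ≤ 2 / D := by
      rw [inv_le_comm₀ hN0 (by positivity), inv_div]
      linarith
    calc 2 * η * ((N : ℝ) * (((N + 1 : ℕ) : ℝ) ^ 2)⁻¹ + ∑ i ∈ Finset.Ioc N M, ((i : ℝ) ^ 2)⁻¹)
        ≤ 2 * η * (2 / D + 2 / D) := by gcongr <;> linarith
      _ = _ := by ring

theorem sum_ite_sq_mul_le {y : ℝ} {N b : ℕ} (hy : 0 ≤ y) (hb : 0 < b) :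
    ∑ a ∈ Finset.Ioc N ⌊y⌋₊, (if a ^ 2 * b ≤ ⌊y⌋₊ then (moebius a : ℝ) else 0) =
      ∑ a ∈ Finset.Ioc N ⌊√(y / b)⌋₊, (moebius a : ℝ) := by
  have hb0 : (0 : ℝ) < b := by exact_mod_cast hb
  rw [← Finset.sum_filter]
  refine Finset.sum_congr ?_ fun _ _ => rfl
  ext a
  have h1 : a ^ 2 * b ≤ ⌊y⌋₊ ↔ a ≤ ⌊√(y / b)⌋₊ := by
    rw [Nat.le_floor_iff hy, Nat.le_floor_iff (Real.sqrt_nonneg _),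
      Real.le_sqrt (Nat.cast_nonneg a) (by positivity), le_div_iff₀ hb0]
    push_cast
    rfl
  rw [Finset.mem_filter, Finset.mem_Ioc, Finset.mem_Ioc, h1]
  refine ⟨fun h => ⟨h.1.1, h.2⟩, fun h => ⟨⟨h.1, ?_⟩, h.2⟩⟩
  calc a ≤ a ^ 2 := Nat.le_self_pow two_ne_zero a
    _ ≤ a ^ 2 * b := Nat.le_mul_of_pos_right _ hb
    _ ≤ ⌊y⌋₊ := h1.2 h.2

theorem abs_sum_ite_sub_le {y : ℝ} {a : ℕ} (hy : 0 ≤ y) (ha : 0 < a) :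
    |(∑ b ∈ Finset.Ioc 0 ⌊y⌋₊, if a ^ 2 * b ≤ ⌊y⌋₊ then (moebius a : ℝ) else 0) -
      y * ((moebius a : ℝ) * ((a : ℝ) ^ 2)⁻¹)| ≤ 1 := by
  have ha0 : 0 < a ^ 2 := pow_pos ha 2
  have h1 : (Finset.Ioc 0 ⌊y⌋₊).filter (fun b => a ^ 2 * b ≤ ⌊y⌋₊) =
      Finset.Ioc 0 (⌊y⌋₊ / a ^ 2) := by
    ext b
    rw [Finset.mem_filter, Finset.mem_Ioc, Finset.mem_Ioc, Nat.le_div_iff_mul_le ha0, mul_comm b]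
    exact ⟨fun h => ⟨h.1.1, h.2⟩, fun h => ⟨⟨h.1, (Nat.le_mul_of_pos_left _ ha0).trans h.2⟩, h.2⟩⟩
  rw [← Finset.sum_filter, h1, Finset.sum_const, Nat.card_Ioc, tsub_zero, nsmul_eq_mul,
    ← Nat.floor_div_natCast]
  push_cast
  have h2 : (⌊y / (a : ℝ) ^ 2⌋₊ : ℝ) * (moebius a : ℝ) - y * ((moebius a : ℝ) * ((a : ℝ) ^ 2)⁻¹) =
      (moebius a : ℝ) * ((⌊y / (a : ℝ) ^ 2⌋₊ : ℝ) - y / (a : ℝ) ^ 2) := by ring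
  rw [h2, abs_mul]
  refine mul_le_one₀ (abs_moebius_cast_le_one a) (abs_nonneg _) ?_
  have h3 := Nat.floor_le (by positivity : 0 ≤ y / (a : ℝ) ^ 2)
  have h4 := Nat.lt_floor_add_one (y / (a : ℝ) ^ 2)
  rw [abs_le]
  constructor <;> linarith

theorem abs_squarefreeCount_sub_le {y D η : ℝ} (hD : 1 ≤ D) (hDy : D ^ 2 ≤ y) (hη : 0 ≤ η)
    (hM : ∀ z, D ≤ z → |mertens z| ≤ η * z) :
    |squarefreeCount y - squarefreeDensity * y| ≤
      D + 8 * η * y / D + 2 * η * y * √y / D ^ 2 := by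
  have hD0 : 0 < D := by linarith
  have hy1 : 1 ≤ y := le_trans (by nlinarith) hDy
  have hy0 : 0 ≤ y := by linarith
  set N := ⌊D⌋₊ with hN
  set K := ⌊y⌋₊ with hK
  have hNK : N ≤ K := Nat.floor_mono (by nlinarith)
  have hdens := abs_density_sub_sum_le hD hη hM
  rw [← hN] at hdens
  have hsmall : |(∑ a ∈ Finset.Ioc 0 N, ∑ b ∈ Finset.Ioc 0 K,
      if a ^ 2 * b ≤ K then (moebius a : ℝ) else 0) -
        y * ∑ a ∈ Finset.Ioc 0 N, (moebius a : ℝ) * ((a : ℝ) ^ 2)⁻¹| ≤ D := by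
    rw [Finset.mul_sum, ← Finset.sum_sub_distrib]
    refine (Finset.abs_sum_le_sum_abs _ _).trans ((Finset.sum_le_card_nsmul _ _ 1 fun a ha => 
      abs_sum_ite_sub_le hy0 (Finset.mem_Ioc.1 ha).1).trans ?_)
    rw [Nat.card_Ioc, tsub_zero, nsmul_eq_mul, mul_one]
    exact Nat.floor_le hD0.le
  have hlarge : |∑ a ∈ Finset.Ioc N K, ∑ b ∈ Finset.Ioc 0 K,
      if a ^ 2 * b ≤ K then (moebius a : ℝ) else 0| ≤ 2 * η * y * √y / D ^ 2 := by
    rw [Finset.sum_comm]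
    have h1 : ∀ b ∈ Finset.Ioc 0 K, |∑ a ∈ Finset.Ioc N K,
        if a ^ 2 * b ≤ K then (moebius a : ℝ) else 0| ≤
          if b ∈ Finset.Ioc 0 ⌊y / D ^ 2⌋₊ then 2 * η * √y else 0 := by
      intro b hb
      have hb := (Finset.mem_Ioc.1 hb).1
      have hb0 : (0 : ℝ) < b := by exact_mod_cast hb
      have hb1 : (1 : ℝ) ≤ b := by exact_mod_cast hb
      rw [sum_ite_sq_mul_le hy0 hb]
      have h2 : b ∈ Finset.Ioc 0 ⌊y / D ^ 2⌋₊ ↔ D ≤ √(y / b) := by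
        rw [Finset.mem_Ioc, Nat.le_floor_iff (by positivity), Real.le_sqrt hD0.le (by positivity),
          le_div_iff₀ (by positivity), le_div_iff₀ hb0, mul_comm]
        exact and_iff_right hb
      split_ifs with h3
      · rw [h2] at h3
        have h4 := Finset.sum_Ioc_consecutive (fun a : ℕ => (moebius a : ℝ)) (Nat.zero_le N)
          (Nat.floor_mono h3)
        have h5 := hM _ h3
        have h6 := hM D le_rfl
        rw [mertens, ← h4] at h5
        rw [mertens, ← hN] at h6
        have h7 : √(y / b) ≤ √y := Real.sqrt_le_sqrt (div_le_self hy0 hb1)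
        have h8 : η * √(y / b) ≤ η * √y := by gcongr
        have h9 : η * D ≤ η * √y := by gcongr; linarith
        rw [abs_le] at *
        constructor <;> linarith
      · rw [h2, not_le] at h3
        rw [Finset.Ioc_eq_empty (not_lt.2 (Nat.floor_mono h3.le)), Finset.sum_empty, abs_zero]
    refine (Finset.abs_sum_le_sum_abs _ _).trans ((Finset.sum_le_sum h1).trans ?_)
    rw [← Finset.sum_filter, Finset.sum_const, nsmul_eq_mul]
    have h2 : (((Finset.Ioc 0 K).filter (fun b => b ∈ Finset.Ioc 0 ⌊y / D ^ 2⌋₊)).card : ℝ) ≤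
        y / D ^ 2 := by
      refine le_trans ?_ (Nat.floor_le (by positivity : 0 ≤ y / D ^ 2))
      rw [Finset.filter_mem_eq_inter]
      refine (Nat.cast_le.2 (Finset.card_le_card Finset.inter_subset_right)).trans ?_
      rw [Nat.card_Ioc, tsub_zero]
    calc _ ≤ y / D ^ 2 * (2 * η * √y) := by gcongr
      _ = _ := by ring
  have hsplit : squarefreeCount y = _ := squarefreeCount_eq_sum_sum
  rw [← Finset.sum_Ioc_consecutive _ (Nat.zero_le N) hNK] at hsplit
  have hd : |squarefreeDensity * y - y * ∑ a ∈ Finset.Ioc 0 N, (moebius a : ℝ) * ((a : ℝ) ^ 2)⁻¹| ≤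
      8 * η * y / D := by
    rw [mul_comm squarefreeDensity, ← mul_sub, abs_mul, abs_of_nonneg hy0]
    calc _ ≤ y * (8 * η / D) := by gcongr
      _ = _ := by ring
  rw [hsplit]
  rw [abs_le] at *
  constructor <;> linarith

theorem abs_mertens_le {z : ℝ} (hz : 0 ≤ z) : |mertens z| ≤ z := by
  refine (Finset.abs_sum_le_sum_abs _ _).trans ((Finset.sum_le_card_nsmul _ _ 1 fun a _ =>
    abs_moebius_cast_le_one a).trans ?_)
  rw [Nat.card_Ioc, tsub_zero, nsmul_eq_mul, mul_one]
  exact Nat.floor_le hz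

theorem exists_abs_squarefreeCount_sub_le : ∃ C : ℝ, 0 < C ∧ ∀ y : ℝ, 0 ≤ y →
    |squarefreeCount y - squarefreeDensity * y| ≤ C * √y := by
  refine ⟨11 + |squarefreeDensity|, by positivity, fun y hy => ?_⟩
  rcases le_or_gt 1 y with h1 | h1
  · have hs : 0 < √y := Real.sqrt_pos.2 (by linarith)
    have h2 := abs_squarefreeCount_sub_le (D := √y) (η := 1) (Real.one_le_sqrt.2 h1)
      (Real.sq_sqrt hy).le zero_le_one
      fun z hz => by rw [one_mul]; exact abs_mertens_le (hs.le.trans hz)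
    have h3 : √y + 8 * 1 * y / √y + 2 * 1 * y * √y / √y ^ 2 = 11 * √y := by
      rw [Real.sq_sqrt hy, mul_div_assoc, Real.div_sqrt]
      field_simp
      ring
    rw [h3] at h2
    have := mul_nonneg (abs_nonneg squarefreeDensity) hs.le
    linarith
  · rw [squarefreeCount, Nat.floor_eq_zero.2 h1, Finset.Ioc_self, Finset.sum_empty, zero_sub,
      abs_neg, abs_mul, abs_of_nonneg hy]
    have h2 : y ≤ √y := Real.le_sqrt_of_sq_le (by nlinarith)
    have := mul_le_mul_of_nonneg_left h2 (abs_nonneg squarefreeDensity)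
    linarith [Real.sqrt_nonneg y]

theorem exists_abs_squarefreeCount_sub_le_exp : ∃ c C x₀ : ℝ, 0 < c ∧ c ≤ 1 ∧ 0 < C ∧
    ∀ y : ℝ, x₀ ≤ y → |squarefreeCount y - squarefreeDensity * y| ≤
      C * √y * Real.exp (-(c * vkExponent y)) := by
  obtain ⟨c, C, x₁, hc, hc1, hC, H⟩ := exists_abs_mertens_le
  have hev := (Filter.eventually_ge_atTop (1 : ℝ)).and
    ((tendsto_log_log_atTop.eventually_ge_atTop 1).and
      (((Real.tendsto_log_atTop.comp (Real.tendsto_log_atTop.atTop_div_const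
        (by norm_num : (0 : ℝ) < 8))).eventually_ge_atTop 1).and
        ((Real.tendsto_log_atTop.eventually_ge_atTop 8).and
          ((tendsto_rpow_atTop (by norm_num : (0 : ℝ) < 1 / 8)).eventually_ge_atTop x₁))))
  obtain ⟨x₀, hx₀⟩ := Filter.eventually_atTop.1 hev
  refine ⟨c / 32, 1 + 10 * C, x₀, by positivity, by linarith, by positivity, fun y hy => ?_⟩
  obtain ⟨hy1, hll, hl8, hL8, hyx⟩ := hx₀ y hy
  simp only [Function.comp_apply] at hl8
  have hy0 : 0 < y := by linarith
  have hVL := vkExponent_le_log hy1 hll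
  have hV1 := one_le_vkExponent hy1 hll
  have hcomp := fun z => vkExponent_le_of_rpow_le (y := z) hy1 hl8 hL8
  set V := vkExponent y
  set e := Real.exp (-(c / 32 * V)) with he
  have he0 : 0 < e := Real.exp_pos _
  have he1 : e ≤ 1 := Real.exp_le_one_iff.2 (by nlinarith)
  have he4 : Real.exp (-(c / 8 * V)) = e ^ 4 := by
    rw [he, ← Real.exp_nat_mul]; ring_nf
  have hs : √y = Real.exp (Real.log y / 2) := by
    rw [Real.exp_half, Real.exp_log hy0]
  have hs0 : 0 < √y := Real.sqrt_pos.2 hy0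
  have hD : y ^ (1 / 8 : ℝ) ≤ √y * e := by
    rw [hs, he, ← Real.exp_add, Real.rpow_def_of_pos hy0, Real.exp_le_exp]
    nlinarith
  have hD1 : 1 ≤ √y * e := (Real.one_le_rpow hy1 (by norm_num)).trans hD
  have h1 := abs_squarefreeCount_sub_le (y := y) (D := √y * e) (η := C * e ^ 4) hD1 (by
    rw [mul_pow, Real.sq_sqrt hy0.le]
    exact mul_le_of_le_one_right hy0.le (pow_le_one₀ he0.le he1)) (by positivity) (by
    intro z hz
    refine (H z (hyx.trans (hD.trans hz))).trans ?_
    have h2 := hcomp z (hD.trans hz)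
    have h3 : Real.exp (-(c * vkExponent z)) ≤ e ^ 4 := by
      rw [← he4, Real.exp_le_exp]
      nlinarith
    have : 0 < z := by linarith
    calc _ ≤ C * z * e ^ 4 := by gcongr
      _ = _ := by ring)
  refine h1.trans ?_
  have hyy : y = √y * √y := (Real.mul_self_sqrt hy0.le).symm
  have e1 : 8 * (C * e ^ 4) * y / (√y * e) = 8 * C * √y * e ^ 3 := by
    rw [div_eq_iff (by positivity)]
    nth_rw 1 [hyy]
    ring
  have e2 : 2 * (C * e ^ 4) * y * √y / (√y * e) ^ 2 = 2 * C * √y * e ^ 2 := by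
    rw [div_eq_iff (by positivity)]
    nth_rw 1 [hyy]
    ring
  rw [e1, e2]
  have e3 : e ^ 3 ≤ e := pow_le_of_le_one he0.le he1 (by norm_num)
  have e4 : e ^ 2 ≤ e := pow_le_of_le_one he0.le he1 (by norm_num)
  calc _ ≤ √y * e + 8 * C * √y * e + 2 * C * √y * e := by gcongr
    _ = _ := by ring

end SquarefreeCount

section TotientRatio
open ArithmeticFunction

/-- The arithmetic function `μ²(n) n / φ(n)`. -/
noncomputable def squarefreeTotientRatio : ArithmeticFunction ℝ :=
  ⟨fun n => (moebius n : ℝ) ^ 2 * (n / Nat.totient n), by simp⟩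

/-- The Dirichlet quotient of `μ²(n) n / φ(n)` by `μ²(n)`. -/
noncomputable def totientCorrection : ArithmeticFunction ℝ :=
  pmul (liouville : ArithmeticFunction ℝ) (prodPrimeFactors fun p => -(1 / ((p : ℝ) - 1)))

/-- The indicator function of the squarefree numbers. -/
noncomputable def squarefreeIndicator : ArithmeticFunction ℝ :=
  ppow (moebius : ArithmeticFunction ℝ) 2

theorem squarefreeIndicator_apply (n : ℕ) : squarefreeIndicator n = (moebius n : ℝ) ^ 2 := by
  simp [squarefreeIndicator, ppow_apply]

theorem squarefreeTotientRatio_apply (n : ℕ) :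
    squarefreeTotientRatio n = (moebius n : ℝ) ^ 2 * (n / Nat.totient n) := rfl

theorem isMultiplicative_squarefreeIndicator : squarefreeIndicator.IsMultiplicative :=
  isMultiplicative_moebius.intCast.ppow

theorem isMultiplicative_totientCorrection : totientCorrection.IsMultiplicative :=
  isMultiplicative_liouville.intCast.pmul (IsMultiplicative.prodPrimeFactors _)

theorem isMultiplicative_squarefreeTotientRatio : squarefreeTotientRatio.IsMultiplicative := by
  refine ⟨by simp [squarefreeTotientRatio_apply], fun {m n} h => ?_⟩
  rw [squarefreeTotientRatio_apply, squarefreeTotientRatio_apply, squarefreeTotientRatio_apply,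
    isMultiplicative_moebius.map_mul_of_coprime h, Nat.totient_mul h]
  push_cast
  rw [mul_div_mul_comm]
  ring

theorem totientCorrection_prime_pow {p k : ℕ} (hp : p.Prime) :
    totientCorrection (p ^ (k + 1)) = (-1) ^ k * (1 / ((p : ℝ) - 1)) := by
  have h1 : p ^ (k + 1) ≠ 0 := pow_ne_zero _ hp.ne_zero
  rw [totientCorrection, pmul_apply, prodPrimeFactors_apply h1,
    Nat.primeFactors_prime_pow k.succ_ne_zero hp, Finset.prod_singleton, intCoe_apply,
    liouville_apply h1, cardFactors_apply_prime_pow hp]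
  push_cast
  ring

theorem totientCorrection_one : totientCorrection 1 = 1 := isMultiplicative_totientCorrection.1

theorem moebius_sq_prime_pow {p k : ℕ} (hp : p.Prime) :
    (moebius (p ^ (k + 2)) : ℝ) = 0 := by
  rw [moebius_apply_prime_pow hp (by lia)]
  simp

theorem squarefreeIndicator_mul_totientCorrection :
    squarefreeIndicator * totientCorrection = squarefreeTotientRatio := by
  rw [IsMultiplicative.eq_iff_eq_on_prime_powers _
    (isMultiplicative_squarefreeIndicator.mul isMultiplicative_totientCorrection) _
    isMultiplicative_squarefreeTotientRatio]
  intro p i hp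
  have hp1 : (p : ℝ) - 1 ≠ 0 := by
    have : (1 : ℝ) < p := by exact_mod_cast hp.one_lt
    linarith
  rw [mul_apply, Nat.sum_divisorsAntidiagonal (fun a b => squarefreeIndicator a *
    totientCorrection b), Nat.sum_divisors_prime_pow hp]
  rcases i with _ | _ | i
  · simp [squarefreeTotientRatio_apply, squarefreeIndicator_apply, totientCorrection_one]
  · have h1 : totientCorrection p = 1 / ((p : ℝ) - 1) := by
      simpa using totientCorrection_prime_pow (k := 0) hp
    rw [Finset.sum_range_succ, Finset.sum_range_one]
    simp only [zero_add, pow_zero, pow_one, Nat.div_one, Nat.div_self hp.pos]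
    rw [squarefreeTotientRatio_apply, squarefreeIndicator_apply, squarefreeIndicator_apply, h1,
      totientCorrection_one, moebius_apply_one, moebius_apply_prime hp, Nat.totient_prime hp,
      Nat.cast_sub hp.one_le]
    push_cast
    field_simp
    ring
  · rw [Finset.sum_range_succ', Finset.sum_range_succ', Finset.sum_eq_zero]
    · have e1 : p ^ (i + 1 + 1) / p ^ (0 + 1) = p ^ (i + 1) := by
        rw [Nat.pow_div (by lia) hp.pos]; rfl
      rw [e1, zero_add, pow_one, pow_zero, Nat.div_one, totientCorrection_prime_pow hp,
        totientCorrection_prime_pow hp, squarefreeTotientRatio_apply, squarefreeIndicator_apply,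
        squarefreeIndicator_apply, moebius_sq_prime_pow hp, moebius_apply_one,
        moebius_apply_prime hp]
      push_cast
      ring
    · intro k _
      rw [squarefreeIndicator_apply, moebius_sq_prime_pow hp]
      ring

theorem hasSum_totientCorrection_prime_pow {p : ℕ} (hp : p.Prime) :
    HasSum (fun k => totientCorrection (p ^ k) * ((p ^ k : ℕ) : ℝ)⁻¹) ((1 - ((p : ℝ) ^ 2)⁻¹)⁻¹) := by
  have hp1 : (1 : ℝ) < p := by exact_mod_cast hp.one_lt
  have hp2 : (p : ℝ) - 1 ≠ 0 := by linarith
  have hg := (hasSum_geometric_of_abs_lt_one (r := -(p : ℝ)⁻¹) (by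
    rw [abs_neg, abs_of_pos (by positivity)]; exact inv_lt_one_of_one_lt₀ hp1)).mul_left
      (1 / ((p : ℝ) - 1) * (p : ℝ)⁻¹)
  rw [← hasSum_nat_add_iff' 1]
  convert hg using 1
  · rfl
  · funext k
    rw [totientCorrection_prime_pow hp]
    push_cast
    rw [neg_pow (p : ℝ)⁻¹, pow_succ, inv_pow, mul_inv]
    ring
  · have h3 : (p : ℝ) ^ 2 - 1 ≠ 0 := by nlinarith
    have h4 : (p : ℝ) + 1 ≠ 0 := by linarith
    have h5 : 1 - ((p : ℝ) ^ 2)⁻¹ = ((p : ℝ) - 1) * (p + 1) / (p : ℝ) ^ 2 := by field_simp; ring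
    have h6 : 1 - -(p : ℝ)⁻¹ = ((p : ℝ) + 1) / p := by field_simp; ring
    rw [Finset.sum_range_one, pow_zero, totientCorrection_one, h5, h6]
    push_cast
    field_simp
    ring

theorem tsum_abs_totientCorrection_prime_pow {p : ℕ} (hp : p.Prime) :
    HasSum (fun k => |totientCorrection (p ^ k)| * ((p ^ k : ℕ) : ℝ) ^ (-(1 / 4) : ℝ))
      (1 + 1 / ((p : ℝ) - 1) * ((p : ℝ) ^ (-(1 / 4) : ℝ) * (1 - (p : ℝ) ^ (-(1 / 4) : ℝ))⁻¹)) := by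
  have hp1 : (1 : ℝ) < p := by exact_mod_cast hp.one_lt
  set r := (p : ℝ) ^ (-(1 / 4) : ℝ) with hr
  have hr0 : 0 ≤ r := by positivity
  have hr1 : r < 1 := Real.rpow_lt_one_of_one_lt_of_neg hp1 (by norm_num)
  have hg := (hasSum_geometric_of_lt_one hr0 hr1).mul_left (1 / ((p : ℝ) - 1) * r)
  rw [← hasSum_nat_add_iff' 1]
  convert hg using 1
  · rfl
  · funext k
    have h1 : ((p ^ (k + 1) : ℕ) : ℝ) ^ (-(1 / 4) : ℝ) = r ^ (k + 1) := by
      push_cast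
      rw [hr, ← Real.rpow_natCast, ← Real.rpow_natCast, ← Real.rpow_mul (by positivity),
        ← Real.rpow_mul (by positivity), mul_comm]
    rw [totientCorrection_prime_pow hp, h1, abs_mul, abs_pow, abs_neg, abs_one, one_pow, one_mul,
      abs_of_pos (div_pos one_pos (by linarith)), pow_succ]
    ring
  · rw [Finset.sum_range_one, pow_zero, totientCorrection_one]
    simp
    ring

theorem summable_abs_totientCorrection_mul :
    Summable fun n : ℕ => |totientCorrection n| * (n : ℝ) ^ (-(1 / 4) : ℝ) := by
  set g := fun n : ℕ => |totientCorrection n| * (n : ℝ) ^ (-(1 / 4) : ℝ) with hg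
  have hg0 : ∀ n, 0 ≤ g n := fun n => by positivity
  have hg1 : g 1 = 1 := by simp [hg, totientCorrection_one]
  have hgm : ∀ {m n : ℕ}, Nat.Coprime m n → g (m * n) = g m * g n := by
    intro m n h
    simp only [hg]
    rw [isMultiplicative_totientCorrection.map_mul_of_coprime h, abs_mul, Nat.cast_mul,
      Real.mul_rpow (Nat.cast_nonneg _) (Nat.cast_nonneg _)]
    ring
  have hgs : ∀ {p : ℕ}, p.Prime → Summable fun n => ‖g (p ^ n)‖ := fun hp =>
    (tsum_abs_totientCorrection_prime_pow hp).summable.norm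
  have hz : Summable fun n : ℕ => (n : ℝ) ^ (-(5 / 4) : ℝ) :=
    Real.summable_nat_rpow.2 (by norm_num)
  have hloc : ∀ p : ℕ, p.Prime → ∑' n, g (p ^ n) ≤ Real.exp (14 * (p : ℝ) ^ (-(5 / 4) : ℝ)) := by
    intro p hp
    have hp2 : (2 : ℝ) ≤ p := by exact_mod_cast hp.two_le
    have hp0 : (0 : ℝ) < p := by linarith
    rw [(tsum_abs_totientCorrection_prime_pow hp).tsum_eq]
    refine le_trans ?_ (Real.add_one_le_exp _)
    rw [add_comm]
    refine add_le_add ?_ le_rfl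
    have h1 : (p : ℝ) ^ (-(1 / 4) : ℝ) ≤ 6 / 7 := by
      calc (p : ℝ) ^ (-(1 / 4) : ℝ) ≤ (2 : ℝ) ^ (-(1 / 4) : ℝ) :=
            Real.rpow_le_rpow_of_nonpos two_pos hp2 (by norm_num)
        _ ≤ ((7 / 6 : ℝ) ^ (4 : ℝ)) ^ (-(1 / 4) : ℝ) :=
            Real.rpow_le_rpow_of_nonpos (by positivity) (by norm_num) (by norm_num)
        _ = 6 / 7 := by
            rw [← Real.rpow_mul (by norm_num)]
            norm_num [Real.rpow_neg_one]
    have h2 : (1 - (p : ℝ) ^ (-(1 / 4) : ℝ))⁻¹ ≤ 7 := by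
      rw [inv_le_comm₀ (by linarith) (by norm_num)]
      linarith
    have h3 : 1 / ((p : ℝ) - 1) ≤ 2 * (p : ℝ)⁻¹ := by
      rw [div_le_iff₀ (by linarith)]
      field_simp
      linarith
    have h4 : (p : ℝ) ^ (-(5 / 4) : ℝ) = (p : ℝ)⁻¹ * (p : ℝ) ^ (-(1 / 4) : ℝ) := by
      rw [← Real.rpow_neg_one, ← Real.rpow_add hp0]
      norm_num
    rw [h4]
    have h5 : 0 ≤ (1 - (p : ℝ) ^ (-(1 / 4) : ℝ))⁻¹ := inv_nonneg.2 (by linarith)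
    calc _ ≤ 2 * (p : ℝ)⁻¹ * ((p : ℝ) ^ (-(1 / 4) : ℝ) * 7) := by gcongr
      _ = _ := by ring
  refine summable_of_sum_le (c := Real.exp (∑' n : ℕ, 14 * (n : ℝ) ^ (-(5 / 4) : ℝ))) hg0 fun u => ?_
  obtain ⟨M, hM⟩ := u.exists_nat_subset_range
  obtain ⟨hs1, hs2⟩ :=
    EulerProduct.summable_and_hasSum_smoothNumbers_prod_primesBelow_tsum hg1 hgm hgs M
  have h0 : g 0 = 0 := by simp [hg]
  calc ∑ n ∈ u, g n ≤ ∏ p ∈ M.primesBelow, ∑' n, g (p ^ n) := by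
        rw [← hs2.tsum_eq, _root_.tsum_subtype]
        have h1 : ∑ n ∈ u, g n = ∑ n ∈ u, M.smoothNumbers.indicator g n := by
          refine Finset.sum_congr rfl fun n hn => ?_
          rcases Nat.eq_zero_or_pos n with rfl | h2
          · rw [h0, Set.indicator_apply]; simp [h0]
          · rw [Set.indicator_of_mem]
            exact Nat.mem_smoothNumbers_of_lt h2 (Finset.mem_range.1 (hM hn))
        rw [h1]
        have h2 : Summable (M.smoothNumbers.indicator g) :=
          summable_subtype_iff_indicator.1 hs2.summable
        have h3 : ∀ n, 0 ≤ M.smoothNumbers.indicator g n :=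
          Set.indicator_nonneg fun n _ => hg0 n
        exact h2.sum_le_tsum u fun n _ => h3 n
    _ ≤ ∏ p ∈ M.primesBelow, Real.exp (14 * (p : ℝ) ^ (-(5 / 4) : ℝ)) :=
        Finset.prod_le_prod (fun p _ => tsum_nonneg fun n => hg0 _) fun p hp =>
          hloc p (Nat.prime_of_mem_primesBelow hp)
    _ = Real.exp (∑ p ∈ M.primesBelow, 14 * (p : ℝ) ^ (-(5 / 4) : ℝ)) := (Real.exp_sum _ _).symm
    _ ≤ _ := by
        gcongr
        exact (hz.mul_left 14).sum_le_tsum _ fun n _ => by positivity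

theorem summable_totientCorrection_mul_inv :
    Summable fun n : ℕ => ‖totientCorrection n * (n : ℝ)⁻¹‖ := by
  refine Summable.of_nonneg_of_le (fun _ => norm_nonneg _) (fun n => ?_)
    summable_abs_totientCorrection_mul
  rcases Nat.eq_zero_or_pos n with rfl | hn
  · simp
  have h1 : (1 : ℝ) ≤ n := by exact_mod_cast hn
  rw [norm_mul, Real.norm_eq_abs, Real.norm_of_nonneg (by positivity), ← Real.rpow_neg_one]
  gcongr
  norm_num

theorem tsum_totientCorrection_mul_density :
    (∑' n : ℕ, totientCorrection n * (n : ℝ)⁻¹) * squarefreeDensity = 1 := by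
  have h1 := EulerProduct.eulerProduct_hasProd (f := fun n : ℕ => totientCorrection n * (n : ℝ)⁻¹)
    (by simp [totientCorrection_one]) (fun {m n} h => by
      rw [isMultiplicative_totientCorrection.map_mul_of_coprime h, Nat.cast_mul, mul_inv]
      ring) summable_totientCorrection_mul_inv (by simp)
  have h2 := EulerProduct.eulerProduct_hasProd (f := fun a : ℕ => (moebius a : ℝ) * ((a : ℝ) ^ 2)⁻¹)
    (by simp) (fun {m n} h => by
      rw [isMultiplicative_moebius.map_mul_of_coprime h, Nat.cast_mul, mul_pow, mul_inv]
      push_cast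
      ring) summable_norm_moebius_mul_inv_sq (by simp)
  have h3 := h1.mul h2
  refine h3.unique ?_
  convert hasProd_one using 1
  funext p
  have hp : (p : ℕ).Prime := p.2
  have hp1 : (1 : ℝ) < (p : ℕ) := by exact_mod_cast hp.one_lt
  rw [(hasSum_totientCorrection_prime_pow hp).tsum_eq, tsum_eq_sum (s := Finset.range 2)]
  · rw [Finset.sum_range_succ, Finset.sum_range_one, pow_zero, pow_one, moebius_apply_one,
      moebius_apply_prime hp]
    have h5 : 1 - (((p : ℕ) : ℝ) ^ 2)⁻¹ ≠ 0 := by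
      have : (((p : ℕ) : ℝ) ^ 2)⁻¹ < 1 := inv_lt_one_of_one_lt₀ (by nlinarith)
      linarith
    push_cast
    rw [one_pow, inv_one, one_mul, neg_one_mul, ← sub_eq_add_neg, inv_mul_cancel₀ h5]
  · intro k hk
    rw [Finset.mem_range, not_lt] at hk
    obtain ⟨j, rfl⟩ := Nat.exists_eq_add_of_le' hk
    rw [moebius_sq_prime_pow hp, zero_mul]

theorem sum_squarefreeTotientRatio {x : ℝ} :
    ∑ n ∈ Finset.Ioc 0 ⌊x⌋₊, squarefreeTotientRatio n =
      ∑ m ∈ Finset.Ioc 0 ⌊x⌋₊, totientCorrection m * squarefreeCount (x / m) := by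
  rw [← squarefreeIndicator_mul_totientCorrection, mul_comm, sum_Ioc_mul_eq_sum_sum]
  refine Finset.sum_congr rfl fun m _ => ?_
  rw [squarefreeCount, Nat.floor_div_natCast]
  simp_rw [squarefreeIndicator_apply]

theorem sum_squarefreeTotientRatio_sub {x : ℝ} (hx : 0 ≤ x) :
    HasSum (fun m : ℕ => totientCorrection m *
      (squarefreeCount (x / m) - squarefreeDensity * (x / m)))
      (∑ n ∈ Finset.Ioc 0 ⌊x⌋₊, squarefreeTotientRatio n - x) := by
  have h1 : HasSum (fun m : ℕ => totientCorrection m * squarefreeCount (x / m))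
      (∑ n ∈ Finset.Ioc 0 ⌊x⌋₊, squarefreeTotientRatio n) := by
    rw [sum_squarefreeTotientRatio]
    refine hasSum_sum_of_ne_finset_zero (L := SummationFilter.unconditional ℕ) fun m hm => ?_
    rw [Finset.mem_Ioc, not_and_or, not_lt, Nat.le_zero, not_le] at hm
    rcases hm with rfl | hm
    · simp
    · have hm0 : (0 : ℝ) < m := by exact_mod_cast (Nat.zero_le _).trans_lt hm
      rw [squarefreeCount, Nat.floor_eq_zero.2 ((div_lt_one hm0).2 ((Nat.floor_lt hx).1 hm))]
      simp
  have h2 := summable_totientCorrection_mul_inv.of_norm.hasSum.mul_right (squarefreeDensity * x)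
  have h3 : (∑' n : ℕ, totientCorrection n * (n : ℝ)⁻¹) * (squarefreeDensity * x) = x := by
    rw [← mul_assoc, tsum_totientCorrection_mul_density, one_mul]
  rw [h3] at h2
  convert h1.sub h2 using 1
  · rfl
  · funext m
    ring

theorem exists_abs_sum_squarefreeTotientRatio_sub_le : ∃ c C x₀ : ℝ, 0 < c ∧ c ≤ 1 / 8 ∧ 0 < C ∧
    ∀ x : ℝ, x₀ ≤ x → |∑ n ∈ Finset.Ioc 0 ⌊x⌋₊, squarefreeTotientRatio n - x| ≤
      C * √x * Real.exp (-(c * vkExponent x)) := by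
  obtain ⟨C₁, hC₁, H₁⟩ := exists_abs_squarefreeCount_sub_le
  obtain ⟨c, C₂, x₁, hc, hc1, hC₂, H₂⟩ := exists_abs_squarefreeCount_sub_le_exp
  have hev := (Filter.eventually_ge_atTop (1 : ℝ)).and
    ((tendsto_log_log_atTop.eventually_ge_atTop 1).and
      (((Real.tendsto_log_atTop.comp (Real.tendsto_log_atTop.atTop_div_const
        (by norm_num : (0 : ℝ) < 8))).eventually_ge_atTop 1).and
        ((Real.tendsto_log_atTop.eventually_ge_atTop 8).and
          ((tendsto_rpow_atTop (by norm_num : (0 : ℝ) < 1 / 2)).eventually_ge_atTop x₁))))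
  obtain ⟨x₀, hx₀⟩ := Filter.eventually_atTop.1 hev
  set Z := ∑' n : ℕ, |totientCorrection n| * (n : ℝ) ^ (-(1 / 4) : ℝ) with hZ
  have hZ0 : 0 ≤ Z := tsum_nonneg fun n => by positivity
  refine ⟨c / 8, (C₁ + C₂) * (Z + 1), x₀, by positivity, by linarith, by positivity, fun x hx => ?_⟩
  obtain ⟨hx1, hll, hl8, hL8, hxx⟩ := hx₀ x hx
  simp only [Function.comp_apply] at hl8
  have hx0 : 0 < x := by linarith
  have hVL := vkExponent_le_log hx1 hll
  have hV1 := one_le_vkExponent hx1 hll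
  have hcomp := fun z => vkExponent_le_of_rpow_le (y := z) hx1 hl8 hL8
  set V := vkExponent x
  set e := Real.exp (-(c / 8 * V)) with he
  have he0 : 0 < e := Real.exp_pos _
  have hsum := sum_squarefreeTotientRatio_sub hx0.le
  have hbound : ∀ m : ℕ, ‖totientCorrection m *
      (squarefreeCount (x / m) - squarefreeDensity * (x / m))‖ ≤
        (|totientCorrection m| * (m : ℝ) ^ (-(1 / 4) : ℝ)) * ((C₁ + C₂) * √x * e) := by
    intro m
    rcases Nat.eq_zero_or_pos m with rfl | hm
    · simp
    have hm1 : (1 : ℝ) ≤ m := by exact_mod_cast hm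
    have hm0 : (0 : ℝ) < m := by linarith
    rw [norm_mul, Real.norm_eq_abs, Real.norm_eq_abs, mul_assoc]
    gcongr
    have hsq : √(x / m) = √x * (m : ℝ) ^ (-(1 / 2) : ℝ) := by
      rw [Real.sqrt_div hx0.le, Real.sqrt_eq_rpow (m : ℝ), Real.rpow_neg hm0.le, div_eq_mul_inv]
    rcases le_total (m : ℝ) (x ^ (1 / 2 : ℝ)) with hmx | hmx
    · have h1 : x ^ (1 / 2 : ℝ) ≤ x / m := by
        rw [le_div_iff₀ hm0]
        calc x ^ (1 / 2 : ℝ) * m ≤ x ^ (1 / 2 : ℝ) * x ^ (1 / 2 : ℝ) := by gcongr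
          _ = x := by rw [← Real.rpow_add hx0]; norm_num
      have h2 := H₂ (x / m) (hxx.trans h1)
      have h3 := hcomp (x / m) ((Real.rpow_le_rpow_of_exponent_le hx1 (by norm_num)).trans h1)
      have h4 : Real.exp (-(c * vkExponent (x / m))) ≤ e := by
        rw [he, Real.exp_le_exp]
        nlinarith
      have h5 : (m : ℝ) ^ (-(1 / 2) : ℝ) ≤ (m : ℝ) ^ (-(1 / 4) : ℝ) :=
        Real.rpow_le_rpow_of_exponent_le hm1 (by norm_num)
      refine h2.trans ?_
      rw [hsq]
      calc C₂ * (√x * (m : ℝ) ^ (-(1 / 2) : ℝ)) * Real.exp (-(c * vkExponent (x / m)))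
          ≤ (C₁ + C₂) * (√x * (m : ℝ) ^ (-(1 / 4) : ℝ)) * e := by gcongr; linarith
        _ = _ := by ring
    · have h2 := H₁ (x / m) (by positivity)
      have h3 : (m : ℝ) ^ (-(1 / 2) : ℝ) ≤ (m : ℝ) ^ (-(1 / 4) : ℝ) * e := by
        have h4 : (m : ℝ) ^ (-(1 / 2) : ℝ) = (m : ℝ) ^ (-(1 / 4) : ℝ) * (m : ℝ) ^ (-(1 / 4) : ℝ) := by
          rw [← Real.rpow_add hm0]; norm_num
        rw [h4]
        gcongr
        calc (m : ℝ) ^ (-(1 / 4) : ℝ) ≤ (x ^ (1 / 2 : ℝ)) ^ (-(1 / 4) : ℝ) :=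
              Real.rpow_le_rpow_of_nonpos (by positivity) hmx (by norm_num)
          _ = Real.exp (-(1 / 8 * Real.log x)) := by
              rw [← Real.rpow_mul hx0.le, Real.rpow_def_of_pos hx0]
              ring_nf
          _ ≤ e := by
              rw [he, Real.exp_le_exp]
              nlinarith
      refine h2.trans ?_
      rw [hsq]
      calc C₁ * (√x * (m : ℝ) ^ (-(1 / 2) : ℝ))
          ≤ (C₁ + C₂) * (√x * ((m : ℝ) ^ (-(1 / 4) : ℝ) * e)) := by gcongr; linarith
        _ = _ := by ring
  have hfin := tsum_of_norm_bounded
    (summable_abs_totientCorrection_mul.hasSum.mul_right ((C₁ + C₂) * √x * e)) hbound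
  rw [hsum.tsum_eq, Real.norm_eq_abs, ← hZ] at hfin
  refine hfin.trans ?_
  have : 0 ≤ (C₁ + C₂) * √x * e := by positivity
  calc Z * ((C₁ + C₂) * √x * e) ≤ (Z + 1) * ((C₁ + C₂) * √x * e) := by gcongr; linarith
    _ = _ := by ring

end TotientRatio

section WeightedTails
open ArithmeticFunction

/-- A nonnegative, eventually decreasing weight `w` of size `O((log x + 1) / x²)` together with
the antiderivative `-F` of `w` for which `F` vanishes at infinity. -/
structure IsTailWeight (w F : ℝ → ℝ) : Prop where
  hasDerivAt : ∀ x, 2 ≤ x → HasDerivAt F (-(w x)) x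
  antitone : AntitoneOn w (Set.Ici 2)
  nonneg : ∀ n : ℕ, 0 ≤ w n
  weight_le : ∀ x, 2 ≤ x → w x ≤ (Real.log x + 1) / x ^ 2
  tail_nonneg : ∀ x, 2 ≤ x → 0 ≤ F x
  tail_le : ∀ x, 2 ≤ x → F x ≤ (Real.log x + 1) / x

theorem isTailWeight_inv_sq : IsTailWeight (fun x => 1 / x ^ 2) (fun x => 1 / x) where
  hasDerivAt x hx := by
    have h := hasDerivAt_inv (show x ≠ 0 by linarith)
    simpa [one_div] using h
  antitone x hx y hy hxy := by
    have : (0 : ℝ) < x := two_pos.trans_le hx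
    simp only
    gcongr
  nonneg n := by positivity
  weight_le x hx := by
    have := Real.log_nonneg (show 1 ≤ x by linarith)
    gcongr
    linarith
  tail_nonneg x hx := by positivity
  tail_le x hx := by
    have := Real.log_nonneg (show 1 ≤ x by linarith)
    gcongr
    linarith

theorem isTailWeight_log_div_sq :
    IsTailWeight (fun x => Real.log x / x ^ 2) (fun x => (Real.log x + 1) / x) where
  hasDerivAt x hx := by
    have hx0 : x ≠ 0 := by linarith
    refine (((Real.hasDerivAt_log hx0).add_const 1).div (hasDerivAt_id x) hx0).congr_deriv ?_
    simp only [id]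
    field_simp
    ring
  antitone := by
    have h := Real.log_div_self_rpow_antitoneOn (a := 2) two_pos
    simp only [Real.rpow_two] at h
    refine h.mono (Set.Ici_subset_Ici.2 ?_)
    have h1 : Real.exp (2⁻¹ : ℝ) ^ 2 ≤ 2 ^ 2 := by
      rw [← Real.exp_nat_mul]
      norm_num
      linarith [Real.exp_one_lt_d9]
    exact le_of_sq_le_sq h1 two_pos.le
  nonneg n := div_nonneg (Real.log_natCast_nonneg n) (by positivity)
  weight_le x hx := by
    gcongr
    linarith
  tail_nonneg x hx := by
    have := Real.log_nonneg (show 1 ≤ x by linarith)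
    positivity
  tail_le x _ := le_rfl

namespace IsTailWeight
variable {w F : ℝ → ℝ}

theorem tail_sub_le (h : IsTailWeight w F) {a b : ℝ} (ha : 2 ≤ a) (hab : a ≤ b) :
    w b * (b - a) ≤ F a - F b ∧ F a - F b ≤ w a * (b - a) := by
  rcases hab.eq_or_lt with rfl | hab
  · simp
  obtain ⟨c, ⟨hc1, hc2⟩, hc⟩ := exists_hasDerivAt_eq_slope F (fun x => -(w x)) hab
    (fun x hx => (h.hasDerivAt x (ha.trans hx.1)).continuousAt.continuousWithinAt)
    (fun x hx => h.hasDerivAt x (ha.trans hx.1.le))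
  have hba : 0 < b - a := sub_pos.2 hab
  have hF : F a - F b = w c * (b - a) := by
    rw [eq_div_iff hba.ne'] at hc
    linarith
  have hc0 : (2 : ℝ) ≤ c := ha.trans hc1.le
  have h1 := h.antitone hc0 (hc0.trans hc2.le) hc2.le
  have h2 := h.antitone ha hc0 hc1.le
  rw [hF]
  constructor <;> gcongr

theorem sum_Ioc_bounds (h : IsTailWeight w F) {N M : ℕ} (hN : 2 ≤ N) (hNM : N ≤ M) :
    F (N + 1) - F (M + 1) ≤ ∑ i ∈ Finset.Ioc N M, w i ∧
      ∑ i ∈ Finset.Ioc N M, w i ≤ F N - F M := by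
  induction M, hNM using Nat.le_induction with
  | base => simp
  | succ M hNM ih =>
    have hM : (2 : ℝ) ≤ M := by exact_mod_cast hN.trans hNM
    have h1 := (h.tail_sub_le hM (b := M + 1) (by linarith)).1
    have h2 := (h.tail_sub_le (a := M + 1) (b := M + 1 + 1) (by linarith) (by linarith)).2
    rw [Finset.sum_Ioc_succ_top hNM]
    push_cast
    constructor <;> linarith [ih.1, ih.2]

theorem tendsto_tail (h : IsTailWeight w F) :
    Filter.Tendsto (fun M : ℕ => F (M + 1)) Filter.atTop (nhds 0) := by
  have h1 : Filter.Tendsto (fun x : ℝ => (Real.log x + 1) / x) Filter.atTop (nhds 0) := by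
    have h2 := (Real.isLittleO_log_id_atTop.tendsto_div_nhds_zero).add tendsto_inv_atTop_zero
    rw [add_zero] at h2
    refine h2.congr fun x => ?_
    simp only [id]
    ring
  have h3 : Filter.Tendsto (fun M : ℕ => (M : ℝ) + 1) Filter.atTop Filter.atTop :=
    Filter.tendsto_atTop_add_const_right _ _ tendsto_natCast_atTop_atTop
  refine squeeze_zero' ?_ ?_ (h1.comp h3)
  · filter_upwards [h3.eventually_ge_atTop 2] with M hM using h.tail_nonneg _ hM
  · filter_upwards [h3.eventually_ge_atTop 2] with M hM using h.tail_le _ hM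

end IsTailWeight

theorem squarefreeTotientRatio_nonneg (n : ℕ) : 0 ≤ squarefreeTotientRatio n := by
  rw [squarefreeTotientRatio_apply]
  positivity

theorem exists_abs_sum_Ioc_squarefreeTotientRatio_sub_one_le : ∃ c C x₀ : ℝ, 0 < c ∧ c ≤ 1 / 8 ∧
    0 < C ∧ ∀ x : ℝ, x₀ ≤ x → ∀ n : ℕ, ⌊x⌋₊ < n →
      |∑ i ∈ Finset.Ioc ⌊x⌋₊ n, (squarefreeTotientRatio i - 1)| ≤
        C * Real.exp (-(c * vkExponent x)) / √x * n := by
  obtain ⟨c, C, x₁, hc, hc1, hC, H⟩ := exists_abs_sum_squarefreeTotientRatio_sub_le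
  obtain ⟨x₂, hx₂⟩ := Filter.eventually_atTop.1 ((Filter.eventually_ge_atTop (1 : ℝ)).and
    ((tendsto_log_log_atTop.eventually_ge_atTop 1).and (Filter.eventually_ge_atTop x₁)))
  refine ⟨c, 2 * C + 1, x₂, hc, hc1, by positivity, fun x hx n hn => ?_⟩
  obtain ⟨hx1, hll, hxx⟩ := hx₂ x hx
  have hx0 : 0 < x := by linarith
  have hxn : x ≤ n := ((Nat.floor_lt hx0.le).1 hn).le
  have hV := vkExponent_mono hx1 hll hxn
  have hVL := vkExponent_le_log hx1 hll
  have hV1 := one_le_vkExponent hx1 hll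
  have h1 := H x hxx
  have h2 := H n (hxx.trans hxn)
  rw [Nat.floor_natCast] at h2
  set e := Real.exp (-(c * vkExponent x)) with he
  have he0 : 0 < e := Real.exp_pos _
  have he1 : Real.exp (-(c * vkExponent n)) ≤ e := by
    rw [he, Real.exp_le_exp]
    nlinarith
  have hs : √x ≤ √n := Real.sqrt_le_sqrt hxn
  have hs0 : 0 < √x := Real.sqrt_pos.2 hx0
  have h3 : 1 ≤ √x * e := by
    rw [he, Real.sqrt_eq_rpow, Real.rpow_def_of_pos hx0, ← Real.exp_add]
    refine Real.one_le_exp ?_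
    nlinarith
  have h4 : ∑ i ∈ Finset.Ioc ⌊x⌋₊ n, (squarefreeTotientRatio i - 1) =
      (∑ i ∈ Finset.Ioc 0 n, squarefreeTotientRatio i - n) -
        (∑ i ∈ Finset.Ioc 0 ⌊x⌋₊, squarefreeTotientRatio i - x) - (x - ⌊x⌋₊) := by
    rw [Finset.sum_sub_distrib, ← Finset.sum_Ioc_consecutive _ (Nat.zero_le _) hn.le]
    simp only [Finset.sum_const, Nat.card_Ioc, nsmul_eq_mul, mul_one]
    rw [Nat.cast_sub hn.le]
    ring
  have h5 : |x - ⌊x⌋₊| ≤ 1 := by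
    rw [abs_of_nonneg (sub_nonneg.2 (Nat.floor_le hx0.le))]
    linarith [Nat.lt_floor_add_one x]
  have h6 : √x * √n ≤ n := by
    calc √x * √n ≤ √n * √n := by gcongr
      _ = n := Real.mul_self_sqrt (Nat.cast_nonneg n)
  calc _ ≤ C * √n * Real.exp (-(c * vkExponent n)) + C * √x * e + 1 := by
        rw [h4]
        exact (abs_sub _ _).trans (add_le_add ((abs_sub _ _).trans (add_le_add h2 h1)) h5)
    _ ≤ C * √n * e + C * √n * e + √n * e := by
        gcongr
        exact h3.trans (by gcongr)
    _ = (2 * C + 1) * e / √x * (√x * √n) := by field_simp; ring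
    _ ≤ _ := by gcongr

end WeightedTails

section TailAsymptotics
open ArithmeticFunction

theorem exists_log_mul_exp_le {c : ℝ} (hc : 0 < c) : ∃ C : ℝ, 0 < C ∧ ∀ x : ℝ, 1 ≤ x →
    1 ≤ Real.log (Real.log x) → (Real.log x + 1) * Real.exp (-(c * vkExponent x)) ≤
      C * Real.exp (-(c / 2 * vkExponent x)) := by
  obtain ⟨C, hC, H⟩ := exists_rpow_le_exp (5 / 2) (half_pos hc)
  refine ⟨2 * C, by positivity, fun x hx hll => ?_⟩
  have h1 : 1 ≤ Real.log x :=
    (Real.one_le_exp zero_le_one).trans (one_le_log_of_one_le_log_log hx hll)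
  have h2 : Real.log x ≤ vkExponent x ^ (5 / 2 : ℝ) := by
    calc Real.log x = (Real.log x ^ (2 / 5 : ℝ)) ^ (5 / 2 : ℝ) := by
          rw [← Real.rpow_mul (by linarith)]
          norm_num
      _ ≤ _ := Real.rpow_le_rpow (by positivity) (log_rpow_le_vkExponent hx hll) (by norm_num)
  have h3 := H _ (one_le_vkExponent hx hll)
  calc (Real.log x + 1) * Real.exp (-(c * vkExponent x))
      ≤ 2 * (C * Real.exp (c / 2 * vkExponent x)) * Real.exp (-(c * vkExponent x)) := by
        gcongr
        linarith
    _ = 2 * C * (Real.exp (c / 2 * vkExponent x) * Real.exp (-(c * vkExponent x))) := by ring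
    _ = _ := by
        rw [← Real.exp_add]
        ring_nf

theorem summable_of_sum_Ioc_le {g : ℕ → ℝ} (hg : ∀ n, 0 ≤ g n) (N : ℕ) {B : ℝ}
    (h : ∀ M, ∑ i ∈ Finset.Ioc N M, g i ≤ B) : Summable g := by
  rw [← summable_nat_add_iff (N + 1)]
  refine summable_of_sum_range_le (c := B) (fun n => hg _) fun n => ?_
  have h1 := h (N + n)
  rw [sum_Ioc_add_eq_sum_range] at h1
  simpa [add_comm] using h1

theorem tendsto_sum_Ioc_floor {g : ℕ → ℝ} (hg : Summable g) {x : ℝ} (hx : 0 ≤ x) :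
    Filter.Tendsto (fun M => ∑ i ∈ Finset.Ioc ⌊x⌋₊ M, g i) Filter.atTop
      (nhds (∑' n : {n : ℕ // x < (n : ℝ)}, g n)) := by
  have hz : ∀ i : ℕ, (i : ℝ) ≤ x → {n : ℕ | x < (n : ℝ)}.indicator g i = 0 := fun i hi =>
    Set.indicator_of_notMem (s := {n : ℕ | x < (n : ℝ)}) (not_lt.2 hi) _
  have h0 := hz 0 (by simpa using hx)
  have h1 := tendsto_sum_Ioc (hg.indicator {n : ℕ | x < (n : ℝ)}) h0 ⌊x⌋₊
  rw [Finset.sum_eq_zero (s := Finset.Ioc 0 ⌊x⌋₊), sub_zero, ← _root_.tsum_subtype] at h1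
  · refine h1.congr fun M => Finset.sum_congr rfl fun i hi => ?_
    exact Set.indicator_of_mem (s := {n : ℕ | x < (n : ℝ)}) ((Nat.floor_lt hx).1 (Finset.mem_Ioc.1 hi).1) _
  · exact fun i hi => hz i ((Nat.le_floor_iff hx).1 (Finset.mem_Ioc.1 hi).2)

/-- The asymptotic formula for the tails of `∑ (μ²(n) n / φ(n)) w(n)`. -/
theorem exists_abs_tail_sub_le : ∃ c C x₀ : ℝ, 0 < c ∧ 0 < C ∧ ∀ w F : ℝ → ℝ,
    IsTailWeight w F → Summable (fun n : ℕ => squarefreeTotientRatio n * w n) ∧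
      ∀ x : ℝ, x₀ ≤ x →
        |∑' n : {n : ℕ // x < (n : ℝ)}, squarefreeTotientRatio n * w n - F x| ≤
          C / (x ^ (3 / 2 : ℝ) * Real.exp (c * vkExponent x)) := by
  obtain ⟨c, C₁, x₁, hc, hc1, hC₁, H₁⟩ := exists_abs_sum_Ioc_squarefreeTotientRatio_sub_one_le
  obtain ⟨C₂, hC₂, H₂⟩ := exists_log_mul_exp_le hc
  obtain ⟨x₀, hx₀⟩ := Filter.eventually_atTop.1 ((Filter.eventually_ge_atTop (4 : ℝ)).and
    ((tendsto_log_log_atTop.eventually_ge_atTop 1).and (Filter.eventually_ge_atTop x₁)))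
  refine ⟨c / 2, (4 * C₁ + 4) * C₂, x₀, by positivity, by positivity, fun w F h => ?_⟩
  have key : ∀ x, x₀ ≤ x → ∀ M, ⌊x⌋₊ ≤ M →
      |∑ i ∈ Finset.Ioc ⌊x⌋₊ M, squarefreeTotientRatio i * w i -
        ∑ i ∈ Finset.Ioc ⌊x⌋₊ M, w i| ≤
        C₁ * Real.exp (-(c * vkExponent x)) / √x * (4 * (Real.log x + 1) / x) := by
    intro x hx M hM
    obtain ⟨hx4, hll, hxx⟩ := hx₀ x hx
    have hx0 : 0 < x := by linarith
    have hN := Nat.floor_le hx0.le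
    have hN1 := Nat.lt_floor_add_one x
    have hN2 : 2 ≤ ⌊x⌋₊ := Nat.le_floor (by norm_num; linarith)
    have hN3 : (2 : ℝ) ≤ ⌊x⌋₊ := by exact_mod_cast hN2
    have hlog : Real.log ⌊x⌋₊ ≤ Real.log x := Real.log_le_log (by linarith) hN
    have hlog0 := Real.log_nonneg (show (1 : ℝ) ≤ x by linarith)
    have h1 := abs_sum_Ioc_mul_le (w := fun i => w i) (by positivity) (H₁ x hxx)
      (fun m n hm hmn => h.antitone (show (2 : ℝ) ≤ m by exact_mod_cast hN2.trans hm.le)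
        (show (2 : ℝ) ≤ n by exact_mod_cast hN2.trans (hm.le.trans hmn)) (by exact_mod_cast hmn))
      (fun n _ => h.nonneg n) M
    simp only [sub_mul, one_mul, Finset.sum_sub_distrib] at h1
    refine h1.trans ?_
    gcongr
    have h2 := (h.sum_Ioc_bounds hN2 hM).2
    have h3 := h.tail_nonneg M (by exact_mod_cast hN2.trans hM)
    have h4 := h.tail_le _ hN3
    have h5 : w (⌊x⌋₊ + 1 : ℕ) ≤ (Real.log ⌊x⌋₊ + 1) / (⌊x⌋₊ : ℝ) ^ 2 := by
      refine (h.antitone hN3 ?_ ?_).trans (h.weight_le _ hN3)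
      · push_cast
        exact hN3.trans (by linarith)
      · push_cast
        linarith
    have h6 : (⌊x⌋₊ : ℝ) * w (⌊x⌋₊ + 1 : ℕ) ≤ (Real.log ⌊x⌋₊ + 1) / ⌊x⌋₊ := by
      calc (⌊x⌋₊ : ℝ) * w (⌊x⌋₊ + 1 : ℕ)
          ≤ (⌊x⌋₊ : ℝ) * ((Real.log ⌊x⌋₊ + 1) / (⌊x⌋₊ : ℝ) ^ 2) := by gcongr
        _ = _ := by field_simp
    have h7 : (Real.log ⌊x⌋₊ + 1) / ⌊x⌋₊ ≤ (Real.log x + 1) / (x / 2) := by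
      gcongr
      linarith
    have h8 : 4 * (Real.log x + 1) / x = 2 * ((Real.log x + 1) / (x / 2)) := by
      field_simp
      ring
    rw [h8]
    linarith
  have hnn : ∀ n : ℕ, 0 ≤ squarefreeTotientRatio n * w n := fun n =>
    mul_nonneg (squarefreeTotientRatio_nonneg n) (h.nonneg n)
  have hsum : Summable fun n : ℕ => squarefreeTotientRatio n * w n := by
    have hx4 := (hx₀ x₀ le_rfl).1
    have hN2 : 2 ≤ ⌊x₀⌋₊ := Nat.le_floor (by norm_num; linarith)
    refine summable_of_sum_Ioc_le hnn ⌊x₀⌋₊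
      (B := F ⌊x₀⌋₊ + C₁ * Real.exp (-(c * vkExponent x₀)) / √x₀ * (4 * (Real.log x₀ + 1) / x₀))
      fun M => ?_
    have hlog0 := Real.log_nonneg (show (1 : ℝ) ≤ x₀ by linarith)
    have hF := h.tail_nonneg ⌊x₀⌋₊ (by exact_mod_cast hN2)
    rcases le_total M ⌊x₀⌋₊ with hM | hM
    · rw [Finset.Ioc_eq_empty (by lia), Finset.sum_empty]
      positivity
    · have h1 := (abs_le.1 (key x₀ le_rfl M hM)).2
      have h2 := (h.sum_Ioc_bounds hN2 hM).2
      have h3 := h.tail_nonneg M (by exact_mod_cast hN2.trans hM)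
      linarith
  refine ⟨hsum, fun x hx => ?_⟩
  obtain ⟨hx4, hll, hxx⟩ := hx₀ x hx
  have hx0 : 0 < x := by linarith
  have hN := Nat.floor_le hx0.le
  have hN1 := Nat.lt_floor_add_one x
  have hN2 : 2 ≤ ⌊x⌋₊ := Nat.le_floor (by norm_num; linarith)
  have hN3 : (2 : ℝ) ≤ ⌊x⌋₊ := by exact_mod_cast hN2
  have hlim := tendsto_sum_Ioc_floor hsum hx0.le
  have hVL := vkExponent_le_log (by linarith) hll
  have hV1 := one_le_vkExponent (by linarith) hll
  have hL := H₂ x (by linarith) hll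
  have hlog : Real.log ⌊x⌋₊ ≤ Real.log x := Real.log_le_log (by linarith) hN
  have hlog0 := Real.log_nonneg (show (1 : ℝ) ≤ x by linarith)
  have hs0 : 0 < √x := Real.sqrt_pos.2 hx0
  have hss : √x * √x = x := Real.mul_self_sqrt hx0.le
  set e := Real.exp (-(c * vkExponent x)) with he
  set E := C₁ * e / √x * (4 * (Real.log x + 1) / x) with hE
  have hw : w ⌊x⌋₊ ≤ e / √x * (4 * (Real.log x + 1) / x) := by
    have h1 : 1 ≤ √x * e := by
      rw [he, Real.sqrt_eq_rpow, Real.rpow_def_of_pos hx0, ← Real.exp_add]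
      refine Real.one_le_exp ?_
      nlinarith
    calc w ⌊x⌋₊ ≤ (Real.log ⌊x⌋₊ + 1) / (⌊x⌋₊ : ℝ) ^ 2 := h.weight_le _ hN3
      _ ≤ (Real.log x + 1) / (x / 2) ^ 2 := by
          gcongr
          linarith
      _ = 1 * (4 * (Real.log x + 1) / x) / x := by
          field_simp
          ring
      _ ≤ (√x * e) * (4 * (Real.log x + 1) / x) / x := by gcongr
      _ = (√x * e) * (4 * (Real.log x + 1) / x) / (√x * √x) := by rw [hss]
      _ = _ := by field_simp
  have hup : ∑' n : {n : ℕ // x < (n : ℝ)}, squarefreeTotientRatio n * w n ≤ F ⌊x⌋₊ + E := by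
    refine le_of_tendsto hlim ?_
    filter_upwards [Filter.eventually_ge_atTop ⌊x⌋₊] with M hM
    have h1 := (abs_le.1 (key x hx M hM)).2
    have h2 := (h.sum_Ioc_bounds hN2 hM).2
    have h3 := h.tail_nonneg M (by exact_mod_cast hN2.trans hM)
    linarith
  have hlo : F (⌊x⌋₊ + 1) - E ≤ ∑' n : {n : ℕ // x < (n : ℝ)}, squarefreeTotientRatio n * w n := by
    have h0 := (h.tendsto_tail.const_sub (F (⌊x⌋₊ + 1) - E))
    rw [sub_zero] at h0
    refine le_of_tendsto_of_tendsto h0 hlim ?_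
    filter_upwards [Filter.eventually_ge_atTop ⌊x⌋₊] with M hM
    have h1 := (abs_le.1 (key x hx M hM)).1
    have h2 := (h.sum_Ioc_bounds hN2 hM).1
    linarith
  have hwn := h.nonneg ⌊x⌋₊
  have hF1 : F ⌊x⌋₊ - F x ≤ w ⌊x⌋₊ := by
    refine (h.tail_sub_le hN3 hN).2.trans (mul_le_of_le_one_right hwn (by linarith))
  have hF2 : F x - F (⌊x⌋₊ + 1) ≤ w ⌊x⌋₊ := by
    refine (h.tail_sub_le (by linarith) hN1.le).2.trans ?_
    have h1 := h.antitone hN3 (show (2 : ℝ) ≤ x by linarith) hN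
    exact (mul_le_mul h1 (by linarith) (by linarith) hwn).trans_eq (mul_one _)
  have hfin : |∑' n : {n : ℕ // x < (n : ℝ)}, squarefreeTotientRatio n * w n - F x| ≤
      E + w ⌊x⌋₊ := by
    rw [abs_le]
    constructor <;> linarith
  refine hfin.trans ?_
  have hx32 : x ^ (3 / 2 : ℝ) = √x * x := by
    rw [Real.sqrt_eq_rpow, ← Real.rpow_add_one hx0.ne']
    norm_num
  calc E + w ⌊x⌋₊ ≤ E + e / √x * (4 * (Real.log x + 1) / x) := by gcongr
    _ = (4 * C₁ + 4) * ((Real.log x + 1) * e) / (√x * x) := by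
        rw [hE]
        field_simp
    _ ≤ (4 * C₁ + 4) * (C₂ * Real.exp (-(c / 2 * vkExponent x))) / (√x * x) := by gcongr
    _ = _ := by
        rw [hx32, Real.exp_neg]
        field_simp

theorem exists_forall_abs_tail_sub_le : ∃ c : ℝ, 0 < c ∧ ∀ w F : ℝ → ℝ, IsTailWeight w F →
    ∃ C : ℝ, 0 < C ∧ ∀ x : ℝ, 3 ≤ x →
      |∑' n : {n : ℕ // x < (n : ℝ)}, squarefreeTotientRatio n * w n - F x| ≤
        C / (x ^ (3 / 2 : ℝ) * Real.exp (c * vkExponent x)) := by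
  obtain ⟨c, C, x₀, hc, hC, H⟩ := exists_abs_tail_sub_le
  refine ⟨c, hc, fun w F h => ?_⟩
  obtain ⟨hsum, H⟩ := H w F h
  have hnn : ∀ n : ℕ, 0 ≤ squarefreeTotientRatio n * w n := fun n =>
    mul_nonneg (squarefreeTotientRatio_nonneg n) (h.nonneg n)
  set S := ∑' n : ℕ, squarefreeTotientRatio n * w n with hS
  have hS0 : 0 ≤ S := tsum_nonneg hnn
  set D := max x₀ 3 ^ (3 / 2 : ℝ) * Real.exp (c * (Real.log (max x₀ 3) ^ (3 / 5 : ℝ) *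
    Real.log (Real.log 3) ^ (-(1 / 5) : ℝ))) with hD
  have hD0 : 0 < D := by positivity
  refine ⟨C + (S + 1) * D, by positivity, fun x hx => ?_⟩
  have hx0 : 0 < x := by linarith
  rcases le_total x₀ x with hxx | hxx
  · refine (H x hxx).trans ?_
    gcongr
    have : 0 ≤ (S + 1) * D := by positivity
    linarith
  have hl3 : 1 < Real.log 3 := by
    rw [Real.lt_log_iff_exp_lt (by norm_num)]
    linarith [Real.exp_one_lt_d9]
  have hll3 : 0 < Real.log (Real.log 3) := Real.log_pos hl3
  have hl : Real.log 3 ≤ Real.log x := Real.log_le_log (by norm_num) hx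
  have hden : x ^ (3 / 2 : ℝ) * Real.exp (c * vkExponent x) ≤ D := by
    have h1 : x ≤ max x₀ 3 := hxx.trans (le_max_left _ _)
    have h2 : Real.log (Real.log x) ^ (-(1 / 5) : ℝ) ≤ Real.log (Real.log 3) ^ (-(1 / 5) : ℝ) :=
      Real.rpow_le_rpow_of_nonpos hll3 (Real.log_le_log (by linarith) hl) (by norm_num)
    have h3 : 0 ≤ Real.log x := by linarith
    have h4 : Real.log x ^ (3 / 5 : ℝ) ≤ Real.log (max x₀ 3) ^ (3 / 5 : ℝ) :=
      Real.rpow_le_rpow h3 (Real.log_le_log hx0 h1) (by norm_num)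
    have h5 : 0 ≤ Real.log (Real.log x) := Real.log_nonneg (by linarith)
    have h6 := (Real.rpow_nonneg h3 _).trans h4
    rw [hD, vkExponent]
    gcongr
  have h1 : ∑' n : {n : ℕ // x < (n : ℝ)}, squarefreeTotientRatio n * w n ≤ S :=
    hsum.tsum_subtype_le (fun n : ℕ => squarefreeTotientRatio n * w n) _ hnn
  have h2 : 0 ≤ ∑' n : {n : ℕ // x < (n : ℝ)}, squarefreeTotientRatio n * w n :=
    tsum_nonneg fun n => hnn n
  have h3 := h.tail_nonneg x (by linarith)
  have h4 : F x ≤ 1 := by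
    refine (h.tail_le x (by linarith)).trans ((div_le_one hx0).2 ?_)
    linarith [Real.log_le_sub_one_of_pos hx0]
  calc _ ≤ S + 1 := by
        rw [abs_le]
        constructor <;> linarith
    _ = (S + 1) * D / D := by field_simp
    _ ≤ _ := by gcongr; linarith

end TailAsymptotics

end VinogradovKorobov

/-- tails of `∑ μ²(r)/(rφ(r))` and its logarithmic weight. -/
theorem tail_sums_over_r :
    ∃ c C : ℝ, 0 < c ∧ 0 < C ∧ ∀ R : ℝ, 3 ≤ R →
      (|(∑' r : {r : ℕ // R < (r : ℝ)},
            (ArithmeticFunction.moebius (r : ℕ) : ℝ) ^ 2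
              / (((r : ℕ) : ℝ) * (Nat.totient (r : ℕ) : ℝ)))
          - 1 / R|
        ≤ C / (R ^ ((3 : ℝ) / 2) *
            Real.exp (c * Real.log R ^ ((3 : ℝ) / 5) *
              Real.log (Real.log R) ^ (-(1 : ℝ) / 5))))
      ∧
      (|(∑' r : {r : ℕ // R < (r : ℝ)},
            (ArithmeticFunction.moebius (r : ℕ) : ℝ) ^ 2 * Real.log ((r : ℕ) : ℝ)
              / (((r : ℕ) : ℝ) * (Nat.totient (r : ℕ) : ℝ)))
          - (Real.log R + 1) / R|
        ≤ C / (R ^ ((3 : ℝ) / 2) *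
            Real.exp (c * Real.log R ^ ((3 : ℝ) / 5) *
              Real.log (Real.log R) ^ (-(1 : ℝ) / 5)))) := by
  obtain ⟨c, hc, H⟩ := VinogradovKorobov.exists_forall_abs_tail_sub_le
  obtain ⟨C₁, hC₁, H₁⟩ := H _ _ VinogradovKorobov.isTailWeight_inv_sq
  obtain ⟨C₂, hC₂, H₂⟩ := H _ _ VinogradovKorobov.isTailWeight_log_div_sq
  have hV : ∀ R : ℝ, c * Real.log R ^ ((3 : ℝ) / 5) * Real.log (Real.log R) ^ (-(1 : ℝ) / 5) =
      c * VinogradovKorobov.vkExponent R := fun R => by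
    rw [VinogradovKorobov.vkExponent, mul_assoc, neg_div]
  refine ⟨c, C₁ + C₂, hc, by positivity, fun R hR => ?_⟩
  have hR0 : 0 < R := by linarith
  rw [hV]
  constructor
  · have h : ∀ r : {r : ℕ // R < (r : ℝ)}, (ArithmeticFunction.moebius (r : ℕ) : ℝ) ^ 2
        / (((r : ℕ) : ℝ) * (Nat.totient (r : ℕ) : ℝ)) =
          VinogradovKorobov.squarefreeTotientRatio r * (1 / ((r : ℕ) : ℝ) ^ 2) := fun r => by
      have : ((r : ℕ) : ℝ) ≠ 0 := (hR0.trans r.2).ne'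
      rw [VinogradovKorobov.squarefreeTotientRatio_apply]
      field_simp
    rw [tsum_congr h]
    refine (H₁ R hR).trans ?_
    gcongr
    linarith
  · have h : ∀ r : {r : ℕ // R < (r : ℝ)},
        (ArithmeticFunction.moebius (r : ℕ) : ℝ) ^ 2 * Real.log ((r : ℕ) : ℝ)
        / (((r : ℕ) : ℝ) * (Nat.totient (r : ℕ) : ℝ)) =
          VinogradovKorobov.squarefreeTotientRatio r *
            (Real.log ((r : ℕ) : ℝ) / ((r : ℕ) : ℝ) ^ 2) := fun r => by
      have : ((r : ℕ) : ℝ) ≠ 0 := (hR0.trans r.2).ne'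
      rw [VinogradovKorobov.squarefreeTotientRatio_apply]
      field_simp
    rw [tsum_congr h]
    refine (H₂ R hR).trans ?_
    gcongr
    linarith
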